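/- arXiv:1902.06589 — 2 statements merged into one kernel-verified Lean document; each statement's English description precedes it below -/
import Mathlib

section
/- For every positive integer δ there exist a real number C = C(δ) and an integer N = N(δ) such that for every prime p > N, every prime power q = p^α (α ≥ 1 an integer), every integer n > 0, and every irreducible polynomial f ∈ F_q((t))[X,Y] of total degree δ, the number of pairs (x,y) ∈ (F_q[t]_n)² with f(x,y) = 0 is at most C · n² · q^{⌈n/δ⌉}. -/
section Irreducibles

open Polynomial

/-- A finite field with `q` elements has at least `q / 2` monic irreducible polynomials of each
positive degree. -/
theorem exists_card_eq_forall_irreducible (F : Type*) [Field F] [Fintype F] {k m : ℕ} (hm : 0 < m)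
    (hk : 2 * k ≤ Fintype.card F) (hq : 4 ≤ Fintype.card F) :
    ∃ T : Finset F[X], T.card = k ∧ ∀ π ∈ T, π.Monic ∧ Irreducible π ∧ π.natDegree = m := by
  classical
  set q := Fintype.card F with hqdef
  obtain ⟨p, hp⟩ := CharP.exists F
  have : Fact p.Prime := ⟨CharP.char_is_prime F p⟩
  have : NeZero m := ⟨hm.ne'⟩
  let E := FiniteField.Extension F p m
  have : Fintype E := Fintype.ofFinite E
  have hcardE : Fintype.card E = q ^ m := by
    rw [← Nat.card_eq_fintype_card, FiniteField.natCard_extension, Nat.card_eq_fintype_card]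
  have hdeg : ∀ x : E, (minpoly F x).natDegree ≤ m := fun x =>
    (minpoly.natDegree_le x).trans (FiniteField.finrank_extension F p m).le
  have hint : ∀ x : E, IsIntegral F x := fun x => Algebra.IsIntegral.isIntegral x
  let good : Finset E := {x | (minpoly F x).natDegree = m}
  let bad : ℕ → Finset E := fun j => {x | x ^ q ^ j = x}
  have hbad : ∀ j, 0 < j → (bad j).card ≤ q ^ j := fun j hj => by
    have hlt : 1 < q ^ j := Nat.one_lt_pow hj.ne' (by omega)
    have hne : (X ^ q ^ j - X : E[X]) ≠ 0 := FiniteField.X_pow_card_sub_X_ne_zero E hlt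
    have hsub : bad j ⊆ (X ^ q ^ j - X : E[X]).roots.toFinset := fun x hx => by
      rw [Multiset.mem_toFinset, mem_roots hne]
      simpa [bad, sub_eq_zero] using hx
    refine (Finset.card_le_card hsub).trans ((Multiset.toFinset_card_le _).trans ?_)
    exact (card_roots' _).trans (FiniteField.X_pow_card_sub_X_natDegree_eq E hlt).le
  have hcover : (Finset.univ : Finset E) ⊆ good ∪ (Finset.Ico 1 m).biUnion bad := fun x _ => by
    rw [Finset.mem_union, Finset.mem_biUnion]
    by_cases hx : (minpoly F x).natDegree = m
    · exact Or.inl (by simpa [good] using hx)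
    · refine Or.inr ⟨(minpoly F x).natDegree, Finset.mem_Ico.2
        ⟨minpoly.natDegree_pos (hint x), lt_of_le_of_ne (hdeg x) hx⟩, ?_⟩
      have hdvd : minpoly F x ∣ X ^ q ^ (minpoly F x).natDegree - X := by
        have := (minpoly.irreducible (hint x)).natDegree_dvd_iff_dvd_X_pow_card_pow_sub_X
          (n := (minpoly F x).natDegree)
        rw [Nat.card_eq_fintype_card] at this
        exact this.1 dvd_rfl
      have := aeval_eq_zero_of_dvd_aeval_eq_zero hdvd (minpoly.aeval F x)
      simpa [bad, sub_eq_zero] using this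
  have hfib : good.card ≤ m * (good.image (minpoly F)).card := by
    refine Finset.card_le_mul_card_image _ _ fun P hP => ?_
    obtain ⟨y, hy, rfl⟩ := Finset.mem_image.1 hP
    have hsub : ({x ∈ good | minpoly F x = minpoly F y} : Finset E) ⊆
        ((minpoly F y).aroots E).toFinset := fun x hx => by
      rw [Multiset.mem_toFinset, mem_aroots, ← (Finset.mem_filter.1 hx).2]
      exact ⟨minpoly.ne_zero (hint x), minpoly.aeval F x⟩
    refine (Finset.card_le_card hsub).trans ((Multiset.toFinset_card_le _).trans ?_)
    refine (card_roots' _).trans ?_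
    rw [natDegree_map]
    exact hdeg y
  have hsum : ∑ j ∈ Finset.Ico 1 m, q ^ j ≤ 2 * q ^ (m - 1) := by
    obtain ⟨n, rfl⟩ : ∃ n, m = n + 1 := ⟨m - 1, by omega⟩
    have h1 : ∑ j ∈ Finset.range n, q ^ j < q ^ n :=
      Nat.geomSum_lt (by omega) fun j hj => Finset.mem_range.1 hj
    have h2 : ∑ j ∈ Finset.Ico 1 (n + 1), q ^ j ≤ ∑ j ∈ Finset.range (n + 1), q ^ j :=
      Finset.sum_le_sum_of_subset fun j hj => by simp at hj ⊢; omega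
    rw [Finset.sum_range_succ] at h2
    simp only [Nat.add_sub_cancel]
    omega
  have htotal : q ^ m ≤ good.card + 2 * q ^ (m - 1) := by
    rw [← hcardE, ← Finset.card_univ]
    refine (Finset.card_le_card hcover).trans ((Finset.card_union_le _ _).trans ?_)
    refine Nat.add_le_add_left (Finset.card_biUnion_le.trans (le_trans ?_ hsum)) _
    exact Finset.sum_le_sum fun j hj => hbad j (Finset.mem_Ico.1 hj).1
  have hk' : k ≤ (good.image (minpoly F)).card := by
    refine Nat.le_of_mul_le_mul_left ((?_ : m * k ≤ good.card).trans hfib) hm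
    obtain ⟨n, rfl⟩ : ∃ n, m = n + 1 := ⟨m - 1, by omega⟩
    simp only [Nat.add_sub_cancel] at htotal
    have hn : n + 1 ≤ q ^ n := Nat.lt_pow_self (by omega)
    have : q ^ (n + 1) = q * q ^ n := pow_succ' q n
    nlinarith
  obtain ⟨T, hT, hTk⟩ := Finset.exists_subset_card_eq hk'
  refine ⟨T, hTk, fun π hπ => ?_⟩
  obtain ⟨x, hx, rfl⟩ := Finset.mem_image.1 (hT hπ)
  exact ⟨minpoly.monic (hint x), minpoly.irreducible (hint x), by simpa [good] using hx⟩

end Irreducibles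

section PlaneCurves

open MvPolynomial

/-- The exponents of total degree at most `N` in two variables. -/
noncomputable def exponentsLE (N : ℕ) : Finset (Fin 2 →₀ ℕ) :=
  ((Finset.range (N + 1)).sigma fun k => Finset.range (k + 1)).image
    fun x => Finsupp.single 0 x.2 + Finsupp.single 1 (x.1 - x.2)

lemma mem_exponentsLE {N : ℕ} {e : Fin 2 →₀ ℕ} : e ∈ exponentsLE N ↔ e.degree ≤ N := by
  simp only [exponentsLE, Finset.mem_image, Finset.mem_sigma, Finset.mem_range, Sigma.exists,
    Finsupp.degree_eq_sum, Fin.sum_univ_two]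
  constructor
  · rintro ⟨k, i, ⟨hk, hi⟩, rfl⟩
    simp
    omega
  · intro h
    refine ⟨e 0 + e 1, e 0, ⟨by omega, by omega⟩, ?_⟩
    ext i
    fin_cases i <;> simp

lemma two_mul_card_exponentsLE (N : ℕ) : 2 * (exponentsLE N).card = (N + 1) * (N + 2) := by
  rw [exponentsLE, Finset.card_image_of_injOn]
  · simp only [Finset.card_sigma, Finset.card_range]
    induction N with
    | zero => simp
    | succ N ih => rw [Finset.sum_range_succ, mul_add, ih]; ring
  · rintro ⟨k, i⟩ hx ⟨l, j⟩ hy h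
    simp only [Finset.coe_sigma, Set.mem_sigma_iff, Finset.coe_range, Set.mem_Iio] at hx hy
    have h0 := DFunLike.congr_fun h 0
    have h1 := DFunLike.congr_fun h 1
    simp at h0 h1
    obtain rfl : i = j := h0
    obtain rfl : k = l := by omega
    rfl

section Bezout

variable {K : Type*} [Field K]

lemma restrictTotalDegree_eq_restrictSupport (N : ℕ) :
    restrictTotalDegree (Fin 2) K N = restrictSupport K (exponentsLE N : Set (Fin 2 →₀ ℕ)) := by
  ext p
  rw [mem_restrictTotalDegree, mem_restrictSupport_iff, totalDegree, Finset.sup_le_iff]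
  simp only [Set.subset_def, Finset.mem_coe, mem_exponentsLE]
  rfl

instance finiteDimensional_restrictTotalDegree (N : ℕ) :
    FiniteDimensional K (restrictTotalDegree (Fin 2) K N) := by
  rw [restrictTotalDegree_eq_restrictSupport]
  exact Module.Finite.of_basis (basisRestrictSupport K _)

lemma two_mul_finrank_restrictTotalDegree (N : ℕ) :
    2 * Module.finrank K (restrictTotalDegree (Fin 2) K N) = (N + 1) * (N + 2) := by
  rw [restrictTotalDegree_eq_restrictSupport,
    Module.finrank_eq_card_basis (basisRestrictSupport K _), ← two_mul_card_exponentsLE]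
  simp

/-- Multiplication by a polynomial on polynomials of bounded degree. -/
noncomputable def mulRestrict (f : MvPolynomial (Fin 2) K) {M N : ℕ} (h : f.totalDegree + M ≤ N) :
    restrictTotalDegree (Fin 2) K M →ₗ[K] restrictTotalDegree (Fin 2) K N :=
  (LinearMap.mulLeft K f).restrict fun p hp => by
    rw [mem_restrictTotalDegree] at hp ⊢
    exact (totalDegree_mul _ _).trans (by omega)

@[simp] lemma coe_mulRestrict (f : MvPolynomial (Fin 2) K) {M N : ℕ}
    (h : f.totalDegree + M ≤ N) (p : restrictTotalDegree (Fin 2) K M) :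
    (mulRestrict f h p : MvPolynomial (Fin 2) K) = f * p := rfl

lemma exists_totalDegree_le_card_eval_eq_zero (S : Finset (Fin 2 → K)) (P : Fin 2 → K) :
    ∃ h : MvPolynomial (Fin 2) K, h.totalDegree ≤ S.card ∧ eval P h ≠ 0 ∧
      ∀ Q ∈ S, Q ≠ P → eval Q h = 0 := by
  classical
  have key : ∀ Q : Fin 2 → K, ∃ l : MvPolynomial (Fin 2) K, l.totalDegree ≤ 1 ∧ eval P l ≠ 0 ∧
      (Q ≠ P → eval Q l = 0) := by
    intro Q
    by_cases hQ : Q = P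
    · exact ⟨1, by simp, by simp, fun h => (h hQ).elim⟩
    · obtain ⟨i, hi⟩ := Function.ne_iff.1 hQ
      refine ⟨X i - C (Q i), (totalDegree_sub_C_le _ _).trans (totalDegree_X _).le, ?_, by simp⟩
      simpa [sub_eq_zero] using hi.symm
  choose l hl1 hl2 hl3 using key
  refine ⟨∏ Q ∈ S, l Q, ?_, ?_, ?_⟩
  · refine (totalDegree_finsetProd _ _).trans ((Finset.sum_le_sum fun Q _ => hl1 Q).trans ?_)
    simp
  · rw [map_prod, Finset.prod_ne_zero_iff]
    exact fun Q _ => hl2 Q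
  · intro Q hQ hne
    rw [map_prod]
    exact Finset.prod_eq_zero hQ (hl3 Q hne)

/-- Bezout's bound for the number of common zeros of an irreducible plane curve and a plane curve
not containing it. -/
theorem card_le_totalDegree_mul_totalDegree {f g : MvPolynomial (Fin 2) K} (hf : Irreducible f)
    (hfg : ¬ f ∣ g) (S : Finset (Fin 2 → K)) (hSf : ∀ P ∈ S, eval P f = 0)
    (hSg : ∀ P ∈ S, eval P g = 0) : S.card ≤ f.totalDegree * g.totalDegree := by
  classical
  set a := f.totalDegree with ha
  set b := g.totalDegree with hb
  set s := S.card with hs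
  let V : ℕ → Submodule K (MvPolynomial (Fin 2) K) := restrictTotalDegree (Fin 2) K
  let Φ : (V (b + s) × V (a + s)) →ₗ[K] V (a + b + s) :=
    (mulRestrict f (by omega)).coprod (mulRestrict g (by omega))
  let Ψ : V s →ₗ[K] (V (b + s) × V (a + s)) :=
    (mulRestrict (-g) (by rw [totalDegree_neg])).prod (mulRestrict f le_rfl)
  have hker : LinearMap.ker Φ ≤ LinearMap.range Ψ := by
    rintro ⟨u, v⟩ huv
    have huv' : f * (u : MvPolynomial (Fin 2) K) + g * v = 0 := congrArg Subtype.val huv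
    have hdvd : f ∣ g * (v : MvPolynomial (Fin 2) K) :=
      ⟨-u, by linear_combination huv'⟩
    obtain ⟨w, hw⟩ := (hf.prime.dvd_or_dvd hdvd).resolve_left hfg
    have hu : (u : MvPolynomial (Fin 2) K) = -g * w := by
      apply mul_left_cancel₀ hf.ne_zero
      rw [hw] at huv'
      linear_combination huv'
    have hws : w ∈ V s := by
      rw [mem_restrictTotalDegree]
      by_cases hw0 : w = 0
      · simp [hw0]
      · have hv := (mem_restrictTotalDegree _ _ _).1 v.2
        rw [hw, totalDegree_mul_of_isDomain hf.ne_zero hw0] at hv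
        omega
    exact ⟨⟨w, hws⟩, Prod.ext (Subtype.ext hu.symm) (Subtype.ext hw.symm)⟩
  let ev : V (a + b + s) →ₗ[K] (S → K) :=
    (LinearMap.pi fun P : S => (aeval (P : Fin 2 → K)).toLinearMap) ∘ₗ (V (a + b + s)).subtype
  have hev : ∀ p P, ev p P = eval (P : Fin 2 → K) (p : MvPolynomial (Fin 2) K) := fun p P => by
    simp [ev, aeval_eq_eval]
  have hrange : LinearMap.range Φ ≤ LinearMap.ker ev := by
    rintro _ ⟨⟨u, v⟩, rfl⟩
    ext P
    rw [hev]
    change eval (P : Fin 2 → K) (f * u + g * v) = 0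
    simp [hSf P P.2, hSg P P.2]
  have hsurj : LinearMap.range ev = ⊤ := by
    rw [eq_top_iff, ← (Pi.basisFun K S).span_eq, Submodule.span_le]
    rintro _ ⟨P, rfl⟩
    obtain ⟨h, h1, h2, h3⟩ := exists_totalDegree_le_card_eval_eq_zero S (P : Fin 2 → K)
    have hh : h ∈ V (a + b + s) := (mem_restrictTotalDegree _ _ _).2 (by omega)
    refine ⟨(eval (P : Fin 2 → K) h)⁻¹ • ⟨h, hh⟩, ?_⟩
    ext Q
    rw [map_smul, Pi.smul_apply, hev]
    by_cases hQ : Q = P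
    · subst hQ; simp [h2]
    · have : (Q : Fin 2 → K) ≠ P := fun h => hQ (Subtype.ext h)
      simp [h3 Q Q.2 this, hQ]
  have e1 := Φ.finrank_range_add_finrank_ker
  have e2 := ev.finrank_range_add_finrank_ker
  have e3 := Submodule.finrank_mono hker
  have e4 := Submodule.finrank_mono hrange
  have e5 := LinearMap.finrank_range_le Ψ
  rw [hsurj, finrank_top, Module.finrank_fintype_fun_eq_card, Fintype.card_coe] at e2
  rw [Module.finrank_prod] at e1
  have d1 : 2 * Module.finrank K (V (b + s)) = _ := two_mul_finrank_restrictTotalDegree _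
  have d2 : 2 * Module.finrank K (V (a + s)) = _ := two_mul_finrank_restrictTotalDegree _
  have d3 : 2 * Module.finrank K (V s) = _ := two_mul_finrank_restrictTotalDegree _
  have d4 : 2 * Module.finrank K (V (a + b + s)) = _ := two_mul_finrank_restrictTotalDegree _
  nlinarith

end Bezout

section Siegel

variable {F : Type*} [Field F]

instance finiteDimensional_degreeLT (n : ℕ) : FiniteDimensional F (Polynomial.degreeLT F n) :=
  Module.Finite.equiv (Polynomial.degreeLTEquiv F n).symm

lemma finrank_degreeLT (n : ℕ) : Module.finrank F (Polynomial.degreeLT F n) = n := by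
  rw [(Polynomial.degreeLTEquiv F n).finrank_eq, Module.finrank_fin_fun]

lemma finiteDimensional_quotient_span_singleton {P : Polynomial F} (hP : P ≠ 0) :
    FiniteDimensional F (Polynomial F ⧸ Ideal.span {P}) :=
  (AdjoinRoot.powerBasis hP).finite

/-- Siegel's lemma over `F[t]`: congruence conditions on a polynomial with prescribed support and
degree bounds on its coefficients have a nonzero solution if there are fewer conditions than
free parameters. -/
theorem exists_ne_zero_forall_dvd {σ ι : Type*} [Fintype ι] (M : Finset (σ →₀ ℕ))
    (B : (σ →₀ ℕ) → ℕ) (φ : ι → MvPolynomial σ (Polynomial F) →ₗ[F] Polynomial F)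
    (P : ι → Polynomial F) (hP : ∀ i, P i ≠ 0)
    (hcard : ∑ i, (P i).natDegree < ∑ e ∈ M, (B e + 1)) :
    ∃ h : MvPolynomial σ (Polynomial F), h ≠ 0 ∧ h.support ⊆ M ∧
      (∀ e, (h.coeff e).natDegree ≤ B e) ∧ ∀ i, P i ∣ φ i h := by
  classical
  have := fun i => finiteDimensional_quotient_span_singleton (hP i)
  let build : ((e : M) → Polynomial.degreeLT F (B e + 1)) →ₗ[F] MvPolynomial σ (Polynomial F) :=
    ∑ e : M, ((monomial (e : σ →₀ ℕ)).restrictScalars F) ∘ₗ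
      (Polynomial.degreeLT F (B e + 1)).subtype ∘ₗ LinearMap.proj e
  have hbuild : ∀ c, build c = ∑ e : M, monomial (e : σ →₀ ℕ) (c e : Polynomial F) := fun c => by
    simp [build]
  have hcoeff : ∀ c (e : M), (build c).coeff e = c e := fun c e => by
    rw [hbuild, coeff_sum, Finset.sum_eq_single e]
    · simp
    · intro e' _ hne
      rw [coeff_monomial, if_neg fun h => hne (Subtype.ext h)]
    · simp
  have hcoeff' : ∀ c, ∀ e ∉ M, (build c).coeff e = 0 := fun c e he => by
    rw [hbuild, coeff_sum]
    refine Finset.sum_eq_zero fun e' _ => ?_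
    rw [coeff_monomial, if_neg]
    rintro rfl
    exact he e'.2
  let Θ : ((e : M) → Polynomial.degreeLT F (B e + 1)) →ₗ[F]
      ((i : ι) → Polynomial F ⧸ Ideal.span {P i}) :=
    LinearMap.pi fun i => (Ideal.Quotient.mkₐ F (Ideal.span {P i})).toLinearMap ∘ₗ φ i ∘ₗ build
  have hlt : Module.finrank F ((i : ι) → Polynomial F ⧸ Ideal.span {P i}) <
      Module.finrank F ((e : M) → Polynomial.degreeLT F (B e + 1)) := by
    rw [Module.finrank_pi_fintype, Module.finrank_pi_fintype]
    simp only [finrank_degreeLT, finrank_quotient_span_eq_natDegree]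
    rwa [Finset.sum_coe_sort M fun e => B e + 1]
  obtain ⟨c, hc, hc0⟩ := Submodule.exists_mem_ne_zero_of_ne_bot
    (LinearMap.ker_ne_bot_of_finrank_lt (f := Θ) hlt)
  refine ⟨build c, ?_, ?_, ?_, ?_⟩
  · contrapose! hc0
    ext1 e
    apply Subtype.ext
    rw [← hcoeff, hc0]
    simp
  · intro e he
    by_contra h
    exact (mem_support_iff.1 he) (hcoeff' c e h)
  · intro e
    by_cases he : e ∈ M
    · rw [hcoeff c ⟨e, he⟩]
      have := Polynomial.mem_degreeLT.1 (c ⟨e, he⟩).2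
      by_cases h0 : (c ⟨e, he⟩ : Polynomial F) = 0
      · simp [h0]
      · have := (Polynomial.natDegree_lt_iff_degree_lt h0).2 this
        simp only at this
        omega
    · simp [hcoeff' c e he]
  · intro i
    have := congrFun hc i
    rwa [← Ideal.mem_span_singleton, ← Ideal.Quotient.eq_zero_iff_mem]

lemma natDegree_prod_pow_le {w : ℕ} {z : Fin 2 → Polynomial F} (hz : ∀ i, (z i).natDegree ≤ w)
    (e : Fin 2 →₀ ℕ) : (∏ i, z i ^ e i).natDegree ≤ w * e.degree := by
  refine (Polynomial.natDegree_prod_le _ _).trans ?_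
  rw [Finsupp.degree_eq_sum, Finset.mul_sum]
  refine Finset.sum_le_sum fun i _ => Polynomial.natDegree_pow_le.trans ?_
  rw [mul_comm]
  exact Nat.mul_le_mul_right _ (hz i)

lemma natDegree_eval_le {w E : ℕ} {h : MvPolynomial (Fin 2) (Polynomial F)}
    (hh : ∀ e ∈ h.support, (h.coeff e).natDegree + w * e.degree ≤ E)
    {z : Fin 2 → Polynomial F} (hz : ∀ i, (z i).natDegree ≤ w) : (eval z h).natDegree ≤ E := by
  rw [eval_eq']
  refine Polynomial.natDegree_sum_le_of_forall_le _ _ fun e he => ?_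
  refine Polynomial.natDegree_mul_le.trans (le_trans ?_ (hh e he))
  exact Nat.add_le_add_left (natDegree_prod_pow_le hz e) _

end Siegel

section Descent

lemma eval_map_apply {R A σ : Type*} [CommRing R] [CommRing A] (ι : R →+* A) (z : σ → R)
    (g : MvPolynomial σ R) : eval (fun i => ι (z i)) (map ι g) = ι (eval z g) := by
  rw [eval_map]
  exact (eval₂_comp_left ι (RingHom.id R) z g).symm

variable {F K : Type*} [Field F] [Field K]

/-- If polynomial points of degree at most `w` lie on a curve of degree `δ` over some extension,
then they lie on a curve of degree at most `δ` over `F[t]` whose coefficients have small degree. -/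
theorem exists_polynomial_coefficients {ι : Polynomial F →+* K} (hι : Function.Injective ι)
    {δ w : ℕ} (S : Set (Fin 2 → Polynomial F)) (hS : ∀ z ∈ S, ∀ i, (z i).natDegree ≤ w)
    {f : MvPolynomial (Fin 2) K} (hf : f ≠ 0) (hfδ : f.totalDegree ≤ δ)
    (hfS : ∀ z ∈ S, eval (fun i => ι (z i)) f = 0) :
    ∃ g : MvPolynomial (Fin 2) (Polynomial F), g ≠ 0 ∧ g.totalDegree ≤ δ ∧
      (∀ e, (g.coeff e).natDegree ≤ (exponentsLE δ).card * (δ * w)) ∧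
      ∀ z ∈ S, eval z g = 0 := by
  classical
  set M := exponentsLE δ with hM
  set B := M.card * (δ * w) with hB
  have heval : ∀ (h : MvPolynomial (Fin 2) K) (x : Fin 2 → K), h.support ⊆ M →
      eval x h = ∑ e : M, h.coeff e * ∏ i, x i ^ (e : Fin 2 →₀ ℕ) i := fun h x hh => by
    rw [eval_eq', Finset.sum_coe_sort M fun e => h.coeff e * ∏ i, x i ^ e i]
    refine Finset.sum_subset hh fun e _ he => ?_
    rw [notMem_support_iff.1 he, zero_mul]
  have hsupp : f.support ⊆ M := fun e he => mem_exponentsLE.2 ((le_totalDegree he).trans hfδ)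
  let v : (Fin 2 → Polynomial F) → (M → K) := fun z e => ∏ i, ι (z i) ^ (e : Fin 2 →₀ ℕ) i
  let func : (M → K) → ((M → K) →ₗ[K] K) := fun c => ∑ e : M, c e • LinearMap.proj e
  have hfunc : ∀ c x, func c x = ∑ e : M, c e * x e := fun c x => by simp [func]
  obtain ⟨b, hbS, hspan, hli⟩ := exists_linearIndependent K (v '' S)
  have hbfin : b.Finite := hli.setFinite
  have : Fintype b := hbfin.fintype
  have hbcard : Fintype.card b < M.card := by
    by_contra! hcon
    have htop : Submodule.span K b = ⊤ := by
      have := hli.span_eq_top_of_card_eq_finrank' (le_antisymm ?_ ?_)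
      · simpa using this
      · exact hli.fintype_card_le_finrank
      · simpa using hcon
    have hle : Submodule.span K b ≤ LinearMap.ker (func fun e => f.coeff e) := by
      rw [hspan, Submodule.span_le]
      rintro _ ⟨z, hz, rfl⟩
      rw [SetLike.mem_coe, LinearMap.mem_ker, hfunc]
      exact (heval f _ hsupp).symm.trans (hfS z hz)
    rw [htop] at hle
    apply hf
    ext e
    by_cases he : e ∈ M
    · have := hle (Submodule.mem_top (x := Pi.single (⟨e, he⟩ : M) (1 : K)))
      rw [LinearMap.mem_ker, hfunc, Finset.sum_eq_single ⟨e, he⟩] at this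
      · simpa using this
      · intro e' _ hne
        simp [hne]
      · simp
    · exact notMem_support_iff.1 fun h => he (hsupp h)
  have hpre : ∀ x : b, ∃ z ∈ S, v z = x := fun x => hbS x.2
  choose pt hptS hpt using hpre
  obtain ⟨g, hg0, hgM, hgB, hgd⟩ := exists_ne_zero_forall_dvd M (fun _ => B)
    (fun x : b => ((aeval (pt x)).toLinearMap :
      MvPolynomial (Fin 2) (Polynomial F) →ₗ[Polynomial F] Polynomial F).restrictScalars F)
    (fun _ => Polynomial.X ^ (B + δ * w + 1)) (fun _ => pow_ne_zero _ Polynomial.X_ne_zero) (by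
      simp only [Polynomial.natDegree_X_pow, Finset.sum_const, smul_eq_mul, Finset.card_univ]
      obtain ⟨k, hk⟩ := Nat.exists_eq_add_of_lt hbcard
      rw [hB, hk]
      nlinarith [Nat.zero_le ((k * Fintype.card b + (k + 1) ^ 2) * (δ * w))])
  have hgδ : ∀ e ∈ g.support, e.degree ≤ δ := fun e he => mem_exponentsLE.1 (hgM he)
  refine ⟨g, hg0, Finset.sup_le hgδ, hgB, ?_⟩
  have hpt0 : ∀ x : b, eval (pt x) g = 0 := fun x => by
    refine Polynomial.eq_zero_of_dvd_of_natDegree_lt (hgd x) ?_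
    rw [Polynomial.natDegree_X_pow]
    refine Nat.lt_succ_of_le (natDegree_eval_le (fun e he => ?_) (hS _ (hptS x)))
    have := Nat.mul_le_mul_left w (hgδ e he)
    have := hgB e
    rw [mul_comm δ w]
    omega
  have hmap : ∀ z, func (fun e => (g.map ι).coeff e) (v z) = ι (eval z g) := fun z => by
    rw [hfunc, ← heval (g.map ι) (fun i => ι (z i)) ((support_map_subset _ _).trans hgM),
      eval_map_apply]
  have hle : Submodule.span K (v '' S) ≤ LinearMap.ker (func fun e => (g.map ι).coeff e) := by
    rw [← hspan, Submodule.span_le]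
    intro x hx
    rw [SetLike.mem_coe, LinearMap.mem_ker]
    have h1 : v (pt ⟨x, hx⟩) = x := hpt ⟨x, hx⟩
    rw [← h1, hmap, hpt0, map_zero]
  intro z hz
  have := hle (Submodule.subset_span ⟨z, hz, rfl⟩)
  rw [LinearMap.mem_ker, hmap] at this
  exact (map_eq_zero_iff ι hι).1 this

end Descent

section Newton

variable {R A σ : Type*} [CommRing R] [CommRing A] [Algebra R A]

lemma exists_aeval_update_add [DecidableEq σ] (g : MvPolynomial σ R) (z : σ → A) (i : σ) (ε : A) :
    ∃ k, aeval (Function.update z i (z i + ε)) g =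
      aeval z g + ε * aeval z (pderiv i g) + ε ^ 2 * k := by
  induction g using MvPolynomial.induction_on with
  | C a => exact ⟨0, by simp⟩
  | add p q hp hq =>
    obtain ⟨k, hk⟩ := hp
    obtain ⟨l, hl⟩ := hq
    exact ⟨k + l, by simp only [map_add, hk, hl]; ring⟩
  | mul_X p j hp =>
    obtain ⟨k, hk⟩ := hp
    by_cases hj : j = i
    · subst hj
      refine ⟨aeval z (pderiv j p) + k * (z j + ε), ?_⟩
      simp only [map_mul, hk, aeval_X, Function.update_self, Derivation.leibniz, pderiv_X_self,
        map_add, smul_eq_mul, map_one]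
      ring
    · refine ⟨k * z j, ?_⟩
      simp only [map_mul, hk, aeval_X, Function.update_of_ne hj, Derivation.leibniz,
        pderiv_X_of_ne hj, map_add, smul_eq_mul, map_zero]
      ring

lemma aeval_sub_aeval_mem {I : Ideal A} {z z' : σ → A} (h : ∀ i, z i - z' i ∈ I)
    (g : MvPolynomial σ R) : aeval z g - aeval z' g ∈ I := by
  rw [← Ideal.Quotient.eq]
  have : (fun i => Ideal.Quotient.mkₐ R I (z i)) = fun i => Ideal.Quotient.mkₐ R I (z' i) :=
    funext fun i => Ideal.Quotient.eq.2 (h i)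
  have key : ∀ y : σ → A, Ideal.Quotient.mk I (aeval y g) =
      aeval (fun i => Ideal.Quotient.mkₐ R I (y i)) g := fun y => by
    rw [← comp_aeval]
    rfl
  rw [key, key, this]

/-- Newton approximation of a root in one variable of a multivariate polynomial. -/
lemma exists_aeval_update_mem_pow [DecidableEq σ] {I : Ideal A} (g : MvPolynomial σ R) (z : σ → A)
    (i : σ) (hz : aeval z g ∈ I) {d : A} (hd : d * aeval z (pderiv i g) - 1 ∈ I) (L : ℕ) :
    ∃ ψ, ψ - z i ∈ I ∧ aeval (Function.update z i ψ) g ∈ I ^ (L + 1) := by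
  induction L with
  | zero => exact ⟨z i, by simp, by simpa using hz⟩
  | succ L ih =>
    obtain ⟨ψ, hψ, hG⟩ := ih
    set z' := Function.update z i ψ with hz'
    have hGI : aeval z' g ∈ I := Ideal.pow_le_self (Nat.succ_ne_zero L) hG
    have hzz' : ∀ j, z' j - z j ∈ I := fun j => by
      by_cases hj : j = i
      · subst hj; simpa [hz'] using hψ
      · simp [hz', Function.update_of_ne hj]
    have hd' : d * aeval z' (pderiv i g) - 1 ∈ I := by
      have := I.add_mem (I.mul_mem_left d (aeval_sub_aeval_mem hzz' (pderiv i g))) hd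
      convert this using 1
      ring
    obtain ⟨k, hk⟩ := exists_aeval_update_add g z' i (-(d * aeval z' g))
    refine ⟨ψ - d * aeval z' g, ?_, ?_⟩
    · have := I.sub_mem hψ (I.mul_mem_left d hGI)
      convert this using 1
      ring
    · have hup : Function.update z i (ψ - d * aeval z' g) =
          Function.update z' i (z' i + -(d * aeval z' g)) := by
        simp [hz', sub_eq_add_neg]
      rw [hup, hk]
      have h1 : aeval z' g * (d * aeval z' (pderiv i g) - 1) ∈ I ^ (L + 1 + 1) := by
        rw [pow_succ]
        exact Ideal.mul_mem_mul hG hd'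
      have h2 : aeval z' g * aeval z' g ∈ I ^ (L + 1 + 1) := by
        rw [pow_succ]
        exact Ideal.mul_mem_mul hG hGI
      have := Ideal.add_mem _ (Ideal.neg_mem_iff _ |>.2 h1) (Ideal.mul_mem_left _ (d ^ 2 * k) h2)
      convert this using 1
      ring

/-- Uniqueness in Hensel's lemma: two approximate roots which agree modulo a prime at which the
partial derivative does not vanish agree to high order. -/
lemma pow_dvd_sub_of_dvd_eval [DecidableEq σ] [IsDomain R] [IsPrincipalIdealRing R] {π : R}
    (hπ : Irreducible π) {g : MvPolynomial σ R} {z : σ → R} {i : σ} {y : R} {L : ℕ}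
    (hz : π ^ L ∣ eval z g) (hy : π ^ L ∣ eval (Function.update z i y) g) (hyz : π ∣ y - z i)
    (hd : ¬ π ∣ eval z (pderiv i g)) : π ^ L ∣ y - z i := by
  obtain ⟨k, hk⟩ := exists_aeval_update_add (A := R) g z i (y - z i)
  rw [add_sub_cancel] at hk
  simp only [aeval_eq_eval] at hk
  have h1 : π ^ L ∣ (y - z i) * (eval z (pderiv i g) + (y - z i) * k) := by
    have := dvd_sub hy hz
    convert this using 1
    rw [hk]
    ring
  refine IsCoprime.dvd_of_dvd_mul_right (IsCoprime.pow_left ?_) h1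
  rw [hπ.coprime_iff_not_dvd]
  rwa [dvd_add_left (dvd_mul_of_dvd_left hyz _)]

end Newton

section Auxiliary

lemma sum_range_le_sum_exponents {δ D w : ℕ} (hD : δ ≤ D) {e₀ : Fin 2 →₀ ℕ} (he₀ : e₀.degree = δ) :
    ∑ j ∈ Finset.range (D - δ + 1), δ * (w * j + 1) ≤
      ∑ e ∈ exponentsLE D with ¬ e₀ ≤ e, (w * (D - e.degree) + 1) := by
  classical
  rw [Finsupp.degree_eq_sum, Fin.sum_univ_two] at he₀
  let φ : ℕ × ℕ → (Fin 2 →₀ ℕ) := fun x => if x.2 < e₀ 0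
    then Finsupp.single 0 x.2 + Finsupp.single 1 (D - x.1 - x.2)
    else Finsupp.single 0 (D - x.1 - (x.2 - e₀ 0)) + Finsupp.single 1 (x.2 - e₀ 0)
  have hφ0 : ∀ x, φ x 0 = if x.2 < e₀ 0 then x.2 else D - x.1 - (x.2 - e₀ 0) := fun x => by
    simp only [φ]; split_ifs <;> simp
  have hφ1 : ∀ x, φ x 1 = if x.2 < e₀ 0 then D - x.1 - x.2 else x.2 - e₀ 0 := fun x => by
    simp only [φ]; split_ifs <;> simp
  have hdeg : ∀ x ∈ Finset.range (D - δ + 1) ×ˢ Finset.range δ, (φ x).degree = D - x.1 := by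
    intro x hx
    simp only [Finset.mem_product, Finset.mem_range] at hx
    rw [Finsupp.degree_eq_sum, Fin.sum_univ_two, hφ0, hφ1]
    split_ifs <;> omega
  have hinj : Set.InjOn φ (Finset.range (D - δ + 1) ×ˢ Finset.range δ : Finset (ℕ × ℕ)) := by
    rintro ⟨j, r⟩ hx ⟨j', r'⟩ hx' h
    have h0 := DFunLike.congr_fun h 0
    have h1 := DFunLike.congr_fun h 1
    rw [hφ0, hφ0] at h0
    rw [hφ1, hφ1] at h1
    simp only [Finset.mem_coe, Finset.mem_product, Finset.mem_range] at hx hx'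
    simp only at h0 h1
    ext <;> simp only <;> split_ifs at h0 h1 <;> omega
  calc ∑ j ∈ Finset.range (D - δ + 1), δ * (w * j + 1)
      = ∑ x ∈ Finset.range (D - δ + 1) ×ˢ Finset.range δ, (w * x.1 + 1) := by
        rw [Finset.sum_product]; simp
    _ = ∑ x ∈ Finset.range (D - δ + 1) ×ˢ Finset.range δ, (w * (D - (φ x).degree) + 1) := by
        refine Finset.sum_congr rfl fun x hx => ?_
        rw [hdeg x hx]
        simp only [Finset.mem_product, Finset.mem_range] at hx
        rw [Nat.sub_sub_self (by omega)]
    _ = ∑ e ∈ (Finset.range (D - δ + 1) ×ˢ Finset.range δ).image φ, (w * (D - e.degree) + 1) :=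
        (Finset.sum_image (f := fun e : Fin 2 →₀ ℕ => w * (D - e.degree) + 1) hinj).symm
    _ ≤ _ := by
        refine Finset.sum_le_sum_of_subset fun e he => ?_
        obtain ⟨x, hx, rfl⟩ := Finset.mem_image.1 he
        rw [Finset.mem_filter, mem_exponentsLE, hdeg x hx]
        refine ⟨Nat.sub_le _ _, fun hle => ?_⟩
        have h0 := hle 0
        have h1 := hle 1
        rw [hφ0] at h0
        rw [hφ1] at h1
        simp only [Finset.mem_product, Finset.mem_range] at hx
        split_ifs at h0 h1 <;> omega

lemma conditions_lt_parameters {δ w m L : ℕ} (hδ : 0 < δ) (hw : 0 < w) (h1 : w + 1 ≤ δ * m)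
    (h2 : m ≤ w + 1) (hL : m * L ≤ w * (20 * δ * w) + m) :
    ∑ j : Fin L, m * (L - j) <
      ∑ j ∈ Finset.range (20 * δ * w - δ + 1), δ * (w * j + 1) := by
  have e1 : 2 * ∑ j : Fin L, m * (L - j) = m * (L * (L + 1)) := by
    rw [Fin.sum_univ_eq_sum_range (fun j => m * (L - j)), ← Finset.mul_sum,
      ← Finset.sum_range_reflect]
    have : ∀ n, 2 * ∑ j ∈ Finset.range n, (j + 1) = n * (n + 1) := fun n => by
      induction n with
      | zero => simp
      | succ n ih => rw [Finset.sum_range_succ, mul_add, ih]; ring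
    rw [mul_left_comm, ← this, Finset.sum_congr rfl]
    intro j hj
    rw [Finset.mem_range] at hj
    omega
  have e2 : ∀ J, 2 * ∑ j ∈ Finset.range (J + 1), δ * (w * j + 1) =
      δ * ((J + 1) * (w * J + 2)) := fun J => by
    induction J with
    | zero => simp; ring
    | succ n ih => rw [Finset.sum_range_succ, mul_add, ih]; ring
  have e3 := e2 (20 * δ * w - δ)
  obtain ⟨J, hJ⟩ : ∃ J, J = 20 * δ * w - δ := ⟨_, rfl⟩
  have hJ' : J + δ = 20 * δ * w := by
    have : δ ≤ 20 * δ * w := by nlinarith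
    omega
  rw [← hJ] at e3 ⊢
  suffices h : m * (m * (L * (L + 1))) < m * (δ * ((J + 1) * (w * J + 2))) by
    have := Nat.lt_of_mul_lt_mul_left h
    omega
  have hm : m * (m * (L * (L + 1))) ≤
      (w * (20 * δ * w) + m) * (w * (20 * δ * w) + m + m) := by
    calc m * (m * (L * (L + 1))) = (m * L) * (m * L + m) := by ring
      _ ≤ _ := Nat.mul_le_mul hL (Nat.add_le_add_right hL _)
  have hR : (w + 1) * (w * J ^ 2) ≤ m * (δ * ((J + 1) * (w * J + 2))) := by
    calc (w + 1) * (w * J ^ 2) ≤ (δ * m) * ((J + 1) * (w * J + 2)) :=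
          Nat.mul_le_mul h1 (by nlinarith)
      _ = _ := by ring
  refine lt_of_le_of_lt hm (lt_of_lt_of_le ?_ hR)
  have hm2 : m ≤ 2 * w := by omega
  have hstep : (w * (20 * δ * w) + m) * (w * (20 * δ * w) + m + m) ≤
      (w * (20 * δ * w) + 2 * w) * (w * (20 * δ * w) + 2 * w + 2 * w) := by gcongr
  refine lt_of_le_of_lt hstep ?_
  have hJZ : (J : ℤ) = δ * (20 * w - 1) := by
    have : (J : ℤ) + δ = 20 * δ * w := by exact_mod_cast hJ'
    linear_combination this
  zify
  rw [hJZ]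
  obtain ⟨u, rfl⟩ : ∃ u, w = u + 1 := ⟨w - 1, by omega⟩
  obtain ⟨d, rfl⟩ : ∃ d, δ = d + 1 := ⟨δ - 1, by omega⟩
  push_cast
  have hu : (0 : ℤ) ≤ u := Int.natCast_nonneg u
  have hd : (0 : ℤ) ≤ d := Int.natCast_nonneg d
  generalize (u : ℤ) = u at hu
  generalize (d : ℤ) = d at hd
  rw [← sub_pos]
  ring_nf
  positivity

variable {F : Type*} [Field F]

open Polynomial in
/-- All points of the curve `g = 0` of small degree that are congruent to a given point modulo a
prime at which a partial derivative of `g` is nonzero lie on an auxiliary curve of small degree. -/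
theorem exists_auxiliary_polynomial {π : F[X]} (hπ : Irreducible π) {δ w : ℕ} (hδ : 0 < δ)
    (hw : 0 < w) (h1 : w + 1 ≤ δ * π.natDegree) (h2 : π.natDegree ≤ w + 1)
    {g : MvPolynomial (Fin 2) F[X]} (hg : g.totalDegree = δ) (i : Fin 2) {c : Fin 2 → F[X]}
    (hc : eval c g = 0) (hd : ¬ π ∣ eval c (pderiv i g)) :
    ∃ h : MvPolynomial (Fin 2) F[X], h ≠ 0 ∧ h.totalDegree ≤ 20 * δ * w ∧
      (∀ e ∈ h.support, ¬ MonomialOrder.degLex.degree g ≤ e) ∧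
      ∀ z : Fin 2 → F[X], (∀ j, (z j).natDegree ≤ w) → (∀ j, π ∣ z j - c j) → eval z g = 0 →
        eval z h = 0 := by
  classical
  set m := π.natDegree with hm
  set D := 20 * δ * w with hD
  have hm0 : 0 < m := Nat.pos_of_ne_zero fun h => by simp [h] at h1
  obtain ⟨L, hL⟩ : ∃ L, L = w * D / m := ⟨_, rfl⟩
  let I : Ideal F[X][X] := Ideal.span {Polynomial.C π, Polynomial.X}
  have hCπ : Polynomial.C π ∈ I := Ideal.subset_span (by simp)
  have hX : (Polynomial.X : F[X][X]) ∈ I := Ideal.subset_span (by simp)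
  let Z₀ : Fin 2 → F[X][X] :=
    Function.update (fun j => Polynomial.C (c j) + Polynomial.X) i (Polynomial.C (c i))
  have hZ₀ : ∀ j, Z₀ j - algebraMap F[X] F[X][X] (c j) ∈ I := fun j => by
    by_cases hj : j = i
    · subst hj; simp [Z₀, Polynomial.algebraMap_eq]
    · simpa [Z₀, Function.update_of_ne hj, Polynomial.algebraMap_eq] using hX
  have hval : ∀ p : MvPolynomial (Fin 2) F[X], aeval Z₀ p - Polynomial.C (eval c p) ∈ I := by
    intro p
    have := aeval_sub_aeval_mem hZ₀ p
    have hcomp : MvPolynomial.aeval (fun j => algebraMap F[X] F[X][X] (c j)) p =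
        algebraMap F[X] F[X][X] (MvPolynomial.aeval c p) :=
      MvPolynomial.aeval_algebraMap_apply F[X][X] c p
    rwa [hcomp, aeval_eq_eval] at this
  obtain ⟨a, b, hab⟩ : IsCoprime π (eval c (pderiv i g)) := hπ.coprime_iff_not_dvd.2 hd
  have hunit : Polynomial.C b * aeval Z₀ (pderiv i g) - 1 ∈ I := by
    have := I.sub_mem (I.mul_mem_left (Polynomial.C b) (hval (pderiv i g)))
      (I.mul_mem_left (Polynomial.C a) hCπ)
    convert this using 1
    have hab' := congrArg (Polynomial.C (R := F[X])) hab
    simp only [map_add, map_mul, map_one] at hab'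
    linear_combination hab'
  obtain ⟨ψ, hψ, hψg⟩ := exists_aeval_update_mem_pow (I := I) g Z₀ i
    (by simpa [hc] using hval g) hunit L
  set Z := Function.update Z₀ i ψ with hZ
  obtain ⟨h, hh0, hhM, hhB, hhd⟩ := exists_ne_zero_forall_dvd
    ((exponentsLE D).filter fun e => ¬ MonomialOrder.degLex.degree g ≤ e)
    (fun e => w * (D - e.degree))
    (fun j : Fin (L + 1) => ((Polynomial.lcoeff F[X] j) ∘ₗ
      (aeval Z : MvPolynomial (Fin 2) F[X] →ₐ[F[X]] F[X][X]).toLinearMap).restrictScalars F)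
    (fun j => π ^ (L + 1 - j)) (fun j => pow_ne_zero _ hπ.ne_zero) (by
      refine lt_of_lt_of_le ?_ (sum_range_le_sum_exponents (δ := δ) ?_ ?_)
      · simp only [Polynomial.natDegree_pow]
        simp only [mul_comm _ π.natDegree]
        refine conditions_lt_parameters hδ hw h1 h2 ?_
        rw [hL, ← hm, mul_add, mul_one]
        exact Nat.add_le_add_right (Nat.mul_div_le _ _) _
      · rw [hD]; nlinarith
      · rw [degree_degLexDegree, hg])
  have hdeg : ∀ e ∈ h.support, e.degree ≤ D := fun e he =>
    mem_exponentsLE.1 (Finset.mem_filter.1 (hhM he)).1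
  refine ⟨h, hh0, Finset.sup_le hdeg, fun e he => (Finset.mem_filter.1 (hhM he)).2, ?_⟩
  intro z hzw hzc hzg
  let θ : F[X][X] →ₐ[F[X]] F[X] := Polynomial.aeval (z (1 - i) - c (1 - i))
  have hθX : π ∣ θ Polynomial.X := by simpa [θ] using hzc (1 - i)
  have hθC : ∀ r, θ (Polynomial.C r) = r := fun r => by simp [θ]
  have hθI : I ≤ Ideal.comap θ (Ideal.span {π}) := by
    rw [Ideal.span_le]
    rintro _ (rfl | rfl)
    · simp [hθC]
    · simpa [Ideal.mem_span_singleton] using hθX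
  have hθpow : ∀ p ∈ I ^ (L + 1), π ^ (L + 1) ∣ θ p := fun p hp => by
    have := Ideal.le_comap_pow θ (L + 1) (Ideal.pow_right_mono hθI (L + 1) hp)
    rwa [Ideal.mem_comap, Ideal.span_singleton_pow, Ideal.mem_span_singleton] at this
  have hθZ : (fun j => θ (Z j)) = Function.update z i (θ ψ) := by
    ext1 j
    by_cases hj : j = i
    · subst hj; simp [hZ]
    · obtain rfl : j = 1 - i := by omega
      rw [hZ, Function.update_of_ne hj, Function.update_of_ne hj]
      simp only [Z₀, Function.update_of_ne hj, map_add, hθC]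
      simp [θ]
  have hθeval : ∀ p : MvPolynomial (Fin 2) F[X],
      θ (aeval Z p) = eval (Function.update z i (θ ψ)) p := fun p => by
    rw [← hθZ, ← aeval_eq_eval, ← AlgHom.comp_apply, comp_aeval]
  have hψc : π ∣ θ ψ - c i := by
    have := hθI hψ
    rw [Ideal.mem_comap, Ideal.mem_span_singleton] at this
    simpa [Z₀, hθC] using this
  have hψz : π ∣ θ ψ - z i := by
    have := dvd_sub hψc (hzc i)
    rwa [sub_sub_sub_cancel_right] at this
  have hdz : ¬ π ∣ eval z (pderiv i g) := fun hdvd => hd <| by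
    have := aeval_sub_aeval_mem (R := F[X]) (I := Ideal.span {π})
      (fun j => Ideal.mem_span_singleton.2 (hzc j)) (pderiv i g)
    rw [Ideal.mem_span_singleton] at this
    simp only [aeval_eq_eval] at this
    exact (dvd_sub_right hdvd).1 this
  have hclose : π ^ (L + 1) ∣ θ ψ - z i := by
    refine pow_dvd_sub_of_dvd_eval hπ (g := g) ?_ ?_ hψz hdz
    · rw [hzg]; exact dvd_zero _
    · rw [← hθeval]; exact hθpow _ hψg
  have hZh : π ^ (L + 1) ∣ eval (Function.update z i (θ ψ)) h := by
    rw [← hθeval]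
    simp only [θ]
    rw [Polynomial.aeval_eq_sum_range]
    refine Finset.dvd_sum fun j _ => ?_
    rw [smul_eq_mul]
    have hXj : π ^ j ∣ (z (1 - i) - c (1 - i)) ^ j := pow_dvd_pow_of_dvd (hzc _) j
    by_cases hj : j < L + 1
    · have := mul_dvd_mul (hhd ⟨j, hj⟩) hXj
      rw [← pow_add, Nat.sub_add_cancel hj.le] at this
      exact this
    · exact Dvd.dvd.mul_left ((pow_dvd_pow _ (by omega)).trans hXj) _
  have hzh : π ^ (L + 1) ∣ eval z h := by
    have := aeval_sub_aeval_mem (R := F[X]) (I := Ideal.span {π ^ (L + 1)})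
      (z := Function.update z i (θ ψ)) (z' := z) (fun j => by
        by_cases hj : j = i
        · subst hj; simpa [Ideal.mem_span_singleton] using hclose
        · simp [Function.update_of_ne hj]) h
    rw [Ideal.mem_span_singleton] at this
    simp only [aeval_eq_eval] at this
    exact (dvd_sub_right hZh).1 this
  refine Polynomial.eq_zero_of_dvd_of_natDegree_lt hzh ?_
  rw [Polynomial.natDegree_pow]
  refine lt_of_le_of_lt (natDegree_eval_le (E := w * D) (fun e he => ?_) hzw) ?_
  · refine (Nat.add_le_add_right (hhB e) _).trans ?_
    rw [← mul_add, Nat.sub_add_cancel (hdeg e he)]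
  · rw [← hm, hL, mul_comm _ m]
    exact Nat.lt_mul_div_succ _ hm0

end Auxiliary

section Reduction

/-- The Schwartz–Zippel bound for two variables, in cardinality form. -/
lemma card_zeros_le_totalDegree_mul {R : Type*} [CommRing R] [IsDomain R]
    {f : MvPolynomial (Fin 2) R} (hf : f ≠ 0) (S : Finset R) (Z : Finset (Fin 2 → R))
    (hS : ∀ P ∈ Z, ∀ i, P i ∈ S) (hZ : ∀ P ∈ Z, eval P f = 0) :
    Z.card ≤ f.totalDegree * S.card := by
  classical
  rcases S.eq_empty_or_nonempty with rfl | hne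
  · have : Z = ∅ := Finset.eq_empty_of_forall_notMem fun P hP => by simpa using hS P hP 0
    simp [this]
  have hpos : (0 : ℚ≥0) < S.card := by exact_mod_cast hne.card_pos
  have h := schwartz_zippel_totalDegree hf S
  rw [div_le_div_iff₀ (by positivity) hpos] at h
  have h' : Z.card ≤ ({P ∈ Fintype.piFinset fun _ : Fin 2 => S | eval P f = 0} : Finset _).card :=
    Finset.card_le_card fun P hP => by
      simpa [Fintype.mem_piFinset, hZ P hP] using ⟨hS P hP 0, hS P hP 1⟩
  refine h'.trans ?_
  have h2 : (({P ∈ Fintype.piFinset fun _ : Fin 2 => S | eval P f = 0} : Finset _).card : ℚ≥0)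
      ≤ f.totalDegree * S.card := by
    refine le_of_mul_le_mul_right (h.trans_eq ?_) hpos
    ring
  exact_mod_cast h2

lemma totalDegree_map_of_injective {σ R A : Type*} [CommSemiring R] [CommSemiring A]
    {ι : R →+* A} (hι : Function.Injective ι) (g : MvPolynomial σ R) :
    (map ι g).totalDegree = g.totalDegree := by
  rw [totalDegree, totalDegree, support_map_of_injective g hι]

lemma not_map_dvd_map {R A : Type*} [CommRing R] [CommRing A] [IsDomain A]
    {ι : R →+* A} (hι : Function.Injective ι) {g h : MvPolynomial (Fin 2) R} (hh : h ≠ 0)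
    (hgh : ∀ e ∈ h.support, ¬ MonomialOrder.degLex.degree g ≤ e) : ¬ map ι g ∣ map ι h := by
  rintro ⟨c, hc⟩
  have hh' : map ι h ≠ 0 := fun h0 => hh (map_injective ι hι (by simpa using h0))
  have hg0 : map ι g ≠ 0 := by rintro h0; simp [h0] at hc; exact hh' (by simpa using hc)
  have hc0 : c ≠ 0 := by rintro rfl; simp at hc; exact hh' (by simpa using hc)
  have hmem := MonomialOrder.degLex.degree_mem_support hh'
  have hdeg := MonomialOrder.degLex.degree_mul hg0 hc0
  rw [support_map_of_injective h hι] at hmem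
  refine hgh _ hmem ?_
  rw [hc, hdeg]
  have : MonomialOrder.degLex.degree (map ι g) = MonomialOrder.degLex.degree g := by
    rw [MonomialOrder.degree, MonomialOrder.degree, support_map_of_injective g hι]
  rw [this]
  exact le_self_add

lemma totalDegree_pderiv_lt {σ R : Type*} [CommRing R] {f : MvPolynomial σ R} {i : σ}
    (h : pderiv i f ≠ 0) : (pderiv i f).totalDegree < f.totalDegree := by
  classical
  have key : ∀ e ∈ (pderiv i f).support, e.degree + 1 ≤ f.totalDegree := by
    intro e he
    rw [mem_support_iff, coeff_pderiv] at he
    have h1 : e + Finsupp.single i 1 ∈ f.support :=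
      mem_support_iff.2 fun h0 => he (by rw [h0, zero_mul])
    have h2 := le_totalDegree h1
    have h3 : (e + Finsupp.single i 1).degree = e.degree + 1 := by
      rw [map_add, Finsupp.degree_single]
    rw [← h3]
    exact h2
  obtain ⟨e, he⟩ := support_nonempty.2 h
  refine (Finset.sup_lt_iff ?_).2 fun e he => key e he
  exact lt_of_lt_of_le (Nat.succ_pos _) (key e he)

lemma exists_pderiv_ne_zero {σ R : Type*} [CommRing R] [IsDomain R] {p : ℕ} [CharP R p]
    {f : MvPolynomial σ R} (h0 : 0 < f.totalDegree) (hp : f.totalDegree < p) :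
    ∃ i, pderiv i f ≠ 0 := by
  classical
  have hf : f ≠ 0 := by rintro rfl; simp at h0
  obtain ⟨e, he, hed⟩ := f.support.exists_mem_eq_sup (support_nonempty.2 hf)
    (fun e => e.sum fun _ k => k)
  change f.totalDegree = e.degree at hed
  obtain ⟨i, hi⟩ : ∃ i, e i ≠ 0 := by
    by_contra! hall
    have : e = 0 := Finsupp.ext hall
    rw [this] at hed
    simp at hed
    omega
  have hle : e i ≤ e.degree := Finsupp.le_degree i e
  refine ⟨i, fun h => ?_⟩
  have hc := congrArg (coeff (e - Finsupp.single i 1)) h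
  have hadd : e - Finsupp.single i 1 + Finsupp.single i 1 = e :=
    tsub_add_cancel_of_le (Finsupp.single_le_iff.2 (Nat.one_le_iff_ne_zero.2 hi))
  rw [coeff_pderiv, hadd, coeff_zero, mul_eq_zero] at hc
  rcases hc with hc | hc
  · exact mem_support_iff.1 he hc
  · have h1 : (((e - Finsupp.single i 1 : σ →₀ ℕ) i : ℕ) : R) + 1 = (e i : R) := by
      have := congrArg (fun u : σ →₀ ℕ => ((u i : ℕ) : R)) hadd
      simpa using this
    rw [h1, CharP.cast_eq_zero_iff R p] at hc
    have := Nat.le_of_dvd (Nat.pos_of_ne_zero hi) hc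
    omega

/-- A nonzero polynomial has few distinct monic irreducible factors of a given degree. -/
lemma card_mul_le_natDegree_of_forall_dvd {F : Type*} [Field F] {m : ℕ} {a : Polynomial F}
    (ha : a ≠ 0) (T : Finset (Polynomial F))
    (hT : ∀ π ∈ T, π.Monic ∧ Irreducible π ∧ π.natDegree = m) (hd : ∀ π ∈ T, π ∣ a) :
    T.card * m ≤ a.natDegree := by
  have hprod : ∏ π ∈ T, π ∣ a := by
    refine Finset.prod_dvd_of_coprime (fun π hπ ρ hρ hne => ?_) hd
    refine ((hT π hπ).2.1.coprime_iff_not_dvd).2 fun hdvd => hne ?_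
    exact Polynomial.eq_of_monic_of_associated (hT π hπ).1 (hT ρ hρ).1
      ((hT π hπ).2.1.associated_of_dvd (hT ρ hρ).2.1 hdvd)
  refine le_trans (le_of_eq ?_) (Polynomial.natDegree_le_of_dvd hprod ha)
  rw [Polynomial.natDegree_prod_of_monic _ _ fun π hπ => (hT π hπ).1,
    Finset.sum_congr rfl fun π hπ => (hT π hπ).2.2]
  simp

end Reduction

section Counting

variable {F K : Type*} [Field F] [Field K] {ι : Polynomial F →+* K}

/-- Bézout's bound for points with polynomial coordinates. -/
lemma card_le_of_not_dvd_map (hι : Function.Injective ι) {f : MvPolynomial (Fin 2) K}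
    (hf : Irreducible f) {h : MvPolynomial (Fin 2) (Polynomial F)} (hfh : ¬ f ∣ map ι h)
    (S : Finset (Fin 2 → Polynomial F)) (hSf : ∀ z ∈ S, eval (fun i => ι (z i)) f = 0)
    (hSh : ∀ z ∈ S, eval z h = 0) : S.card ≤ f.totalDegree * h.totalDegree := by
  classical
  have hinj : Function.Injective fun (z : Fin 2 → Polynomial F) (i : Fin 2) => ι (z i) :=
    fun z z' h => funext fun i => hι (congrFun h i)
  rw [← totalDegree_map_of_injective hι h, ← Finset.card_image_of_injective S hinj]
  refine card_le_totalDegree_mul_totalDegree hf hfh _ ?_ ?_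
  · simpa [Finset.forall_mem_image] using hSf
  · simp only [Finset.forall_mem_image]
    intro z hz
    rw [eval_map_apply, hSh z hz, map_zero]

lemma card_le_of_forall_not_dvd_pderiv [Fintype F] (hι : Function.Injective ι)
    {π : Polynomial F} (hπ : Irreducible π) {δ w : ℕ} (hδ : 0 < δ) (hw : 0 < w)
    (h1 : w + 1 ≤ δ * π.natDegree) (h2 : π.natDegree ≤ w + 1)
    {g : MvPolynomial (Fin 2) (Polynomial F)} (hg : g.totalDegree = δ)
    (hirr : Irreducible (map ι g)) (i : Fin 2) (S : Finset (Fin 2 → Polynomial F))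
    (hSw : ∀ z ∈ S, ∀ j, (z j).natDegree ≤ w) (hSg : ∀ z ∈ S, eval z g = 0)
    (hSd : ∀ z ∈ S, ¬ π ∣ eval z (pderiv i g)) :
    S.card ≤ (δ * (20 * δ * w)) * (δ * Fintype.card F ^ π.natDegree) := by
  classical
  have : Fact (Irreducible π) := ⟨hπ⟩
  let B := AdjoinRoot.powerBasis hπ.ne_zero
  have : Module.Finite F (AdjoinRoot π) := B.finite
  have : Finite (AdjoinRoot π) := Module.finite_of_finite F
  have : Fintype (AdjoinRoot π) := Fintype.ofFinite _
  have hcard : Fintype.card (AdjoinRoot π) = Fintype.card F ^ π.natDegree := by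
    rw [Module.card_eq_pow_finrank (K := F), B.finrank, AdjoinRoot.powerBasis_dim]
  let φ : (Fin 2 → Polynomial F) → Fin 2 → AdjoinRoot π := fun z j => AdjoinRoot.mk π (z j)
  have hfib : ∀ b ∈ S.image φ, (S.filter fun z => φ z = b).card ≤ δ * (20 * δ * w) := by
    intro b hb
    obtain ⟨c, hcS, rfl⟩ := Finset.mem_image.1 hb
    obtain ⟨h, hh0, hhd, hhs, hhz⟩ := exists_auxiliary_polynomial hπ hδ hw h1 h2 hg i
      (hSg c hcS) (hSd c hcS)
    have hle := card_le_of_not_dvd_map hι hirr (not_map_dvd_map hι hh0 hhs)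
      (S.filter fun z => φ z = φ c) (fun z hz => ?_) (fun z hz => ?_)
    · rw [totalDegree_map_of_injective hι, hg] at hle
      exact hle.trans (Nat.mul_le_mul_left _ hhd)
    · rw [eval_map_apply, hSg z (Finset.mem_filter.1 hz).1, map_zero]
    · obtain ⟨hzS, hzc⟩ := Finset.mem_filter.1 hz
      exact hhz z (hSw z hzS) (fun j => AdjoinRoot.mk_eq_mk.1 (congrFun hzc j)) (hSg z hzS)
  refine (Finset.card_le_mul_card_image S _ hfib).trans (Nat.mul_le_mul_left _ ?_)
  rcases S.eq_empty_or_nonempty with rfl | ⟨c, hcS⟩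
  · simp
  have hg0 : map (AdjoinRoot.mk π) g ≠ 0 := by
    intro h0
    apply hSd c hcS
    rw [← AdjoinRoot.mk_eq_zero, ← eval_map_apply, ← pderiv_map, h0]
    simp
  have hle := card_zeros_le_totalDegree_mul hg0 Finset.univ (S.image φ) (by simp) (by
    simp only [Finset.forall_mem_image]
    intro z hz
    change eval (fun j => AdjoinRoot.mk π (z j)) _ = 0
    rw [eval_map_apply, hSg z hz, map_zero])
  rw [Finset.card_univ, hcard] at hle
  refine hle.trans (Nat.mul_le_mul_right _ ?_)
  rw [← hg]
  exact Finset.sup_mono (support_map_subset _ _)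

/-- The number of irreducible moduli used to separate the points of a curve of degree `δ`. -/
noncomputable def moduliCount (δ : ℕ) : ℕ := ((exponentsLE δ).card + 1) * δ ^ 2 + 1

lemma natDegree_eval_pderiv_le {δ w D : ℕ} {g : MvPolynomial (Fin 2) (Polynomial F)}
    (hg : g.totalDegree ≤ δ) (hD : ∀ e, (g.coeff e).natDegree ≤ D) (i : Fin 2)
    {z : Fin 2 → Polynomial F} (hz : ∀ j, (z j).natDegree ≤ w) :
    (eval z (pderiv i g)).natDegree ≤ D + w * δ := by
  refine natDegree_eval_le (fun e he => ?_) hz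
  have hlt := totalDegree_pderiv_lt (f := g) (i := i) (by rintro h; simp [h] at he)
  have hed : e.degree ≤ (pderiv i g).totalDegree := le_totalDegree he
  refine add_le_add ?_ (Nat.mul_le_mul_left _ (by omega))
  rw [coeff_pderiv]
  refine Polynomial.natDegree_mul_le.trans ?_
  have h1 : ((e i : Polynomial F) + 1).natDegree = 0 := by
    rw [← Nat.cast_one, ← Nat.cast_add, Polynomial.natDegree_natCast]
  rw [h1]
  exact hD _

lemma card_le_of_natDegree_le [Fintype F] (hι : Function.Injective ι) {p δ w m : ℕ} [CharP F p]
    (hδ : 0 < δ) (hp : δ < p) (hq : 2 * moduliCount δ ≤ Fintype.card F)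
    (hw : 0 < w) (h1 : w + 1 ≤ δ * m) (h2 : m ≤ w + 1)
    {f : MvPolynomial (Fin 2) K} (hf : Irreducible f) (hfδ : f.totalDegree = δ)
    (S : Finset (Fin 2 → Polynomial F)) (hSw : ∀ z ∈ S, ∀ j, (z j).natDegree ≤ w)
    (hSf : ∀ z ∈ S, eval (fun i => ι (z i)) f = 0) :
    S.card ≤ δ * δ + moduliCount δ * ((δ * (20 * δ * w)) * (δ * Fintype.card F ^ m)) := by
  classical
  obtain ⟨g, hg0, hgδ, hgD, hgS⟩ := exists_polynomial_coefficients hι (↑S : Set _)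
    (fun z hz => hSw z hz) hf.ne_zero hfδ.le (fun z hz => hSf z hz)
  by_cases hfg : f ∣ map ι g
  swap
  · refine (card_le_of_not_dvd_map hι hf hfg S hSf fun z hz => hgS z hz).trans ?_
    rw [hfδ]
    exact (Nat.mul_le_mul_left _ hgδ).trans (Nat.le_add_right _ _)
  obtain ⟨c, hc⟩ := hfg
  have hG0 : map ι g ≠ 0 := fun h0 => hg0 (map_injective ι hι (by simpa using h0))
  have hc0 : c ≠ 0 := by rintro rfl; exact hG0 (by simpa using hc)
  have hdeg : g.totalDegree = δ + c.totalDegree := by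
    rw [← totalDegree_map_of_injective hι, hc, totalDegree_mul_of_isDomain hf.ne_zero hc0, hfδ]
  have hg : g.totalDegree = δ := by omega
  have hcu : IsUnit c := by
    have hcC := totalDegree_eq_zero_iff_eq_C.1 (show c.totalDegree = 0 by omega)
    rw [hcC]
    refine IsUnit.map C (isUnit_iff_ne_zero.2 fun h0 => hc0 ?_)
    rw [hcC, h0, map_zero]
  have hirr : Irreducible (map ι g) := by
    rw [hc]
    exact (irreducible_mul_isUnit hcu).2 hf
  have hSg : ∀ z ∈ S, eval z g = 0 := fun z hz => hgS z hz
  have hSG : ∀ z ∈ S, eval (fun i => ι (z i)) (map ι g) = 0 := fun z hz => by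
    rw [eval_map_apply, hSg z hz, map_zero]
  obtain ⟨i, hi⟩ := exists_pderiv_ne_zero (p := p) (f := g) (by omega) (by omega)
  have hlt := totalDegree_pderiv_lt hi
  have hndvd : ¬ map ι g ∣ map ι (pderiv i g) := by
    rintro ⟨d, hd⟩
    have hP0 : map ι (pderiv i g) ≠ 0 := fun h0 => hi (map_injective ι hι (by simpa using h0))
    have hd0 : d ≠ 0 := by rintro rfl; exact hP0 (by simpa using hd)
    have := totalDegree_mul_of_isDomain hG0 hd0
    rw [← hd, totalDegree_map_of_injective hι, totalDegree_map_of_injective hι] at this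
    omega
  have hq4 : 4 ≤ Fintype.card F := by
    have : 0 < ((exponentsLE δ).card + 1) * δ ^ 2 :=
      Nat.mul_pos (Nat.succ_pos _) (pow_pos hδ 2)
    have hM : 2 ≤ moduliCount δ := Nat.succ_le_succ this
    omega
  obtain ⟨T, hTcard, hT⟩ := exists_card_eq_forall_irreducible F (k := moduliCount δ) (m := m)
    (Nat.pos_of_ne_zero (by rintro rfl; omega)) hq hq4
  have hcover : S ⊆ (S.filter fun z => eval z (pderiv i g) = 0) ∪
      T.biUnion fun π => S.filter fun z => ¬ π ∣ eval z (pderiv i g) := by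
    intro z hz
    by_cases hz0 : eval z (pderiv i g) = 0
    · exact Finset.mem_union_left _ (Finset.mem_filter.2 ⟨hz, hz0⟩)
    refine Finset.mem_union_right _ ?_
    by_contra hcon
    simp only [Finset.mem_biUnion, Finset.mem_filter, not_exists, not_and, not_not] at hcon
    have hle := card_mul_le_natDegree_of_forall_dvd hz0 T hT fun π hπ => hcon π hπ hz
    have hub := natDegree_eval_pderiv_le hg.le hgD i (hSw z hz)
    rw [hTcard] at hle
    have hm : 0 < m := Nat.pos_of_ne_zero (by rintro rfl; omega)
    have : ((exponentsLE δ).card * (δ * w) + w * δ) ≤ ((exponentsLE δ).card + 1) * δ ^ 2 * m := by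
      calc _ = ((exponentsLE δ).card + 1) * δ * w := by ring
        _ ≤ ((exponentsLE δ).card + 1) * δ * (δ * m) := Nat.mul_le_mul_left _ (by omega)
        _ = _ := by ring
    unfold moduliCount at hle
    rw [add_mul, one_mul] at hle
    omega
  refine (Finset.card_le_card hcover).trans ((Finset.card_union_le _ _).trans (add_le_add ?_ ?_))
  · refine (card_le_of_not_dvd_map hι hirr hndvd _ (fun z hz => hSG z (Finset.mem_filter.1 hz).1)
      fun z hz => (Finset.mem_filter.1 hz).2).trans ?_
    rw [totalDegree_map_of_injective hι, hg]
    exact Nat.mul_le_mul_left _ (by omega)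
  · rw [← hTcard]
    refine Finset.card_biUnion_le_card_mul _ _ _ fun π hπ => ?_
    obtain ⟨-, hπ, rfl⟩ := hT π hπ
    exact card_le_of_forall_not_dvd_pderiv hι hπ hδ hw h1 h2 hg hirr i _
      (fun z hz => hSw z (Finset.mem_filter.1 hz).1) (fun z hz => hSg z (Finset.mem_filter.1 hz).1)
      (fun z hz => (Finset.mem_filter.1 hz).2)

lemma card_le_of_natDegree_eq_zero [Fintype F] (hι : Function.Injective ι)
    {f : MvPolynomial (Fin 2) K} (hf : f ≠ 0) (S : Finset (Fin 2 → Polynomial F))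
    (hS : ∀ z ∈ S, ∀ j, (z j).natDegree = 0) (hSf : ∀ z ∈ S, eval (fun i => ι (z i)) f = 0) :
    S.card ≤ f.totalDegree * Fintype.card F := by
  classical
  have hinj : Function.Injective fun (z : Fin 2 → Polynomial F) (i : Fin 2) => ι (z i) :=
    fun z z' h => funext fun i => hι (congrFun h i)
  rw [← Finset.card_image_of_injective S hinj]
  refine (card_zeros_le_totalDegree_mul hf
    (Finset.univ.image fun a : F => ι (Polynomial.C a)) _ ?_ ?_).trans
    (Nat.mul_le_mul_left _ Finset.card_image_le)
  · simp only [Finset.forall_mem_image]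
    intro z hz j
    refine Finset.mem_image.2 ⟨(z j).coeff 0, Finset.mem_univ _, ?_⟩
    rw [← Polynomial.eq_C_of_natDegree_eq_zero (hS z hz j)]
  · simpa [Finset.forall_mem_image] using hSf

end Counting

end PlaneCurves

lemma setOf_degree_lt_finite (F : Type*) [Field F] [Fintype F] (n : ℕ) :
    {z : Fin 2 → Polynomial F | ∀ i, (z i).degree < (n : WithBot ℕ)}.Finite := by
  have hfin : {a : Polynomial F | a.degree < (n : WithBot ℕ)}.Finite := by
    have : Finite (Polynomial.degreeLT F n) :=
      Finite.of_equiv _ (Polynomial.degreeLTEquiv F n).symm.toEquiv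
    refine (Set.toFinite (Polynomial.degreeLT F n : Set (Polynomial F))).subset fun a ha => ?_
    exact Polynomial.mem_degreeLT.2 ha
  refine (Set.Finite.pi' fun _ : Fin 2 => hfin).subset fun z hz => hz

/-- For every positive integer `δ` there exist a real number `C = C(δ)` and an
integer `N = N(δ)` such that for every prime `p > N`, every prime power `q = p^α` (`α ≥ 1`),
every integer `n > 0`, and every irreducible polynomial `f ∈ F_q((t))[X,Y]` of total degree `δ`,
the number of pairs `(x,y) ∈ (F_q[t]_n)²` with `f(x,y) = 0` is at most
`C · n² · q^⌈n/δ⌉`. -/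
theorem points_of_bounded_degree_on_plane_curves (δ : ℕ) (hδ : 0 < δ) :
    ∃ (C : ℝ) (N : ℕ), ∀ (p : ℕ), p.Prime → N < p →
      ∀ (α : ℕ), 1 ≤ α →
      ∀ (F : Type) [Field F] [Fintype F], Fintype.card F = p ^ α →
      ∀ (n : ℕ), 0 < n →
      ∀ f : MvPolynomial (Fin 2) (LaurentSeries F),
        Irreducible f → f.totalDegree = δ →
        (Set.ncard {z : Fin 2 → Polynomial F |
            (∀ i, (z i).degree < (n : WithBot ℕ)) ∧
            MvPolynomial.eval
              (fun i => (HahnSeries.ofPowerSeries ℤ F ((z i : PowerSeries F)))) f = 0} : ℝ)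
          ≤ C * (n : ℝ) ^ 2 * ((p : ℝ) ^ α) ^ (⌈(n : ℚ) / (δ : ℚ)⌉₊) := by
  classical
  refine ⟨δ ^ 2 + 20 * moduliCount δ * δ ^ 3, 2 * moduliCount δ + δ, ?_⟩
  intro p hp hN α hα F _ _ hF n hn f hf hfδ
  have : Fact p.Prime := ⟨hp⟩
  have : CharP F p := charP_of_card_eq_prime_pow hF
  set ι : Polynomial F →+* LaurentSeries F :=
    (HahnSeries.ofPowerSeries ℤ F).comp Polynomial.coeToPowerSeries.ringHom
  have hι : Function.Injective ι :=
    HahnSeries.ofPowerSeries_injective.comp (Polynomial.coe_injective F)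
  set Z := {z : Fin 2 → Polynomial F | (∀ i, (z i).degree < (n : WithBot ℕ)) ∧
    MvPolynomial.eval
      (fun i => (HahnSeries.ofPowerSeries ℤ F ((z i : PowerSeries F)))) f = 0}
  have hfin : Z.Finite := (setOf_degree_lt_finite F n).subset fun z hz => hz.1
  have hmem : ∀ z ∈ hfin.toFinset, (∀ i, (z i).natDegree ≤ n - 1) ∧
      MvPolynomial.eval (fun i => ι (z i)) f = 0 := by
    intro z hz
    have hz' : z ∈ Z := hfin.mem_toFinset.1 hz
    refine ⟨fun i => ?_, hz'.2⟩
    refine Nat.le_sub_one_of_lt ?_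
    rcases eq_or_ne (z i) 0 with h0 | h0
    · simpa [h0] using hn
    · exact (Polynomial.natDegree_lt_iff_degree_lt h0).2 (hz'.1 i)
  rw [Set.ncard_eq_toFinset_card Z hfin, ← Nat.cast_pow p α, ← hF]
  set m := ⌈(n : ℚ) / (δ : ℚ)⌉₊ with hm
  have hδQ : (0 : ℚ) < δ := by exact_mod_cast hδ
  have hm1 : n ≤ δ * m := by
    have := (div_le_iff₀ hδQ).1 (Nat.le_ceil ((n : ℚ) / δ))
    rw [← hm] at this
    rw [mul_comm]
    exact_mod_cast this
  have hm2 : m ≤ n := Nat.ceil_le.2 (div_le_self (by positivity) (by exact_mod_cast hδ))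
  have hm0 : 0 < m := Nat.pos_of_ne_zero (by rintro h; rw [h] at hm1; omega)
  have hq : p ≤ Fintype.card F := by rw [hF]; exact Nat.le_self_pow (by omega) p
  suffices h : hfin.toFinset.card ≤
      (δ ^ 2 + 20 * moduliCount δ * δ ^ 3) * n ^ 2 * Fintype.card F ^ m by exact_mod_cast h
  have hqm : 0 < Fintype.card F ^ m := by positivity
  rcases Nat.lt_or_ge 1 n with hn1 | hn1
  · have h := card_le_of_natDegree_le hι hδ (by omega : δ < p) (by omega) (w := n - 1) (m := m)
      (by omega) (by omega) (by omega) hf hfδ hfin.toFinset (fun z hz => (hmem z hz).1)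
      (fun z hz => (hmem z hz).2)
    refine h.trans ?_
    have hw : n - 1 ≤ n ^ 2 := (Nat.sub_le n 1).trans (Nat.le_self_pow two_ne_zero n)
    have h1 : 1 ≤ n ^ 2 * Fintype.card F ^ m := Nat.mul_pos (by positivity) hqm
    calc δ * δ + moduliCount δ * ((δ * (20 * δ * (n - 1))) * (δ * Fintype.card F ^ m))
        = δ ^ 2 * 1 + 20 * moduliCount δ * δ ^ 3 * ((n - 1) * Fintype.card F ^ m) := by ring
      _ ≤ δ ^ 2 * (n ^ 2 * Fintype.card F ^ m) +
          20 * moduliCount δ * δ ^ 3 * (n ^ 2 * Fintype.card F ^ m) := by gcongr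
      _ = _ := by ring
  · obtain rfl : n = 1 := by omega
    have hm3 : m = 1 := by omega
    have h := card_le_of_natDegree_eq_zero hι hf.ne_zero hfin.toFinset
      (fun z hz j => Nat.le_zero.1 ((hmem z hz).1 j)) (fun z hz => (hmem z hz).2)
    refine h.trans ?_
    rw [hfδ, hm3, one_pow, mul_one, pow_one]
    exact Nat.mul_le_mul_right _
      ((Nat.le_self_pow two_ne_zero δ).trans (Nat.le_add_right _ _))
end

section
/- For all positive integers m ≥ 2 and δ there exist a real number C = C(m,δ) and an integer N = N(m,δ) such that for every prime p > N, every prime power q = p^α, every integer n > 0, and every irreducible polynomial f ∈ F_q((t))[X_1,…,X_m] of total degree δ, the number of m-tuples x ∈ (F_q[t]_n)^m with f(x) = 0 is at most C · n² · q^{n(m−2) + ⌈n/δ⌉}. -/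
/-- A function that behaves like an upper bound for a degree. -/
structure IsDegreeLike {A : Type*} [CommRing A] (dg : A → ℕ) : Prop where
  one : dg 1 = 0
  zero : dg 0 = 0
  neg : ∀ a, dg (-a) = dg a
  add : ∀ a b, dg (a + b) ≤ max (dg a) (dg b)
  mul : ∀ a b, dg (a * b) ≤ dg a + dg b

namespace IsDegreeLike

variable {A : Type*} [CommRing A] {dg : A → ℕ}

theorem natDegree (R : Type*) [CommRing R] :
    IsDegreeLike (Polynomial.natDegree : Polynomial R → ℕ) where
  one := Polynomial.natDegree_one
  zero := Polynomial.natDegree_zero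
  neg := Polynomial.natDegree_neg
  add := Polynomial.natDegree_add_le
  mul := fun _ _ => Polynomial.natDegree_mul_le

theorem totalDegree (σ R : Type*) [CommRing R] :
    IsDegreeLike (MvPolynomial.totalDegree : MvPolynomial σ R → ℕ) where
  one := MvPolynomial.totalDegree_one
  zero := MvPolynomial.totalDegree_zero
  neg := MvPolynomial.totalDegree_neg
  add := MvPolynomial.totalDegree_add
  mul := MvPolynomial.totalDegree_mul

theorem sum_le (h : IsDegreeLike dg) {ι : Type*} (s : Finset ι) (a : ι → A) (e : ℕ)
    (ha : ∀ i ∈ s, dg (a i) ≤ e) : dg (∑ i ∈ s, a i) ≤ e := by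
  classical
  induction s using Finset.induction_on with
  | empty => simp [h.zero]
  | insert i s hi ih =>
    rw [Finset.sum_insert hi]
    exact (h.add _ _).trans (max_le (ha _ (by simp))
      (ih fun j hj => ha j (Finset.mem_insert_of_mem hj)))

theorem prod_le (h : IsDegreeLike dg) {ι : Type*} (s : Finset ι) (a : ι → A) (e : ℕ)
    (ha : ∀ i ∈ s, dg (a i) ≤ e) : dg (∏ i ∈ s, a i) ≤ s.card * e := by
  classical
  induction s using Finset.induction_on with
  | empty => simp [h.one]
  | insert i s hi ih =>
    rw [Finset.prod_insert hi, Finset.card_insert_of_notMem hi]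
    have h1 := ha i (by simp)
    have h2 := ih fun j hj => ha j (Finset.mem_insert_of_mem hj)
    have h3 := h.mul (a i) (∏ i ∈ s, a i)
    linarith

theorem pow_le (h : IsDegreeLike dg) (a : A) (k : ℕ) : dg (a ^ k) ≤ k * dg a := by
  simpa using h.prod_le (Finset.range k) (fun _ => a) (dg a) (by simp)

theorem det_le (h : IsDegreeLike dg) {ι : Type*} [Fintype ι] [DecidableEq ι]
    (M : Matrix ι ι A) (e : ℕ) (hM : ∀ i j, dg (M i j) ≤ e) :
    dg M.det ≤ Fintype.card ι * e := by
  rw [Matrix.det_apply]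
  refine h.sum_le _ _ _ fun σ _ => ?_
  have hp : dg (∏ i, M (σ i) i) ≤ Fintype.card ι * e :=
    h.prod_le Finset.univ _ e fun i _ => hM _ _
  rcases Int.units_eq_one_or (Equiv.Perm.sign σ) with hs | hs
  · simpa [hs] using hp
  · simpa [hs, h.neg] using hp

end IsDegreeLike

/-- A family of vectors in `K^ι` either lies in a hyperplane, or contains `|ι|` members whose
determinant does not vanish. -/
theorem exists_hyperplane_or_det_ne_zero {K ι I : Type*} [Field K] [Fintype ι] [DecidableEq ι]
    (v : I → ι → K) :
    (∃ c : ι → K, c ≠ 0 ∧ ∀ i, ∑ b, c b * v i b = 0) ∨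
      ∃ r : ι → I, (Matrix.of fun l b => v (r l) b).det ≠ 0 := by
  classical
  by_cases htop : Submodule.span K (Set.range v) = ⊤
  · right
    obtain ⟨κ, a, ha, hsp, hli⟩ := exists_linearIndependent' K v
    have hb : ⊤ ≤ Submodule.span K (Set.range (v ∘ a)) := by rw [hsp, htop]
    let B := Module.Basis.mk hli hb
    let e : ι ≃ κ := (Pi.basisFun K ι).indexEquiv B
    refine ⟨fun l => a (e l), ?_⟩
    have hli' : LinearIndependent K (fun l => (v ∘ a) (e l)) := hli.comp e e.injective
    have : IsUnit (Matrix.of fun l b => v (a (e l)) b) := by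
      rw [← Matrix.linearIndependent_rows_iff_isUnit]
      exact hli'
    exact ((Matrix.isUnit_iff_isUnit_det _).1 this).ne_zero
  · left
    obtain ⟨φ, hφ, hle⟩ := Submodule.exists_le_ker_of_lt_top _ (lt_top_iff_ne_top.2 htop)
    refine ⟨fun b => φ (Pi.single b 1), ?_, fun i => ?_⟩
    · intro h0
      apply hφ
      refine (Pi.basisFun K ι).ext fun b => ?_
      simpa using congrFun h0 b
    · have hz : φ (v i) = 0 := hle (Submodule.subset_span ⟨i, rfl⟩)
      rw [← hz, LinearMap.pi_apply_eq_sum_univ φ (v i)]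
      refine Finset.sum_congr rfl fun b _ => ?_
      rw [smul_eq_mul, mul_comm]
      have : (Pi.single b 1 : ι → K) = fun j => if b = j then 1 else 0 := by
        ext j
        simp [Pi.single_apply, eq_comm]
      simp only [this]

namespace Polynomial

/-- Elimination of the main variable: a monic irreducible `f` and a `g` that is not a multiple
of `f` generate an ideal containing a nonzero constant of controlled degree. -/
theorem exists_elimination {A : Type*} [CommRing A] [IsDomain A] [IsIntegrallyClosed A]
    {dg : A → ℕ} (h : IsDegreeLike dg) {f g : A[X]} (hf : f.Monic) (hirr : Irreducible f)
    (hfg : ¬ f ∣ g) (e : ℕ) (hfe : ∀ i, dg (f.coeff i) ≤ e) (hge : ∀ i, dg (g.coeff i) ≤ e) :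
    ∃ R : A, R ≠ 0 ∧ dg R ≤ (f.natDegree + g.natDegree) * e ∧
      ∃ a b : A[X], f * a + g * b = C R := by
  have hdeg : f.natDegree ≠ 0 := fun h0 =>
    hirr.not_isUnit (by rw [eq_one_of_monic_natDegree_zero hf h0]; exact isUnit_one)
  refine ⟨resultant f g, ?_, ?_, ?_⟩
  · intro h0
    let L := FractionRing A
    have hinj : Function.Injective (algebraMap A L) := IsFractionRing.injective A L
    have hmap : resultant (f.map (algebraMap A L)) (g.map (algebraMap A L)) = 0 := by
      rw [natDegree_map_eq_of_injective hinj, natDegree_map_eq_of_injective hinj,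
        resultant_map_map, h0, map_zero]
    have hirr' := (hf.irreducible_iff_irreducible_map_fraction_map (K := L)).1 hirr
    rw [resultant_eq_zero_iff] at hmap
    refine hmap.2 ((hirr'.coprime_iff_not_dvd).2 fun hd => hfg ?_)
    exact (map_dvd_map _ hinj hf).1 hd
  · have := h.det_le (sylvester f g f.natDegree g.natDegree) e (fun i j => ?_)
    · simpa [resultant] using this
    · refine Fin.addCases (fun j => ?_) (fun j => ?_) j
      · simp only [sylvester, Matrix.of_apply, Fin.addCases_left]
        split_ifs
        · exact hge _
        · simp [h.zero]
      · simp only [sylvester, Matrix.of_apply, Fin.addCases_right]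
        split_ifs
        · exact hfe _
        · simp [h.zero]
  · obtain ⟨p, q, -, -, hpq⟩ := exists_mul_add_mul_eq_C_resultant f g le_rfl le_rfl
      (Or.inl hdeg)
    exact ⟨p, q, hpq⟩

end Polynomial

namespace Polynomial

/-- If every `(x, y) ∈ S` satisfies `f(x) = 0`, with `f` monic and specialised at `y`, then `S` has
at most `deg f` elements above each `y`. -/
theorem card_le_natDegree_mul {A K Y : Type*} [CommRing A] [Field K]
    (φ : Y → A →+* K) {f : A[X]} (hf : f.Monic) (S : Finset (K × Y)) (T : Finset Y)
    (hT : ∀ z ∈ S, z.2 ∈ T) (hS : ∀ z ∈ S, (f.map (φ z.2)).eval z.1 = 0) :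
    S.card ≤ f.natDegree * T.card := by
  classical
  refine Finset.card_le_mul_card_image_of_maps_to hT _ fun y _ => ?_
  have hm : (f.map (φ y)).Monic := hf.map _
  have hle : (S.filter fun z => z.2 = y).card ≤ (f.map (φ y)).roots.toFinset.card := by
    refine Finset.card_le_card_of_injOn Prod.fst ?_ ?_
    · intro z hz
      simp only [Finset.coe_filter, Set.mem_ofPred_eq] at hz
      have := hS z hz.1
      rw [hz.2] at this
      simp [hm.ne_zero, this]
    · rintro ⟨x, y⟩ hz ⟨x', y'⟩ hz' hxx
      simp only [Finset.coe_filter, Set.mem_ofPred_eq] at hz hz' hxx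
      rw [hxx, hz.2, hz'.2]
  calc _ ≤ _ := hle
    _ ≤ (f.map (φ y)).roots.card := Multiset.toFinset_card_le _
    _ ≤ (f.map (φ y)).natDegree := card_roots' _
    _ ≤ _ := natDegree_map_le

theorem eval_map_eq_zero_of_elimination {A K : Type*} [CommRing A] [CommRing K] (φ : A →+* K)
    {f g a b : A[X]} {R : A} (h : f * a + g * b = C R) {x : K}
    (hf : (f.map φ).eval x = 0) (hg : (g.map φ).eval x = 0) : φ R = 0 := by
  have := congrArg (fun p => (p.map φ).eval x) h
  simpa [hf, hg] using this.symm

/-- A Bézout type bound for the common zeros of two plane curves. -/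
theorem card_common_zeros_le {K : Type*} [Field K] {f g : K[X][X]} (hf : f.Monic)
    (hirr : Irreducible f) (hfg : ¬ f ∣ g) (e : ℕ) (hfe : ∀ i, (f.coeff i).natDegree ≤ e)
    (hge : ∀ i, (g.coeff i).natDegree ≤ e) (S : Finset (K × K))
    (hSf : ∀ z ∈ S, f.evalEval z.2 z.1 = 0) (hSg : ∀ z ∈ S, g.evalEval z.2 z.1 = 0) :
    S.card ≤ f.natDegree * ((f.natDegree + g.natDegree) * e) := by
  classical
  obtain ⟨R, hR, hRd, a, b, hab⟩ := exists_elimination (IsDegreeLike.natDegree K) hf hirr hfg e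
    hfe hge
  have hev : ∀ (p : K[X][X]) (x y : K), p.evalEval y x = (p.map (evalRingHom y)).eval x :=
    fun p x y => (map_evalRingHom_eval y x p).symm
  refine (card_le_natDegree_mul (fun y : K => evalRingHom y) hf S R.roots.toFinset ?_
    fun z hz => (hev _ _ _).symm.trans (hSf z hz)).trans ?_
  · intro z hz
    have := eval_map_eq_zero_of_elimination (evalRingHom z.2) hab (x := z.1)
      ((hev _ _ _).symm.trans (hSf z hz)) ((hev _ _ _).symm.trans (hSg z hz))
    simpa [hR] using this
  · gcongr
    exact (Multiset.toFinset_card_le _).trans ((card_roots' R).trans hRd)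

end Polynomial

namespace MvPolynomial

open Finset in
theorem card_zeros_le {K : Type*} [Field K] [DecidableEq K] {r : ℕ} {p : MvPolynomial (Fin (r + 1)) K}
    (hp : p ≠ 0) (S : Finset K) :
    #{y ∈ Fintype.piFinset fun _ => S | eval y p = 0} ≤ p.totalDegree * #S ^ r := by
  rcases S.eq_empty_or_nonempty with rfl | hne
  · have : (Fintype.piFinset fun _ : Fin (r + 1) => (∅ : Finset K)) = ∅ := by
      simp
    simp [this]
  have h := schwartz_zippel_totalDegree hp S
  have hpos : (0 : ℚ≥0) < #S := by exact_mod_cast hne.card_pos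
  rw [div_le_div_iff₀ (by positivity) hpos, pow_succ, ← mul_assoc] at h
  have h' := le_of_mul_le_mul_right h hpos
  exact_mod_cast h'

/-- A Bézout type bound for the common zeros of two hypersurfaces in a box. -/
theorem card_common_zeros_le {K : Type*} [Field K] {r : ℕ}
    {f g : Polynomial (MvPolynomial (Fin (r + 1)) K)} (hf : f.Monic)
    (hirr : Irreducible f) (hfg : ¬ f ∣ g) (e : ℕ) (hfe : ∀ i, (f.coeff i).totalDegree ≤ e)
    (hge : ∀ i, (g.coeff i).totalDegree ≤ e) (B : Finset K) (S : Finset (K × (Fin (r + 1) → K)))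
    (hB : ∀ z ∈ S, ∀ i, z.2 i ∈ B)
    (hSf : ∀ z ∈ S, (f.map (eval z.2)).eval z.1 = 0)
    (hSg : ∀ z ∈ S, (g.map (eval z.2)).eval z.1 = 0) :
    S.card ≤ f.natDegree * ((f.natDegree + g.natDegree) * e) * B.card ^ r := by
  classical
  obtain ⟨R, hR, hRd, a, b, hab⟩ :=
    Polynomial.exists_elimination (IsDegreeLike.totalDegree _ K) hf hirr hfg e hfe hge
  refine (Polynomial.card_le_natDegree_mul (fun y => eval y) hf S
    {y ∈ Fintype.piFinset fun _ => B | eval y R = 0} ?_ hSf).trans ?_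
  · intro z hz
    have := Polynomial.eval_map_eq_zero_of_elimination (eval z.2) hab (hSf z hz) (hSg z hz)
    simpa [this] using hB z hz
  · rw [mul_assoc]
    gcongr
    exact (card_zeros_le hR B).trans (by gcongr)

end MvPolynomial

namespace FiniteField

open Polynomial

/-- Over a field with `q ≥ 3` elements, at least `q / 2` monic polynomials of a given positive
degree are irreducible. -/
theorem exists_finset_irreducible (F : Type*) [Field F] [Fintype F] (hq : 3 ≤ Fintype.card F)
    (d : ℕ) (hd : 0 < d) :
    ∃ Ps : Finset F[X], Fintype.card F ≤ 2 * Ps.card ∧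
      ∀ P ∈ Ps, P.Monic ∧ Irreducible P ∧ P.natDegree = d := by
  classical
  obtain ⟨p, hp⟩ := CharP.exists F
  have : Fact p.Prime := ⟨CharP.char_is_prime F p⟩
  have : NeZero d := ⟨hd.ne'⟩
  let E := Extension F p d
  let : Fintype E := Fintype.ofFinite E
  set q := Fintype.card F with hqdef
  have hE : Fintype.card E = q ^ d := by
    rw [← Nat.card_eq_fintype_card, natCard_extension, Nat.card_eq_fintype_card]
  have hint : ∀ x : E, IsIntegral F x := fun x => Algebra.IsIntegral.isIntegral x
  let T : Finset E := Finset.univ.filter fun x => (minpoly F x).natDegree = d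
  -- elements of smaller degree are roots of `X ^ q ^ e - X` for some `e < d`
  have hsmall : (Finset.univ.filter fun x : E => ¬ (minpoly F x).natDegree = d).card
      ≤ ∑ e ∈ Finset.range d, q ^ e := by
    have hsub : (Finset.univ.filter fun x : E => ¬ (minpoly F x).natDegree = d) ⊆
        (Finset.range d).biUnion fun e =>
          if e = 0 then ∅ else (X ^ q ^ e - X : E[X]).roots.toFinset := by
      intro x hx
      simp only [Finset.mem_filter, Finset.mem_univ, true_and] at hx
      have hirr := minpoly.irreducible (hint x)
      have hle : (minpoly F x).natDegree ≤ d := by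
        have := minpoly.natDegree_le (A := F) x
        rwa [finrank_extension F p d] at this
      have hpos := minpoly.natDegree_pos (hint x)
      have hdvd : minpoly F x ∣ X ^ q ^ (minpoly F x).natDegree - X := by
        have := (hirr.natDegree_dvd_iff_dvd_X_pow_card_pow_sub_X
          (n := (minpoly F x).natDegree)).1 dvd_rfl
        rwa [Nat.card_eq_fintype_card] at this
      have hroot := aeval_eq_zero_of_dvd_aeval_eq_zero hdvd (minpoly.aeval F x)
      refine Finset.mem_biUnion.2 ⟨(minpoly F x).natDegree, Finset.mem_range.2 (by omega), ?_⟩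
      rw [if_neg hpos.ne', Multiset.mem_toFinset, mem_roots
        (X_pow_card_pow_sub_X_ne_zero E hpos.ne' (by omega))]
      simpa using hroot
    refine (Finset.card_le_card hsub).trans (Finset.card_biUnion_le.trans ?_)
    refine Finset.sum_le_sum fun e _ => ?_
    split_ifs with he
    · simp
    · refine (Multiset.toFinset_card_le _).trans ((card_roots' _).trans ?_)
      rw [X_pow_card_pow_sub_X_natDegree_eq E he (by omega)]
  have hgeom : 2 * ∑ e ∈ Finset.range d, q ^ e ≤ q ^ d := by
    have h1 := Nat.geomSum_eq (m := q) (by omega) d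
    have h2 : (q - 1) * ∑ e ∈ Finset.range d, q ^ e ≤ q ^ d := by
      rw [h1]
      exact (Nat.mul_div_le _ _).trans (Nat.sub_le _ _)
    refine le_trans (Nat.mul_le_mul_right _ (by omega)) h2
  have hT : q ^ d ≤ 2 * T.card := by
    have := Finset.card_filter_add_card_filter_not (s := (Finset.univ : Finset E))
      (fun x : E => (minpoly F x).natDegree = d)
    rw [Finset.card_univ, hE] at this
    change T.card + _ = _ at this
    omega
  refine ⟨T.image (minpoly F), ?_, ?_⟩
  · have hfib : T.card ≤ d * (T.image (minpoly F)).card := by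
      refine Finset.card_le_mul_card_image T d fun P hP => ?_
      obtain ⟨x, hx, rfl⟩ := Finset.mem_image.1 hP
      have hne : ((minpoly F x).map (algebraMap F E)) ≠ 0 :=
        ((minpoly.monic (hint x)).map _).ne_zero
      have hsub : (T.filter fun y => minpoly F y = minpoly F x) ⊆
          ((minpoly F x).map (algebraMap F E)).roots.toFinset := by
        intro y hy
        have := (Finset.mem_filter.1 hy).2
        rw [Multiset.mem_toFinset, mem_roots hne, IsRoot.def, eval_map_algebraMap, ← this]
        exact minpoly.aeval F y
      refine (Finset.card_le_card hsub).trans ((Multiset.toFinset_card_le _).trans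
        ((card_roots' _).trans ?_))
      rw [natDegree_map]
      exact (Finset.mem_filter.1 hx).2.le
    have hpow : q * d ≤ q ^ d := by
      obtain ⟨k, rfl⟩ : ∃ k, d = k + 1 := ⟨d - 1, by omega⟩
      rw [pow_succ']
      gcongr
      have h1 : k < 2 ^ k := Nat.lt_two_pow_self
      have h2 : 2 ^ k ≤ q ^ k := Nat.pow_le_pow_left (by omega) k
      omega
    have : q * d ≤ (2 * (T.image (minpoly F)).card) * d := by
      calc q * d ≤ 2 * T.card := hpow.trans hT
        _ ≤ 2 * (d * (T.image (minpoly F)).card) := by gcongr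
        _ = _ := by ring
    exact Nat.le_of_mul_le_mul_right this hd
  · intro P hP
    obtain ⟨x, hx, rfl⟩ := Finset.mem_image.1 hP
    exact ⟨minpoly.monic (hint x), minpoly.irreducible (hint x), (Finset.mem_filter.1 hx).2⟩

end FiniteField

namespace Polynomial

section Local

variable {R : Type*} [CommRing R]

/-- The ideal of polynomials whose value at `0` is divisible by `P`. -/
noncomputable def germIdeal (P : R) : Ideal R[X] := Ideal.span {C P, X}

theorem mem_germIdeal_iff {P : R} {w : R[X]} : w ∈ germIdeal P ↔ P ∣ w.eval 0 := by
  constructor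
  · intro h
    obtain ⟨a, b, rfl⟩ := Ideal.mem_span_pair.1 h
    simp
  · rintro ⟨c, hc⟩
    obtain ⟨v, hv⟩ : X ∣ w - C (w.eval 0) := X_dvd_iff.2 (by simp [coeff_zero_eq_eval_zero])
    refine Ideal.mem_span_pair.2 ⟨C c, v, ?_⟩
    rw [← C_mul, mul_comm c, ← hc, mul_comm v, ← hv]
    ring

theorem pow_dvd_eval_of_mem_germIdeal_pow {P u : R} (hu : P ∣ u) {k : ℕ} {w : R[X]}
    (hw : w ∈ germIdeal P ^ k) : P ^ k ∣ w.eval u := by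
  have h1 : germIdeal P ≤ (Ideal.span {P}).comap (evalRingHom u) := by
    refine Ideal.span_le.2 ?_
    rintro v (rfl | rfl)
    · simp
    · simpa [Ideal.mem_span_singleton] using hu
  have h2 := (Ideal.pow_right_mono h1 k).trans (Ideal.le_comap_pow _ k) hw
  simpa [Ideal.span_singleton_pow, Ideal.mem_span_singleton] using h2

theorem mem_germIdeal_pow_of_coeff {P : R} {k : ℕ} {w : R[X]}
    (hw : ∀ l < k, P ^ (k - l) ∣ w.coeff l) : w ∈ germIdeal P ^ k := by
  have hP : C P ∈ germIdeal P := Ideal.subset_span (by simp)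
  have hX : (X : R[X]) ∈ germIdeal P := Ideal.subset_span (by simp)
  rw [w.as_sum_support_C_mul_X_pow]
  refine Ideal.sum_mem _ fun l _ => ?_
  rcases lt_or_ge l k with hl | hl
  · obtain ⟨c, hc⟩ := hw l hl
    rw [hc, C_mul, C_pow, mul_right_comm]
    refine Ideal.mul_mem_right _ _ ?_
    have := Ideal.mul_mem_mul (Ideal.pow_mem_pow hP (k - l)) (Ideal.pow_mem_pow hX l)
    rwa [← pow_add, Nat.sub_add_cancel hl.le] at this
  · exact Ideal.mul_mem_left _ _ (Ideal.pow_le_pow_right hl (Ideal.pow_mem_pow hX l))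

theorem evalEval_eq_eval_map_comp (f : R[X][X]) (φ : R[X]) (τ₀ u : R) :
    ((f.map (compRingHom (X + C τ₀))).eval φ).eval u = f.evalEval (u + τ₀) (φ.eval u) := by
  have : (evalRingHom u).comp (compRingHom (X + C τ₀)) = evalRingHom (u + τ₀) := by
    ext <;> simp
  rw [← map_evalRingHom_eval, ← this, ← map_map, ← coe_evalRingHom u,
    ← eval_map_apply, coe_evalRingHom]

theorem dvd_evalEval_sub {P τ τ' x x' : R} (f : R[X][X]) (hτ : P ∣ τ - τ') (hx : P ∣ x - x') :
    P ∣ f.evalEval τ x - f.evalEval τ' x' := by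
  have h1 : P ∣ f.evalEval τ x - f.evalEval τ x' := by
    rw [← map_evalRingHom_eval, ← map_evalRingHom_eval]
    exact hx.trans (sub_dvd_eval_sub _ _ _)
  have h2 : P ∣ f.evalEval τ x' - f.evalEval τ' x' := hτ.trans (sub_dvd_eval_sub _ _ _)
  simpa using dvd_add h1 h2

/-- Hensel's lemma along a curve, modulo `P ^ k`: near a point that is smooth modulo `P`, the
second coordinate is a polynomial in the first one. -/
theorem exists_local_parametrization [IsDomain R] [IsPrincipalIdealRing R] {P : R}
    (hP : Irreducible P) {k : ℕ} (hk : k ≠ 0) (f : R[X][X]) (τ₀ x₀ : R)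
    (h0 : P ∣ f.evalEval τ₀ x₀) (h1 : ¬ P ∣ f.derivative.evalEval τ₀ x₀) :
    ∃ φ : R[X], ∀ τ x : R, P ∣ τ - τ₀ → P ∣ x - x₀ → f.evalEval τ x = 0 →
      P ^ k ∣ x - φ.eval (τ - τ₀) := by
  set I := germIdeal P with hI
  set s := compRingHom (X + C τ₀) with hs
  set π := Ideal.Quotient.mk (I ^ k) with hπ
  have hnil : ∀ w ∈ I, IsNilpotent (π w) := fun w hw =>
    ⟨k, by rw [← map_pow]; exact Ideal.Quotient.eq_zero_iff_mem.2 (Ideal.pow_mem_pow hw k)⟩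
  have hunit : ∀ w : R[X], ¬ P ∣ w.eval 0 → IsUnit (π w) := by
    intro w hw
    obtain ⟨a, b, hab⟩ := (hP.coprime_iff_not_dvd).2 hw
    have hmem : C b * w - 1 ∈ I := by
      rw [hI, mem_germIdeal_iff]
      refine ⟨-a, ?_⟩
      simp only [eval_sub, eval_mul, eval_C, eval_one]
      linear_combination hab
    have h2 : IsUnit (π (C b * w)) := by
      have := (hnil _ hmem).isUnit_add_one
      simpa using this
    rw [map_mul] at h2
    exact isUnit_of_mul_isUnit_right h2
  obtain ⟨r, ⟨hr1, hr2⟩, -⟩ := existsUnique_nilpotent_sub_and_aeval_eq_zero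
    (P := (f.map s).map π) (x := π (C x₀))
    (by
      rw [coe_aeval_eq_eval, eval_map_apply]
      refine hnil _ ?_
      rw [hI, mem_germIdeal_iff, hs, evalEval_eq_eval_map_comp]
      simpa using h0)
    (by
      rw [coe_aeval_eq_eval, derivative_map, derivative_map, eval_map_apply]
      refine hunit _ ?_
      rw [hs, evalEval_eq_eval_map_comp]
      simpa using h1)
  obtain ⟨φ, rfl⟩ := Ideal.Quotient.mk_surjective r
  refine ⟨φ, fun τ x hτ hx hfx => ?_⟩
  have hφ0 : P ∣ x₀ - φ.eval 0 := by
    obtain ⟨j, hj⟩ := hr1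
    rw [← map_sub, ← map_pow] at hj
    have := Ideal.pow_le_self hk (Ideal.Quotient.eq_zero_iff_mem.1 hj)
    rw [mem_germIdeal_iff, eval_pow] at this
    simpa using hP.prime.dvd_of_dvd_pow this
  have hφu : P ∣ x₀ - φ.eval (τ - τ₀) := by
    have h2 : P ∣ φ.eval (τ - τ₀) - φ.eval 0 :=
      hτ.trans (by simpa using sub_dvd_eval_sub (τ - τ₀) 0 φ)
    simpa using dvd_sub hφ0 h2
  have hroot : P ^ k ∣ f.evalEval τ (φ.eval (τ - τ₀)) := by
    rw [coe_aeval_eq_eval, eval_map_apply] at hr2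
    have := pow_dvd_eval_of_mem_germIdeal_pow hτ (Ideal.Quotient.eq_zero_iff_mem.1 hr2)
    rwa [hs, evalEval_eq_eval_map_comp, sub_add_cancel] at this
  set ρ := Ideal.Quotient.mk (Ideal.span {P ^ k}) with hρ
  have hρ0 : ∀ w : R, ρ w = 0 ↔ P ^ k ∣ w := fun w => by
    rw [hρ, Ideal.Quotient.eq_zero_iff_mem, Ideal.mem_span_singleton]
  have hρnil : ∀ w : R, P ∣ w → IsNilpotent (ρ w) := fun w hw =>
    ⟨k, by rw [← map_pow, hρ0]; exact pow_dvd_pow_of_dvd hw k⟩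
  have hτx₀ : ∀ g : R[X][X], P ∣ g.evalEval τ x₀ ↔ P ∣ g.evalEval τ₀ x₀ := fun g =>
    dvd_iff_dvd_of_dvd_sub (dvd_evalEval_sub g hτ (by simp))
  have huniq := existsUnique_nilpotent_sub_and_aeval_eq_zero
    (P := (f.map (evalRingHom τ)).map ρ) (x := ρ x₀)
    (by
      rw [coe_aeval_eq_eval, eval_map_apply, map_evalRingHom_eval]
      exact hρnil _ ((hτx₀ f).2 h0))
    (by
      rw [coe_aeval_eq_eval, derivative_map, derivative_map, eval_map_apply,
        map_evalRingHom_eval]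
      have hc : IsCoprime (P ^ k) (f.derivative.evalEval τ x₀) :=
        ((hP.coprime_iff_not_dvd).2 fun h => h1 ((hτx₀ _).1 h)).pow_left
      obtain ⟨a, b, hab⟩ := hc
      have : ρ b * ρ (f.derivative.evalEval τ x₀) = 1 := by
        rw [← map_mul, ← map_one ρ, ← sub_eq_zero, ← map_sub, hρ0]
        exact ⟨-a, by linear_combination hab⟩
      exact IsUnit.of_mul_eq_one_right _ this)
  have := huniq.unique (y₁ := ρ x) (y₂ := ρ (φ.eval (τ - τ₀)))
    ⟨by rw [← map_sub]; exact hρnil _ (by rw [← neg_sub, dvd_neg]; exact hx), by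
      rw [coe_aeval_eq_eval, eval_map_apply, map_evalRingHom_eval, hfx, map_zero]⟩
    ⟨by rw [← map_sub]; exact hρnil _ hφu, by
      rw [coe_aeval_eq_eval, eval_map_apply, map_evalRingHom_eval, hρ0]
      exact hroot⟩
  rwa [← sub_eq_zero, ← map_sub, hρ0] at this

end Local

end Polynomial

namespace Polynomial

theorem exists_ne_zero_of_card_lt {F V ι κ : Type*} [Field F] [AddCommGroup V] [Module F V]
    [Fintype ι] [Fintype κ] (hc : Fintype.card κ < Fintype.card ι) (T : V →ₗ[F] (κ → F))
    (v : ι → V) : ∃ c : ι → F, c ≠ 0 ∧ T (∑ s, c s • v s) = 0 := by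
  have h : ¬ LinearIndependent F (fun s => T (v s)) := fun h => by
    have := h.fintype_card_le_finrank
    rw [Module.finrank_fintype_fun_eq_card] at this
    omega
  obtain ⟨c, hc, s, hs⟩ := Fintype.not_linearIndependent_iff.1 h
  exact ⟨c, fun h => hs (by simp [h]), by simpa using hc⟩

/-- The parameter count behind the auxiliary polynomial. -/
theorem auxiliary_count {n δ d : ℕ} (hn : 0 < n) (hδ : 0 < δ) (hd : n ≤ d * δ) (hdn : d ≤ n) :
    Fintype.card (Σ l : Fin (δ * (n * (δ + 1))), Fin (d * (δ * (n * (δ + 1)) - l))) <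
      Fintype.card (Σ s : Fin (n * (δ + 1)) × Fin δ,
        Fin (d * (δ * (n * (δ + 1))) - (n - 1) * (s.1 + s.2))) := by
  simp only [Fintype.card_sigma, Fintype.card_fin, Fintype.sum_prod_type]
  obtain ⟨ν, rfl⟩ : ∃ ν, n = ν + 1 := ⟨n - 1, by omega⟩
  set M := (ν + 1) * (δ + 1) with hM
  set k := δ * M with hk
  have gauss : ∀ N : ℕ, (2 : ℤ) * ∑ i : Fin N, (i : ℤ) = N * (N - 1) := fun N => by
    rw [Fin.sum_univ_eq_sum_range (fun i => (i : ℤ)) N]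
    induction N with
    | zero => simp
    | succ N ih => rw [Finset.sum_range_succ, mul_add, ih]; push_cast; ring
  have h1 : (2 : ℤ) * ((∑ l : Fin k, d * (k - (l : ℕ)) : ℕ) : ℤ) = d * (k * (k + 1)) := by
    have : ((∑ l : Fin k, d * (k - (l : ℕ)) : ℕ) : ℤ) = ∑ l : Fin k, (d : ℤ) * (k - (l : ℤ)) := by
      push_cast
      refine Finset.sum_congr rfl fun l _ => ?_
      rw [Nat.cast_sub l.2.le]
    rw [this, ← Finset.mul_sum, Finset.sum_sub_distrib]
    have := gauss k
    simp only [Finset.sum_const, Finset.card_univ, Fintype.card_fin, nsmul_eq_mul]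
    linear_combination (-d : ℤ) * this
  have h2 : (d * (k * k) * 2 - ν * (k * (M - 1) + k * (δ - 1)) : ℤ) ≤
      2 * ((∑ i : Fin M, ∑ j : Fin δ, (d * k - (ν + 1 - 1) * ((i : ℕ) + j)) : ℕ) : ℤ) := by
    have : (∑ i : Fin M, ∑ j : Fin δ, ((d : ℤ) * k - ν * ((i : ℤ) + j))) ≤
        ((∑ i : Fin M, ∑ j : Fin δ, (d * k - (ν + 1 - 1) * ((i : ℕ) + j)) : ℕ) : ℤ) := by
      push_cast
      refine Finset.sum_le_sum fun i _ => Finset.sum_le_sum fun j _ => ?_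
      have : ((d * k : ℕ) : ℤ) - ((ν + 1 - 1) * ((i : ℕ) + j) : ℕ) ≤
        ((d * k - (ν + 1 - 1) * ((i : ℕ) + j) : ℕ) : ℤ) := by omega
      simpa using this
    refine le_trans (le_of_eq ?_) (mul_le_mul_of_nonneg_left this (by norm_num))
    have e1 := gauss M
    have e2 := gauss δ
    simp only [Finset.sum_sub_distrib, ← Finset.mul_sum, Finset.sum_add_distrib,
      Finset.sum_const, Finset.card_univ, Fintype.card_fin, nsmul_eq_mul]
    rw [hk]
    push_cast
    linear_combination (ν * δ : ℤ) * e1 + (ν * M : ℤ) * e2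
  have hkpos : (0 : ℤ) < k := by rw [hk]; positivity
  have h3 : (ν : ℤ) * (M + δ - 2) < d * (k - 1) := by
    have hd' : ((ν : ℤ) + 1) ≤ d * δ := by exact_mod_cast hd
    have hdn' : (d : ℤ) ≤ ν + 1 := by exact_mod_cast hdn
    have hM' : (M : ℤ) = (ν + 1) * (δ + 1) := by exact_mod_cast hM
    have hk' : (k : ℤ) = δ * M := by exact_mod_cast hk
    have : ((ν : ℤ) + 1) * M ≤ d * δ * M := mul_le_mul_of_nonneg_right hd' (by positivity)
    have hδ' : (0 : ℤ) < δ := by exact_mod_cast hδ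
    rw [hk']
    nlinarith
  have h4 := mul_lt_mul_of_pos_left h3 hkpos
  have : (2 : ℤ) * ((∑ l : Fin k, d * (k - (l : ℕ)) : ℕ) : ℤ) <
    2 * ((∑ i : Fin M, ∑ j : Fin δ, (d * k - (ν + 1 - 1) * ((i : ℕ) + j)) : ℕ) : ℤ) := by
    rw [h1]
    refine lt_of_lt_of_le ?_ h2
    linarith
  exact_mod_cast (mul_lt_mul_iff_right₀ (by norm_num : (0 : ℤ) < 2)).1 this

/-- The points in a box on a curve that reduce to a given smooth point modulo `P` lie on an
auxiliary curve of small degree. -/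
theorem exists_auxiliary {F : Type*} [Field F] {n δ d : ℕ} (hn : 0 < n) (hδ : 0 < δ)
    (hd : n ≤ d * δ) (hdn : d ≤ n) {P : F[X]} (hPm : P.Monic) (hP : Irreducible P)
    (hPd : P.natDegree = d) (f : F[X][X][X]) (τ₀ x₀ : F[X]) (h0 : P ∣ f.evalEval τ₀ x₀)
    (h1 : ¬ P ∣ f.derivative.evalEval τ₀ x₀) :
    ∃ g : F[X][X][X], g ≠ 0 ∧ g.natDegree < δ ∧
      (∀ j, (g.coeff j).natDegree ≤ n * (δ + 1)) ∧
      ∀ τ x : F[X], τ.natDegree < n → x.natDegree < n → P ∣ τ - τ₀ → P ∣ x - x₀ →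
        f.evalEval τ x = 0 → g.evalEval τ x = 0 := by
  set M := n * (δ + 1) with hM
  set k := δ * M with hk
  have hkpos : 0 < k := by positivity
  obtain ⟨φ, hφ⟩ := exists_local_parametrization hP hkpos.ne' f τ₀ x₀ h0 h1
  let T : F[X][X][X] →ₗ[F] ((Σ l : Fin k, Fin (d * (k - l))) → F) :=
    { toFun := fun g s => (((g.map (compRingHom (X + C τ₀))).eval φ).coeff s.1 %ₘ
        P ^ (k - (s.1 : ℕ))).coeff s.2
      map_add' := fun g g' => by
        ext s
        simp [add_modByMonic]
      map_smul' := fun a g => by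
        ext s
        have : a • g = C (C (C a)) * g := by
          ext; simp
        rw [this]
        simp [← smul_eq_C_mul, smul_modByMonic] }
  let ι := Σ s : Fin M × Fin δ, Fin (d * k - (n - 1) * (s.1 + s.2))
  obtain ⟨c, hc0, hc⟩ := exists_ne_zero_of_card_lt (auxiliary_count hn hδ hd hdn) T
    (fun s : ι => monomial (s.1.2 : ℕ) (monomial (s.1.1 : ℕ) (monomial (s.2 : ℕ) (1 : F))))
  set g := ∑ s : ι, c s • monomial (s.1.2 : ℕ)
    (monomial (s.1.1 : ℕ) (monomial (s.2 : ℕ) (1 : F))) with hg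
  refine ⟨g, ?_, ?_, ?_, ?_⟩
  · obtain ⟨s, hs⟩ := Function.ne_iff.1 hc0
    intro h
    have : ((g.coeff s.1.2).coeff s.1.1).coeff s.2 = c s := by
      simp only [hg, finsetSum_coeff, coeff_smul]
      rw [Finset.sum_eq_single s]
      · simp
      · rintro ⟨⟨i, j⟩, a⟩ - hne
        obtain ⟨⟨i', j'⟩, a'⟩ := s
        by_cases hj : j = j'
        · subst hj
          by_cases hi : i = i'
          · subst hi
            have : (a : ℕ) ≠ a' := fun h => hne (by simpa [Fin.ext_iff] using h)
            simp [coeff_monomial, this]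
          · simp [coeff_monomial, Fin.val_inj, hi]
        · simp [coeff_monomial, Fin.val_inj, hj]
      · simp
    exact hs (by simpa [h] using this.symm)
  · refine lt_of_le_of_lt (natDegree_sum_le_of_forall_le (n := δ - 1) _ _ fun s _ =>
      (natDegree_smul_le _ _).trans ((natDegree_monomial_le _).trans ?_)) (by omega)
    have := s.1.2.2
    omega
  · intro j
    simp only [hg, finsetSum_coeff, coeff_smul]
    refine natDegree_sum_le_of_forall_le _ _ fun s _ => (natDegree_smul_le _ _).trans ?_
    rw [coeff_monomial]
    split_ifs
    · exact (natDegree_monomial_le _).trans s.1.1.2.le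
    · simp
  · intro τ x hτ hx hPτ hPx hfx
    have hmem : (g.map (compRingHom (X + C τ₀))).eval φ ∈ germIdeal P ^ k := by
      refine mem_germIdeal_pow_of_coeff fun l hl => ?_
      rw [← modByMonic_eq_zero_iff_dvd (hPm.pow _)]
      ext a
      by_cases ha : a < d * (k - l)
      · exact congrFun hc ⟨⟨l, hl⟩, ⟨a, ha⟩⟩
      · refine coeff_eq_zero_of_natDegree_lt (lt_of_lt_of_le
          (natDegree_modByMonic_lt _ (hPm.pow _) ?_) ?_)
        · intro h1
          have := congrArg natDegree h1
          rw [natDegree_pow, hPd, natDegree_one] at this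
          have : 0 < d := by
            rw [← hPd]; exact hP.natDegree_pos
          have : 0 < k - l := by omega
          have := Nat.mul_pos this ‹0 < d›
          omega
        · rw [natDegree_pow, hPd, mul_comm]
          exact not_lt.1 ha
    have hdvd := pow_dvd_eval_of_mem_germIdeal_pow hPτ hmem
    rw [evalEval_eq_eval_map_comp, sub_add_cancel] at hdvd
    have hdvd' : P ^ k ∣ g.evalEval τ x :=
      (dvd_iff_dvd_of_dvd_sub (dvd_evalEval_sub g (by simp) (hφ τ x hPτ hPx hfx))).2 hdvd
    refine eq_zero_of_dvd_of_natDegree_lt hdvd' ?_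
    rw [natDegree_pow, hPd]
    have hdk : 0 < k * d := Nat.mul_pos hkpos (by rw [← hPd]; exact hP.natDegree_pos)
    refine lt_of_le_of_lt ?_ (Nat.sub_one_lt hdk.ne')
    rw [hg, evalEval_finsetSum]
    refine natDegree_sum_le_of_forall_le _ _ fun s _ => ?_
    have : (c s • monomial (s.1.2 : ℕ)
      (monomial (s.1.1 : ℕ) (monomial (s.2 : ℕ) (1 : F)))).evalEval τ x =
        C (c s) * X ^ (s.2 : ℕ) * τ ^ (s.1.1 : ℕ) * x ^ (s.1.2 : ℕ) := by
      simp [evalEval, ← C_mul_X_pow_eq_monomial, smul_eq_C_mul, mul_assoc]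
    rw [this]
    have e1 : (C (c s) * X ^ (s.2 : ℕ)).natDegree ≤ (s.2 : ℕ) := natDegree_C_mul_X_pow_le _ _
    have e2 : (τ ^ (s.1.1 : ℕ)).natDegree ≤ s.1.1 * (n - 1) :=
      natDegree_pow_le_of_le _ (by omega)
    have e3 : (x ^ (s.1.2 : ℕ)).natDegree ≤ s.1.2 * (n - 1) :=
      natDegree_pow_le_of_le _ (by omega)
    refine (natDegree_mul_le_of_le (natDegree_mul_le_of_le e1 e2) e3).trans ?_
    have := s.2.2
    have e4 : (n - 1) * ((s.1.1 : ℕ) + (s.1.2 : ℕ)) = s.1.1 * (n - 1) + s.1.2 * (n - 1) := by ring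
    rw [mul_comm k d]
    omega

end Polynomial

namespace Polynomial

section Bivariate

variable {A : Type*} [CommRing A] {a b : ℕ}

/-- The bivariate polynomial with coefficients `c (i, j)` at `Y ^ i X ^ j`. -/
noncomputable def ofCoeffs (c : Fin a × Fin b → A) : A[X][X] :=
  ∑ s, monomial (s.2 : ℕ) (monomial (s.1 : ℕ) (c s))

theorem coeff_coeff_ofCoeffs (c : Fin a × Fin b → A) (i j : ℕ) :
    ((ofCoeffs c).coeff j).coeff i =
      if h : i < a ∧ j < b then c (⟨i, h.1⟩, ⟨j, h.2⟩) else 0 := by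
  simp only [ofCoeffs, finsetSum_coeff]
  split_ifs with h
  · rw [Finset.sum_eq_single (⟨i, h.1⟩, ⟨j, h.2⟩)]
    · simp
    · rintro ⟨i', j'⟩ - hne
      by_cases hj : (j' : ℕ) = j
      · have hi : (i' : ℕ) ≠ i := fun hi => hne (by simp [← hi, ← hj])
        simp [coeff_monomial, hj, hi]
      · simp [coeff_monomial, hj]
    · simp
  · refine Finset.sum_eq_zero fun s _ => ?_
    by_cases hj : (s.2 : ℕ) = j
    · have hi : (s.1 : ℕ) ≠ i := fun hi => h ⟨hi ▸ s.1.2, hj ▸ s.2.2⟩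
      simp [coeff_monomial, hj, hi]
    · simp [coeff_monomial, hj]

theorem ofCoeffs_ne_zero {c : Fin a × Fin b → A} (hc : c ≠ 0) : ofCoeffs c ≠ 0 := by
  obtain ⟨⟨i, j⟩, hs⟩ := Function.ne_iff.1 hc
  intro h
  have := coeff_coeff_ofCoeffs c i j
  simp only [h, coeff_zero, i.2, j.2, and_self, dite_true] at this
  exact hs this.symm

theorem natDegree_ofCoeffs_lt (hb : 0 < b) (c : Fin a × Fin b → A) :
    (ofCoeffs c).natDegree < b := by
  refine lt_of_le_of_lt (natDegree_sum_le_of_forall_le (n := b - 1) _ _ fun s _ =>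
    (natDegree_monomial_le _).trans ?_) (by omega)
  have := s.2.2
  omega

theorem natDegree_coeff_ofCoeffs_le (c : Fin (a + 1) × Fin b → A) (j : ℕ) :
    ((ofCoeffs c).coeff j).natDegree ≤ a := by
  refine natDegree_le_iff_coeff_eq_zero.2 fun i hi => ?_
  rw [coeff_coeff_ofCoeffs, dif_neg (by omega)]

theorem evalEval_ofCoeffs (c : Fin a × Fin b → A) (y x : A) :
    (ofCoeffs c).evalEval y x = ∑ s, c s * (y ^ (s.1 : ℕ) * x ^ (s.2 : ℕ)) := by
  rw [ofCoeffs, evalEval_finsetSum]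
  refine Finset.sum_congr rfl fun s _ => ?_
  simp [evalEval, mul_assoc]

theorem map_ofCoeffs {B : Type*} [CommRing B] (φ : A →+* B) (c : Fin a × Fin b → A) :
    (ofCoeffs c).map (mapRingHom φ) = ofCoeffs (φ ∘ c) := by
  simp [ofCoeffs, Polynomial.map_sum]

theorem eq_ofCoeffs {f : A[X][X]} (hf : ∀ j, b ≤ j → f.coeff j = 0)
    (hfc : ∀ j, (f.coeff j).natDegree ≤ a) :
    f = ofCoeffs fun s : Fin (a + 1) × Fin b => (f.coeff s.2).coeff s.1 := by
  ext j i
  rw [coeff_coeff_ofCoeffs]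
  split_ifs with h
  · rfl
  · by_cases hj : j < b
    · exact coeff_eq_zero_of_natDegree_lt (lt_of_le_of_lt (hfc j) (by omega))
    · simp [hf j (not_lt.1 hj)]

theorem Monic.eq_X_pow_add_ofCoeffs {f : A[X][X]} (hf : f.Monic)
    (hfc : ∀ j, (f.coeff j).natDegree ≤ a) :
    f = X ^ f.natDegree +
      ofCoeffs fun s : Fin (a + 1) × Fin f.natDegree => (f.coeff s.2).coeff s.1 := by
  have h : f - X ^ f.natDegree =
      ofCoeffs fun s : Fin (a + 1) × Fin f.natDegree => (f.coeff s.2).coeff s.1 := by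
    have hc : ∀ j, j ≠ f.natDegree → (f - X ^ f.natDegree).coeff j = f.coeff j := by
      intro j hj
      simp [coeff_X_pow, hj]
    rw [eq_ofCoeffs (f := f - X ^ f.natDegree) (a := a) (b := f.natDegree)]
    · congr 1
      ext s
      rw [hc _ s.2.2.ne]
    · intro j hj
      rcases hj.eq_or_lt with rfl | hj
      · simp [hf.coeff_natDegree]
      · rw [hc _ hj.ne', coeff_eq_zero_of_natDegree_lt hj]
    · intro j
      by_cases hj : j = f.natDegree
      · simp [hj, hf.coeff_natDegree]
      · rw [hc _ hj]; exact hfc j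
  rw [← h]; ring

end Bivariate

/-- Cramer's rule: a plane curve through sufficiently many integral points in general position has
an integral equation of small height. -/
theorem exists_integral_equation {F K : Type*} [Field F] [Field K] {ι : F[X] →+* K}
    {n δ : ℕ} {f : K[X][X]} (hf : f.Monic) (hfδ : f.natDegree = δ)
    (hfc : ∀ j, (f.coeff j).natDegree ≤ δ) (z : Fin (δ + 1) × Fin δ → F[X] × F[X])
    (hzn : ∀ l, (z l).1.natDegree ≤ n ∧ (z l).2.natDegree ≤ n)
    (hzf : ∀ l, f.evalEval (ι (z l).2) (ι (z l).1) = 0)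
    (hdet : (Matrix.of fun l s : Fin (δ + 1) × Fin δ =>
      ι (z l).2 ^ (s.1 : ℕ) * ι (z l).1 ^ (s.2 : ℕ)).det ≠ 0) :
    ∃ (f₀ : F[X][X][X]) (Δ : K), Δ ≠ 0 ∧ f₀.map (mapRingHom ι) = C (C Δ) * f ∧
      ∀ i j, ((f₀.coeff j).coeff i).natDegree ≤ (δ + 1) * δ * (2 * δ * n) := by
  classical
  set M : Matrix (Fin (δ + 1) × Fin δ) (Fin (δ + 1) × Fin δ) F[X] :=
    Matrix.of fun l s => (z l).2 ^ (s.1 : ℕ) * (z l).1 ^ (s.2 : ℕ) with hM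
  have hMι : M.map ι = Matrix.of fun l s : Fin (δ + 1) × Fin δ =>
      ι (z l).2 ^ (s.1 : ℕ) * ι (z l).1 ^ (s.2 : ℕ) := by
    ext; simp [hM]
  set b : Fin (δ + 1) × Fin δ → F[X] := fun l => - (z l).1 ^ δ with hb
  have hMdeg : ∀ l s, (M l s).natDegree ≤ 2 * δ * n := by
    intro l s
    refine (natDegree_mul_le_of_le (natDegree_pow_le_of_le _ (hzn l).2)
      (natDegree_pow_le_of_le _ (hzn l).1)).trans ?_
    rw [← add_mul]
    have := s.1.2
    have := s.2.2
    gcongr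
    omega
  have hbdeg : ∀ l, (b l).natDegree ≤ 2 * δ * n := by
    intro l
    rw [hb, natDegree_neg]
    refine (natDegree_pow_le_of_le _ (hzn l).1).trans ?_
    gcongr
    omega
  have hcard : Fintype.card (Fin (δ + 1) × Fin δ) = (δ + 1) * δ := by simp
  set u := M.cramer b with hu
  have hudeg : ∀ s, (u s).natDegree ≤ (δ + 1) * δ * (2 * δ * n) := by
    intro s
    rw [hu, Matrix.cramer_apply, ← hcard]
    refine (IsDegreeLike.natDegree F).det_le _ _ fun l s' => ?_
    rw [Matrix.updateCol_apply]
    split_ifs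
    · exact hbdeg l
    · exact hMdeg l s'
  have hDdeg : M.det.natDegree ≤ (δ + 1) * δ * (2 * δ * n) := by
    rw [← hcard]
    exact (IsDegreeLike.natDegree F).det_le _ _ hMdeg
  set a : Fin (δ + 1) × Fin δ → K := fun s => (f.coeff s.2).coeff s.1 with ha
  have hfa : f = X ^ δ + ofCoeffs a := by
    have := hf.eq_X_pow_add_ofCoeffs hfc
    subst hfδ
    exact this
  have hdetι : ι M.det = (M.map ι).det := RingHom.map_det _ _
  have hsys : (M.map ι).mulVec a = ι ∘ b := by
    ext l
    have h := hzf l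
    rw [hfa, evalEval_add, evalEval_ofCoeffs] at h
    simp only [hMι, Matrix.mulVec, dotProduct, Matrix.of_apply, Function.comp, hb, map_neg, map_pow]
    rw [eq_neg_iff_add_eq_zero, add_comm]
    simpa [evalEval, mul_comm, mul_left_comm, mul_assoc] using h
  have hua : ∀ s, ι (u s) = ι M.det * a s := by
    intro s
    have h1 : (M.map ι).cramer (ι ∘ b) = (M.map ι).det • a := by
      rw [← hsys, Matrix.cramer_eq_adjugate_mulVec, Matrix.mulVec_mulVec, Matrix.adjugate_mul,
        Matrix.smul_mulVec, Matrix.one_mulVec]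
    have h2 : ι (u s) = (M.map ι).cramer (ι ∘ b) s := by
      rw [hu, Matrix.cramer_apply, Matrix.cramer_apply, RingHom.map_det, RingHom.mapMatrix_apply,
        Matrix.map_updateCol]
    rw [h2, h1, hdetι]
    simp
  refine ⟨C (C M.det) * X ^ δ + ofCoeffs u, ι M.det, ?_, ?_, ?_⟩
  · rw [hdetι, hMι]; exact hdet
  · have hcomp : ι ∘ u = fun s => ι M.det * a s := _root_.funext hua
    have hsmul : ofCoeffs (fun s => ι M.det * a s) = C (C (ι M.det)) * ofCoeffs a := by
      simp only [ofCoeffs, Finset.mul_sum, C_mul_monomial]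
    rw [Polynomial.map_add, map_ofCoeffs, hcomp, hsmul]
    conv_rhs => rw [hfa]
    simp [mul_add]
  · intro i j
    rw [coeff_add, coeff_add]
    refine (natDegree_add_le _ _).trans (max_le ?_ ?_)
    · rw [coeff_C_mul, coeff_X_pow]
      split_ifs
      · rw [mul_one, coeff_C]
        split_ifs
        · exact hDdeg
        · simp
      · simp
    · rw [coeff_coeff_ofCoeffs]
      split_ifs
      · exact hudeg _
      · simp

end Polynomial

namespace Polynomial

theorem card_adjoinRoot {F : Type*} [Field F] [Fintype F] {P : F[X]} (hP : P.Monic) :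
    Nat.card (AdjoinRoot P) = Fintype.card F ^ P.natDegree := by
  have := hP.finite_adjoinRoot
  rw [Module.natCard_eq_pow_finrank (K := F), Nat.card_eq_fintype_card,
    (AdjoinRoot.powerBasis hP.ne_zero).finrank, AdjoinRoot.powerBasis_dim]

/-- The number of smooth points of a plane curve over a finite field. -/
theorem card_smooth_zeros_le {k : Type*} [Field k] [Finite k] {f : k[X][X]} {δ : ℕ}
    (hf : f.natDegree ≤ δ) (S : Finset (k × k)) (h0 : ∀ z ∈ S, f.evalEval z.2 z.1 = 0)
    (h1 : ∀ z ∈ S, f.derivative.evalEval z.2 z.1 ≠ 0) : S.card ≤ δ * Nat.card k := by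
  classical
  let := Fintype.ofFinite k
  rw [Nat.card_eq_fintype_card, ← Finset.card_univ]
  refine Finset.card_le_mul_card_image_of_maps_to (f := Prod.snd) (by simp) _ fun y _ => ?_
  rcases (S.filter fun z => z.2 = y).eq_empty_or_nonempty with he | ⟨z₀, hz₀⟩
  · simp [he]
  rw [Finset.mem_filter] at hz₀
  have hne : f.map (evalRingHom y) ≠ 0 := by
    intro h
    refine h1 z₀ hz₀.1 ?_
    rw [← map_evalRingHom_eval, ← derivative_map, hz₀.2, h]
    simp
  have hle : (S.filter fun z => z.2 = y).card ≤ (f.map (evalRingHom y)).roots.toFinset.card := by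
    refine Finset.card_le_card_of_injOn Prod.fst ?_ ?_
    · intro z hz
      simp only [Finset.coe_filter, Set.mem_ofPred_eq] at hz
      have := h0 z hz.1
      rw [hz.2, ← map_evalRingHom_eval] at this
      simp only [Finset.mem_coe, Multiset.mem_toFinset, mem_roots hne]
      exact this
    · rintro ⟨x, y⟩ hz ⟨x', y'⟩ hz' hxx
      simp only [Finset.coe_filter, Set.mem_ofPred_eq] at hz hz' hxx
      rw [hxx, hz.2, hz'.2]
  calc _ ≤ _ := hle
    _ ≤ (f.map (evalRingHom y)).roots.card := Multiset.toFinset_card_le _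
    _ ≤ (f.map (evalRingHom y)).natDegree := card_roots' _
    _ ≤ _ := natDegree_map_le.trans hf

section PlaneCurve

variable {F K : Type*} [Field F] [Field K] {ι : F[X] →+* K} {n δ d : ℕ}
  {f : K[X][X]}

/-- The points in a box on a plane curve that lie on another curve. -/
theorem card_box_common_zeros_le (hι : Function.Injective ι) (hf : f.Monic)
    (hirr : Irreducible f) (hfδ : f.natDegree = δ) {g : K[X][X]} (hg : g ≠ 0)
    (hgδ : g.natDegree < δ) (e : ℕ) (hfe : ∀ j, (f.coeff j).natDegree ≤ e)
    (hge : ∀ j, (g.coeff j).natDegree ≤ e) (S : Finset (F[X] × F[X]))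
    (hSf : ∀ z ∈ S, f.evalEval (ι z.2) (ι z.1) = 0)
    (hSg : ∀ z ∈ S, g.evalEval (ι z.2) (ι z.1) = 0) : S.card ≤ δ * (2 * δ * e) := by
  classical
  have hinj : Function.Injective (Prod.map ι ι) := hι.prodMap hι
  rw [← Finset.card_image_of_injective S hinj]
  refine (card_common_zeros_le hf hirr (hf.not_dvd_of_natDegree_lt hg (by omega)) e hfe hge _
    ?_ ?_).trans ?_
  · exact Finset.forall_mem_image.2 hSf
  · exact Finset.forall_mem_image.2 hSg
  · rw [hfδ]
    gcongr
    omega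

theorem card_mul_le_natDegree_of_dvd {w : F[X]} (hw : w ≠ 0) (Ps : Finset F[X])
    (hPs : ∀ P ∈ Ps, P.Monic ∧ Irreducible P ∧ P.natDegree = d) (hdvd : ∀ P ∈ Ps, P ∣ w) :
    Ps.card * d ≤ w.natDegree := by
  have h : ∏ P ∈ Ps, P ∣ w := by
    refine Finset.prod_dvd_of_coprime (fun P hP Q hQ hne => ?_) hdvd
    refine (hPs P hP).2.1.coprime_iff_not_dvd.2 fun hPQ => hne ?_
    exact eq_of_monic_of_associated (hPs P hP).1 (hPs Q hQ).1
      ((hPs P hP).2.1.associated_of_dvd (hPs Q hQ).2.1 hPQ)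
  have h2 := natDegree_le_of_dvd h hw
  rwa [natDegree_prod_of_monic _ _ fun P hP => (hPs P hP).1,
    Finset.sum_congr rfl fun P hP => (hPs P hP).2.2, Finset.sum_const, smul_eq_mul] at h2

theorem natDegree_evalEval_le {g : F[X][X][X]} {a b e : ℕ} (hg : g.natDegree ≤ b)
    (hgc : ∀ j, (g.coeff j).natDegree ≤ a) (hge : ∀ i j, ((g.coeff j).coeff i).natDegree ≤ e)
    {τ x : F[X]} (hτ : τ.natDegree ≤ n) (hx : x.natDegree ≤ n) :
    (g.evalEval τ x).natDegree ≤ e + (a + b) * n := by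
  rw [eq_ofCoeffs (f := g) (a := a) (b := b + 1)
    (fun j hj => coeff_eq_zero_of_natDegree_lt (by omega)) hgc, evalEval_ofCoeffs]
  refine natDegree_sum_le_of_forall_le _ _ fun s _ => ?_
  refine (natDegree_mul_le_of_le (hge _ _) (natDegree_mul_le_of_le
    (natDegree_pow_le_of_le _ hτ) (natDegree_pow_le_of_le _ hx))).trans ?_
  rw [← add_mul]
  gcongr
  · exact Nat.lt_succ_iff.1 s.1.2
  · exact Nat.lt_succ_iff.1 s.2.2

variable [Fintype F]

/-- The points in a box on a plane curve that are smooth modulo a given prime. -/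
theorem card_box_smooth_zeros_le (hι : Function.Injective ι) (hn : 0 < n) (hδ : 0 < δ)
    (hd : n ≤ d * δ) (hdn : d ≤ n) (hf : f.Monic) (hirr : Irreducible f) (hfδ : f.natDegree = δ)
    (hfc : ∀ j, (f.coeff j).natDegree ≤ δ) {f₀ : F[X][X][X]} {Δ : K}
    (hf₀ : f₀.map (mapRingHom ι) = C (C Δ) * f) {P : F[X]} (hPm : P.Monic)
    (hP : Irreducible P) (hPd : P.natDegree = d) (S : Finset (F[X] × F[X]))
    (hSn : ∀ z ∈ S, z.1.natDegree < n ∧ z.2.natDegree < n)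
    (hSf : ∀ z ∈ S, f.evalEval (ι z.2) (ι z.1) = 0)
    (hSP : ∀ z ∈ S, ¬ P ∣ f₀.derivative.evalEval z.2 z.1) :
    S.card ≤ δ * (2 * δ * (n * (δ + 1))) * (δ * Fintype.card F ^ d) := by
  classical
  have : Fact (Irreducible P) := ⟨hP⟩
  have hfin := hPm.finite_adjoinRoot
  have : Finite (AdjoinRoot P) := Module.finite_of_finite F
  set ρ := AdjoinRoot.mk P with hρ
  have hf₀z : ∀ z ∈ S, f₀.evalEval z.2 z.1 = 0 := by
    intro z hz
    apply hι
    rw [← map_mapRingHom_evalEval, hf₀, evalEval_mul, hSf z hz, mul_zero, map_zero]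
  have hf₀deg : f₀.natDegree ≤ δ := by
    have h1 : (f₀.map (mapRingHom ι)).natDegree = f₀.natDegree :=
      natDegree_map_eq_of_injective (map_injective ι hι) f₀
    rw [← h1, hf₀, ← hfδ]
    exact natDegree_C_mul_le _ _
  have himage : (S.image (Prod.map ρ ρ)).card ≤ δ * Fintype.card F ^ d := by
    rw [← hPd, ← card_adjoinRoot hPm]
    refine card_smooth_zeros_le (f := f₀.map (mapRingHom ρ)) (natDegree_map_le.trans hf₀deg) _ ?_ ?_
    · simp only [Finset.forall_mem_image, Prod.map_fst, Prod.map_snd]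
      intro z hz
      rw [map_mapRingHom_evalEval, hf₀z z hz, map_zero]
    · simp only [Finset.forall_mem_image, Prod.map_fst, Prod.map_snd]
      intro z hz
      rw [derivative_map, map_mapRingHom_evalEval, hρ, Ne, AdjoinRoot.mk_eq_zero]
      exact hSP z hz
  refine (Finset.card_le_mul_card_image S (f := Prod.map ρ ρ) _ fun c hc => ?_).trans
    (Nat.mul_le_mul_left _ himage)
  obtain ⟨z₀, hz₀, rfl⟩ := Finset.mem_image.1 hc
  obtain ⟨g, hg0, hgδ, hgc, hg⟩ := exists_auxiliary hn hδ hd hdn hPm hP hPd f₀ z₀.2 z₀.1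
    (by simp [hf₀z z₀ hz₀]) (hSP z₀ hz₀)
  have hinj : Function.Injective (mapRingHom ι) := map_injective ι hι
  have hδn : δ ≤ n * (δ + 1) := by nlinarith
  refine card_box_common_zeros_le hι hf hirr hfδ (g := g.map (mapRingHom ι))
    ((Polynomial.map_ne_zero_iff hinj).2 hg0) (natDegree_map_le.trans_lt hgδ) _
    (fun j => (hfc j).trans hδn) (fun j => ?_) _ ?_ ?_
  · rw [coeff_map]
    exact natDegree_map_le.trans (hgc j)
  · intro z hz
    exact hSf z (Finset.mem_filter.1 hz).1
  · intro z hz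
    obtain ⟨hzS, hzz⟩ := Finset.mem_filter.1 hz
    have h1 : ∀ a b : F[X], ρ a = ρ b → P ∣ a - b := fun a b h => AdjoinRoot.mk_eq_mk.1 h
    rw [Prod.ext_iff] at hzz
    rw [map_mapRingHom_evalEval, hg z.2 z.1 (hSn z hzS).2 (hSn z hzS).1 (h1 _ _ hzz.2)
      (h1 _ _ hzz.1) (hf₀z z hzS), map_zero]

/-- The number of primes needed to count points on plane curves of degree `δ`. -/
def primesNeeded (δ : ℕ) : ℕ := δ * ((δ + 1) * δ * (2 * δ) + (δ + δ)) + 1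

/-- The constant in the bound for the number of points on plane curves of degree `δ`. -/
def curveConst (δ : ℕ) : ℕ :=
  2 * (δ * (2 * δ * δ)) + primesNeeded δ * (δ * (2 * δ * (δ + 1)) * δ)

/-- The number of points in a box on an irreducible plane curve. -/
theorem card_box_zeros_le (hι : Function.Injective ι) (hn : 0 < n) (hδ : 0 < δ)
    (hd : n ≤ d * δ) (hdn : d ≤ n) (hchar : (δ : K) ≠ 0)
    (hq : 2 * primesNeeded δ ≤ Fintype.card F) (hf : f.Monic) (hirr : Irreducible f)
    (hfδ : f.natDegree = δ) (hfc : ∀ j, (f.coeff j).natDegree ≤ δ)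
    (S : Finset (F[X] × F[X])) (hSn : ∀ z ∈ S, z.1.natDegree < n ∧ z.2.natDegree < n)
    (hSf : ∀ z ∈ S, f.evalEval (ι z.2) (ι z.1) = 0) :
    S.card ≤ curveConst δ * n * Fintype.card F ^ d := by
  classical
  have hd0 : 0 < d := by
    rcases Nat.eq_zero_or_pos d with rfl | h
    · omega
    · exact h
  have hq1 : 1 ≤ Fintype.card F ^ d := Nat.one_le_pow _ _ Fintype.card_pos
  have hconst : 2 * (δ * (2 * δ * δ)) ≤ 2 * (δ * (2 * δ * δ)) * (n * Fintype.card F ^ d) :=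
    Nat.le_mul_of_pos_right _ (by positivity)
  have htot : curveConst δ * n * Fintype.card F ^ d =
      2 * (δ * (2 * δ * δ)) * (n * Fintype.card F ^ d) +
      primesNeeded δ * (δ * (2 * δ * (n * (δ + 1))) * (δ * Fintype.card F ^ d)) := by
    rw [curveConst]; ring
  rcases exists_hyperplane_or_det_ne_zero (K := K) (I := S)
    (fun z (s : Fin (δ + 1) × Fin δ) => ι z.1.2 ^ (s.1 : ℕ) * ι z.1.1 ^ (s.2 : ℕ)) with
    ⟨c, hc, hcz⟩ | ⟨r, hr⟩
  · have := card_box_common_zeros_le hι hf hirr hfδ (ofCoeffs_ne_zero hc)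
      (natDegree_ofCoeffs_lt hδ c) δ hfc (natDegree_coeff_ofCoeffs_le c) S hSf
      (fun z hz => by rw [evalEval_ofCoeffs]; exact hcz ⟨z, hz⟩)
    rw [htot]
    omega
  obtain ⟨f₀, Δ, hΔ, hf₀, hf₀c⟩ := exists_integral_equation (n := n) hf hfδ hfc
    (fun l => (r l).1) (fun l => ⟨(hSn _ (r l).2).1.le, (hSn _ (r l).2).2.le⟩)
    (fun l => hSf _ (r l).2) hr
  set S₀ := S.filter fun z => f.derivative.evalEval (ι z.2) (ι z.1) = 0 with hS₀
  have hder : f.derivative ≠ 0 := by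
    intro h
    have h1 := congrArg (fun p => (p.coeff (δ - 1)).coeff 0) h
    have h2 : f.coeff δ = 1 := by rw [← hfδ]; exact hf.coeff_natDegree
    have h3 : ((δ - 1 : ℕ) : K) + 1 = δ := by
      rw [Nat.cast_sub hδ]; simp
    simp only [coeff_derivative, Nat.sub_add_cancel hδ, h2, coeff_zero, one_mul] at h1
    rw [coeff_add, ← C_eq_natCast, coeff_C_zero, coeff_one_zero, h3] at h1
    exact hchar h1
  have hS₀card : S₀.card ≤ δ * (2 * δ * δ) := by
    refine card_box_common_zeros_le hι hf hirr hfδ hder ?_ δ hfc (fun j => ?_) S₀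
      (fun z hz => hSf z (Finset.mem_filter.1 hz).1) (fun z hz => (Finset.mem_filter.1 hz).2)
    · rw [← hfδ]; exact natDegree_derivative_lt (by omega)
    · rw [coeff_derivative]
      have : ((j : K[X]) + 1) = C ((j : K) + 1) := by simp
      rw [this]
      exact (natDegree_mul_C_le _ _).trans (hfc _)
  have hJ : 3 ≤ Fintype.card F := by
    refine le_trans ?_ hq
    have : 0 < δ * ((δ + 1) * δ * (2 * δ) + (δ + δ)) := by positivity
    rw [primesNeeded]
    omega
  obtain ⟨Ps, hPs, hPsP⟩ := FiniteField.exists_finset_irreducible F hJ d hd0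
  obtain ⟨Qs, hQs, hQcard⟩ := Finset.exists_subset_card_eq (s := Ps) (n := primesNeeded δ)
    (by omega)
  have hcov : S ⊆ S₀ ∪ Qs.biUnion fun P =>
      S.filter fun z => ¬ P ∣ f₀.derivative.evalEval z.2 z.1 := by
    intro z hz
    by_cases hz0 : f.derivative.evalEval (ι z.2) (ι z.1) = 0
    · exact Finset.mem_union_left _ (Finset.mem_filter.2 ⟨hz, hz0⟩)
    · refine Finset.mem_union_right _ ?_
      by_contra hcon
      have hall : ∀ P ∈ Qs, P ∣ f₀.derivative.evalEval z.2 z.1 := by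
        intro P hP
        by_contra hnd
        exact hcon (Finset.mem_biUnion.2 ⟨P, hP, Finset.mem_filter.2 ⟨hz, hnd⟩⟩)
      have hw : f₀.derivative.evalEval z.2 z.1 ≠ 0 := by
        intro hw
        have h1 := congrArg ι hw
        rw [← map_mapRingHom_evalEval, ← derivative_map, hf₀, derivative_C_mul, evalEval_mul,
          map_zero, evalEval_C, eval_C] at h1
        exact (mul_ne_zero hΔ hz0) h1
      have h1 := card_mul_le_natDegree_of_dvd hw Qs (fun P hP => hPsP P (hQs hP)) hall
      have h2 : (f₀.derivative.evalEval z.2 z.1).natDegree ≤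
          (δ + 1) * δ * (2 * δ * n) + (δ + δ) * n := by
        have hinj : Function.Injective (mapRingHom ι) := map_injective ι hι
        have e1 : f₀.natDegree ≤ δ := by
          rw [← natDegree_map_eq_of_injective hinj f₀, hf₀, ← hfδ]
          exact natDegree_C_mul_le _ _
        have e2 : ∀ j, (f₀.coeff j).natDegree ≤ δ := by
          intro j
          rw [← natDegree_map_eq_of_injective hι (f₀.coeff j), ← coe_mapRingHom, ← coeff_map, hf₀,
            coeff_C_mul]
          exact (natDegree_C_mul_le _ _).trans (hfc j)
        have e3 : ∀ j : ℕ, ((j : F[X][X]) + 1) = C (C ((j : F) + 1)) := by simp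
        refine natDegree_evalEval_le ((natDegree_derivative_le f₀).trans (by omega)) (fun j => ?_)
          (fun i j => ?_) (hSn z hz).2.le (hSn z hz).1.le
        · rw [coeff_derivative, e3]
          exact (natDegree_mul_C_le _ _).trans (e2 _)
        · rw [coeff_derivative, e3, coeff_mul_C]
          exact (natDegree_mul_C_le _ _).trans (hf₀c _ _)
      have h3 : (δ + 1) * δ * (2 * δ * n) + (δ + δ) * n ≤
          ((δ + 1) * δ * (2 * δ) + (δ + δ)) * (d * δ) := by
        calc _ = ((δ + 1) * δ * (2 * δ) + (δ + δ)) * n := by ring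
          _ ≤ _ := by gcongr
      rw [hQcard, primesNeeded] at h1
      nlinarith
  have h1 := (Finset.card_le_card hcov).trans (Finset.card_union_le _ _)
  have h2 : (Qs.biUnion fun P => S.filter fun z => ¬ P ∣ f₀.derivative.evalEval z.2 z.1).card ≤
      primesNeeded δ * (δ * (2 * δ * (n * (δ + 1))) * (δ * Fintype.card F ^ d)) := by
    rw [← hQcard]
    refine Finset.card_biUnion_le_card_mul _ _ _ fun P hP => ?_
    obtain ⟨hPm, hPi, hPd⟩ := hPsP P (hQs hP)
    exact card_box_smooth_zeros_le hι hn hδ hd hdn hf hirr hfδ hfc hf₀ hPm hPi hPd _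
      (fun z hz => hSn z (Finset.mem_filter.1 hz).1) (fun z hz => hSf z (Finset.mem_filter.1 hz).1)
      (fun z hz => (Finset.mem_filter.1 hz).2)
  rw [htot]
  omega

end PlaneCurve

end Polynomial

namespace Polynomial

section InnerDerivative

variable {A B : Type*} [CommRing A] [CommRing B]

theorem swap_map_mapRingHom (ψ : A →+* B) (h : A[X][X]) :
    Bivariate.swap (h.map (mapRingHom ψ)) = (Bivariate.swap h).map (mapRingHom ψ) := by
  induction h using Polynomial.induction_on' with
  | add p q hp hq => simp only [Polynomial.map_add, map_add, hp, hq]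
  | monomial j p =>
    induction p using Polynomial.induction_on' with
    | add p q hp hq => simp only [Polynomial.map_add, map_add, hp, hq]
    | monomial i c => simp only [map_monomial, coe_mapRingHom, Bivariate.swap_monomial_monomial]

theorem coeff_coeff_swap (h : A[X][X]) (i j : ℕ) :
    ((Bivariate.swap h).coeff i).coeff j = (h.coeff j).coeff i := by
  induction h using Polynomial.induction_on' with
  | add p q hp hq => simp only [map_add, coeff_add, hp, hq]
  | monomial j' p =>
    induction p using Polynomial.induction_on' with
    | add p q hp hq => simp only [map_add, coeff_add, hp, hq]
    | monomial i' c =>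
      rw [Bivariate.swap_monomial_monomial]
      simp only [coeff_monomial]
      split_ifs <;> simp_all [coeff_monomial]

theorem natDegree_swap_le_iff {h : A[X][X]} {e : ℕ} :
    (Bivariate.swap h).natDegree ≤ e ↔ ∀ j, (h.coeff j).natDegree ≤ e := by
  simp only [natDegree_le_iff_coeff_eq_zero]
  constructor
  · intro H j N hN
    rw [← coeff_coeff_swap, H N hN, coeff_zero]
  · intro H N hN
    ext j
    rw [coeff_coeff_swap, H j N hN, coeff_zero]

theorem natDegree_coeff_le_of_mul [IsDomain A] {g h : A[X][X]} (hg : g ≠ 0) (hh : h ≠ 0) {e : ℕ}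
    (he : ∀ j, ((g * h).coeff j).natDegree ≤ e) (j : ℕ) : (g.coeff j).natDegree ≤ e := by
  have h1 := natDegree_swap_le_iff.2 he
  rw [map_mul, natDegree_mul (by simpa using hg) (by simpa using hh)] at h1
  exact natDegree_swap_le_iff.1 (by omega) j

/-- The derivative of a bivariate polynomial with respect to the inner variable. -/
noncomputable def innerDerivative (h : A[X][X]) : A[X][X] :=
  Bivariate.swap (derivative (Bivariate.swap h))

theorem innerDerivative_add (g h : A[X][X]) :
    innerDerivative (g + h) = innerDerivative g + innerDerivative h := by
  simp [innerDerivative]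

theorem innerDerivative_mul (g h : A[X][X]) :
    innerDerivative (g * h) = innerDerivative g * h + g * innerDerivative h := by
  simp only [innerDerivative, map_mul, derivative_mul, map_add, Bivariate.swap_swap_apply]

theorem innerDerivative_C (p : A[X]) : innerDerivative (C p) = C p.derivative := by
  rw [innerDerivative, Bivariate.swap_C, derivative_map, Bivariate.swap_map_C]

theorem innerDerivative_map (ψ : A →+* B) (h : A[X][X]) :
    innerDerivative (h.map (mapRingHom ψ)) = (innerDerivative h).map (mapRingHom ψ) := by
  rw [innerDerivative, swap_map_mapRingHom, derivative_map, swap_map_mapRingHom, innerDerivative]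

/-- The Hamiltonian derivation of `f`, which is tangent to the level curves of `f`. -/
noncomputable def hamiltonian (f h : A[X][X]) : A[X][X] :=
  derivative f * innerDerivative h - innerDerivative f * derivative h

theorem hamiltonian_add (f g h : A[X][X]) :
    hamiltonian f (g + h) = hamiltonian f g + hamiltonian f h := by
  simp only [hamiltonian, innerDerivative_add, derivative_add]; ring

theorem hamiltonian_mul (f g h : A[X][X]) :
    hamiltonian f (g * h) = hamiltonian f g * h + g * hamiltonian f h := by
  simp only [hamiltonian, innerDerivative_mul, derivative_mul]; ring

theorem hamiltonian_self (f : A[X][X]) : hamiltonian f f = 0 := by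
  rw [hamiltonian]; ring

theorem hamiltonian_CC (f : A[X][X]) (a : A) : hamiltonian f (C (C a)) = 0 := by
  simp [hamiltonian, innerDerivative_C]

theorem hamiltonian_map (ψ : A →+* B) (f h : A[X][X]) :
    hamiltonian (f.map (mapRingHom ψ)) (h.map (mapRingHom ψ)) =
      (hamiltonian f h).map (mapRingHom ψ) := by
  simp only [hamiltonian, innerDerivative_map, derivative_map, Polynomial.map_sub,
    Polynomial.map_mul]

theorem hamiltonian_iterate_map (ψ : A →+* B) (f h : A[X][X]) (l : ℕ) :
    (hamiltonian (f.map (mapRingHom ψ)))^[l] (h.map (mapRingHom ψ)) =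
      ((hamiltonian f)^[l] h).map (mapRingHom ψ) := by
  induction l with
  | zero => rfl
  | succ l ih => rw [Function.iterate_succ_apply', ih, hamiltonian_map, Function.iterate_succ_apply']

theorem hamiltonian_sum {σ : Type*} (s : Finset σ) (f : A[X][X]) (c : σ → A)
    (v : σ → A[X][X]) :
    hamiltonian f (∑ i ∈ s, C (C (c i)) * v i) = ∑ i ∈ s, C (C (c i)) * hamiltonian f (v i) := by
  classical
  induction s using Finset.induction_on with
  | empty => simpa using hamiltonian_CC f 0
  | insert i s hi ih =>
    rw [Finset.sum_insert hi, Finset.sum_insert hi, hamiltonian_add, ih, hamiltonian_mul,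
      hamiltonian_CC, zero_mul, zero_add]

theorem hamiltonian_iterate_sum {σ : Type*} (s : Finset σ) (f : A[X][X]) (c : σ → A)
    (v : σ → A[X][X]) (l : ℕ) :
    (hamiltonian f)^[l] (∑ i ∈ s, C (C (c i)) * v i) =
      ∑ i ∈ s, C (C (c i)) * (hamiltonian f)^[l] (v i) := by
  induction l with
  | zero => rfl
  | succ l ih => simp only [Function.iterate_succ_apply', ih, hamiltonian_sum]

/-- The first `l` derivatives of `h` along the curve `f = 0` vanish at `(0, α)`. -/
def VanishesAlong (f : A[X][X]) (α : A) (l : ℕ) (h : A[X][X]) : Prop :=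
  ∀ i < l, ((hamiltonian f)^[i] h).evalEval 0 α = 0

theorem vanishesAlong_zero (f : A[X][X]) (α : A) (h : A[X][X]) : VanishesAlong f α 0 h :=
  fun _ hi => absurd hi (Nat.not_lt_zero _)

theorem vanishesAlong_succ {f h : A[X][X]} {α : A} {l : ℕ} : VanishesAlong f α (l + 1) h ↔
    h.evalEval 0 α = 0 ∧ VanishesAlong f α l (hamiltonian f h) := by
  constructor
  · exact fun H => ⟨H 0 (by omega), fun i hi => H (i + 1) (by omega)⟩
  · rintro ⟨h0, h1⟩ (_ | i) hi
    · exact h0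
    · exact h1 i (by omega)

theorem VanishesAlong.mono {f h : A[X][X]} {α : A} {l l' : ℕ} (H : VanishesAlong f α l h)
    (hl : l' ≤ l) : VanishesAlong f α l' h := fun i hi => H i (by omega)

theorem VanishesAlong.add {f : A[X][X]} {α : A} {l : ℕ} : ∀ {g h : A[X][X]},
    VanishesAlong f α l g → VanishesAlong f α l h → VanishesAlong f α l (g + h) := by
  induction l with
  | zero => exact fun _ _ => vanishesAlong_zero _ _ _
  | succ l ih =>
    intro g h hg hh
    rw [vanishesAlong_succ] at hg hh ⊢
    refine ⟨by rw [evalEval_add, hg.1, hh.1, add_zero], ?_⟩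
    rw [hamiltonian_add]
    exact ih hg.2 hh.2

theorem VanishesAlong.mul_right {f : A[X][X]} {α : A} {l : ℕ} : ∀ {g : A[X][X]} (h : A[X][X]),
    VanishesAlong f α l g → VanishesAlong f α l (g * h) := by
  induction l with
  | zero => exact fun _ _ => vanishesAlong_zero _ _ _
  | succ l ih =>
    intro g h hg
    have hg' := vanishesAlong_succ.1 hg
    rw [vanishesAlong_succ]
    refine ⟨by rw [evalEval_mul, hg'.1, zero_mul], ?_⟩
    rw [hamiltonian_mul]
    exact (ih _ hg'.2).add (ih _ (hg.mono (by omega)))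

theorem vanishesAlong_self {f : A[X][X]} {α : A} (h0 : f.evalEval 0 α = 0) (l : ℕ) :
    VanishesAlong f α l f := by
  cases l with
  | zero => exact vanishesAlong_zero _ _ _
  | succ l =>
    refine vanishesAlong_succ.2 ⟨h0, fun i _ => ?_⟩
    rw [hamiltonian_self]
    have := hamiltonian_iterate_sum (∅ : Finset ℕ) f 0 0 i
    simp only [Finset.sum_empty] at this
    simp [this]

/-- A factor of `f` vanishes along the curve `f = 0` at each of its zeros. -/
theorem vanishesAlong_factor {g h : A[X][X]} {α : A} (h0 : g.evalEval 0 α = 0) (l : ℕ) :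
    VanishesAlong (g * h) α l g := by
  induction l with
  | zero => exact vanishesAlong_zero _ _ _
  | succ l ih =>
    refine vanishesAlong_succ.2 ⟨h0, ?_⟩
    have : hamiltonian (g * h) g =
        g * (derivative h * innerDerivative g - innerDerivative h * derivative g) := by
      simp only [hamiltonian, innerDerivative_mul, derivative_mul]; ring
    rw [this]
    exact ih.mul_right _

/-- If `f = 0` is not vertical at `(0, α)`, the inner variable is a local parameter there. -/
theorem not_vanishesAlong_pow_mul [IsDomain A] {f : A[X][X]} {α : A}
    (h1 : f.derivative.evalEval 0 α ≠ 0) (e : ℕ) : ∀ (w : A[X][X]), w.evalEval 0 α ≠ 0 →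
    (∀ i, 0 < i → i ≤ e → (i : A) ≠ 0) → ¬ VanishesAlong f α (e + 1) (C X ^ e * w) := by
  induction e with
  | zero =>
    intro w hw _ H
    rw [vanishesAlong_succ] at H
    exact hw (by simpa using H.1)
  | succ e ih =>
    intro w hw hchar H
    rw [vanishesAlong_succ] at H
    have hD : hamiltonian f (C X ^ (e + 1) * w) =
        C X ^ e * (C (C ((e + 1 : ℕ) : A)) * derivative f * w + C X * hamiltonian f w) := by
      have : hamiltonian f (C X ^ (e + 1)) = C X ^ e * (C (C ((e + 1 : ℕ) : A)) * derivative f) := by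
        rw [← C_pow, hamiltonian, innerDerivative_C, derivative_C, derivative_X_pow]
        simp only [C_mul, C_pow, add_tsub_cancel_right]
        ring
      rw [hamiltonian_mul, this]
      ring
    rw [hD] at H
    refine ih _ ?_ (fun i hi hie => hchar i hi (by omega)) H.2
    rw [evalEval_add, evalEval_mul, evalEval_mul, evalEval_mul, evalEval_C, eval_C, evalEval_C,
      eval_X, zero_mul, add_zero]
    exact mul_ne_zero (mul_ne_zero (hchar _ (by omega) le_rfl) h1) hw

end InnerDerivative

section Criterion

/-- The number of derivatives along a curve of degree `δ` needed to detect its components. -/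
def derivativesNeeded (δ : ℕ) : ℕ := 2 * δ * δ + 1

variable {L : Type*} [Field L] {δ : ℕ} {f : L[X][X]} {α : L}

/-- The entries of the matrix whose minors detect reducibility. -/
noncomputable def jetEntry {A : Type*} [CommRing A] {a b : ℕ} (f : A[X][X]) (α : A) (l : ℕ)
    (s : Fin a × Fin b) : A :=
  ((hamiltonian f)^[l] (C X ^ (s.1 : ℕ) * X ^ (s.2 : ℕ))).evalEval 0 α

theorem ofCoeffs_eq_sum {A : Type*} [CommRing A] {a b : ℕ} (c : Fin a × Fin b → A) :
    ofCoeffs c = ∑ s, C (C (c s)) * (C X ^ (s.1 : ℕ) * X ^ (s.2 : ℕ)) := by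
  refine Finset.sum_congr rfl fun s _ => ?_
  rw [← C_mul_X_pow_eq_monomial, ← C_mul_X_pow_eq_monomial, C_mul, C_pow, mul_assoc]

theorem evalEval_hamiltonian_ofCoeffs {A : Type*} [CommRing A] {a b : ℕ} (f : A[X][X]) (α : A)
    (l : ℕ) (c : Fin a × Fin b → A) :
    ((hamiltonian f)^[l] (ofCoeffs c)).evalEval 0 α = ∑ s, c s * jetEntry f α l s := by
  rw [ofCoeffs_eq_sum, hamiltonian_iterate_sum, evalEval_finsetSum]
  refine Finset.sum_congr rfl fun s _ => ?_
  rw [evalEval_mul, evalEval_C, eval_C, jetEntry]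

theorem det_jetEntry_eq_zero (hf : f.Monic) (hfδ : f.natDegree = δ) (hδ : 0 < δ)
    (hfc : ∀ j, (f.coeff j).natDegree ≤ δ) (h0 : f.evalEval 0 α = 0) (hred : ¬ Irreducible f)
    (r : Fin (δ + 1) × Fin δ → ℕ) :
    (Matrix.of fun l s : Fin (δ + 1) × Fin δ => jetEntry f α (r l) s).det = 0 := by
  classical
  obtain ⟨g, h, hg, hgh, hg0, hgδ⟩ : ∃ g h : L[X][X], g ≠ 0 ∧ f = g * h ∧
      g.evalEval 0 α = 0 ∧ g.natDegree < δ := by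
    have hf1 : f ≠ 1 := by
      rintro rfl
      simp at hfδ
      omega
    rw [hf.irreducible_iff_natDegree] at hred
    push Not at hred
    obtain ⟨g, h, hg, hh, hgh, h1, h2⟩ := hred hf1
    have hdeg := hg.natDegree_mul hh
    rw [hgh, hfδ] at hdeg
    rw [← hgh, evalEval_mul, mul_eq_zero] at h0
    rcases h0 with h0 | h0
    · exact ⟨g, h, hg.ne_zero, hgh.symm, h0, by omega⟩
    · exact ⟨h, g, hh.ne_zero, by rw [mul_comm, hgh], h0, by omega⟩
  have hh : h ≠ 0 := by
    rintro rfl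
    exact hf.ne_zero (by simpa using hgh)
  have hgc := natDegree_coeff_le_of_mul hg hh (hgh ▸ hfc)
  have hgo := eq_ofCoeffs (f := g) (a := δ) (b := δ)
    (fun j hj => coeff_eq_zero_of_natDegree_lt (by omega)) hgc
  set c := fun s : Fin (δ + 1) × Fin δ => (g.coeff s.2).coeff s.1 with hc
  refine Matrix.exists_mulVec_eq_zero_iff.1 ⟨c, ?_, ?_⟩
  · intro hc0
    exact hg (by rw [hgo, hc0]; simp [ofCoeffs])
  · ext l
    have h1 := vanishesAlong_factor (h := h) hg0 (r l + 1) (r l) (by omega)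
    rw [← hgh, hgo, evalEval_hamiltonian_ofCoeffs] at h1
    simpa [Matrix.mulVec, dotProduct, mul_comm] using h1

theorem exists_det_jetEntry_ne_zero (hf : f.Monic) (hfδ : f.natDegree = δ) (hδ : 0 < δ)
    (hfc : ∀ j, (f.coeff j).natDegree ≤ δ) (h0 : f.evalEval 0 α = 0)
    (h1 : f.derivative.evalEval 0 α ≠ 0) (hirr : Irreducible f)
    (hchar : ∀ i, 0 < i → i < derivativesNeeded δ → (i : L) ≠ 0) :
    ∃ r : Fin (δ + 1) × Fin δ → Fin (derivativesNeeded δ),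
      (Matrix.of fun l s : Fin (δ + 1) × Fin δ => jetEntry f α (r l) s).det ≠ 0 := by
  rcases exists_hyperplane_or_det_ne_zero (I := Fin (derivativesNeeded δ))
    (fun l (s : Fin (δ + 1) × Fin δ) => jetEntry f α l s) with ⟨c, hc, hcl⟩ | h
  swap
  · exact h
  exfalso
  have hg0 := ofCoeffs_ne_zero hc
  have hgδ := natDegree_ofCoeffs_lt hδ c
  have hgv : VanishesAlong f α (derivativesNeeded δ) (ofCoeffs c) := fun l hl => by
    rw [evalEval_hamiltonian_ofCoeffs]
    exact hcl ⟨l, hl⟩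
  obtain ⟨R, hR, hRd, a, b, hab⟩ := exists_elimination (IsDegreeLike.natDegree L) hf hirr
    (hf.not_dvd_of_natDegree_lt hg0 (by omega)) δ hfc (natDegree_coeff_ofCoeffs_le c)
  have hRv : VanishesAlong f α (derivativesNeeded δ) (C R) := by
    rw [← hab]
    exact ((vanishesAlong_self h0 _).mul_right _).add (hgv.mul_right _)
  obtain ⟨e, R₁, hR₁, hRe⟩ : ∃ (e : ℕ) (R₁ : L[X]), R₁.eval 0 ≠ 0 ∧ R = X ^ e * R₁ := by
    obtain ⟨w, hw, hw'⟩ := exists_eq_pow_rootMultiplicity_mul_and_not_dvd R hR 0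
    refine ⟨_, w, ?_, by simpa using hw⟩
    rwa [Ne, ← IsRoot.def, ← dvd_iff_isRoot]
  have he : e < derivativesNeeded δ := by
    have : e ≤ R.natDegree := by
      have hR₁0 : R₁ ≠ 0 := by rintro rfl; simp at hR₁
      rw [hRe, natDegree_mul (by simp) hR₁0, natDegree_X_pow]
      omega
    have h2 : (f.natDegree + (ofCoeffs c).natDegree) * δ ≤ 2 * δ * δ := by
      gcongr
      omega
    rw [derivativesNeeded]
    omega
  refine not_vanishesAlong_pow_mul h1 e (C R₁) (by rwa [evalEval_C])
    (fun i hi hie => hchar i hi (by omega)) ?_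
  rw [← C_pow, ← C_mul, ← hRe]
  exact hRv.mono (by omega)

end Criterion

end Polynomial

namespace IsDegreeLike

variable {A : Type*} [CommRing A] {dg : A → ℕ}

theorem eval₂_le (h : IsDegreeLike dg) {R σ : Type*} [CommRing R] (φ : R →+* A)
    (hφ : ∀ c, dg (φ c) = 0) (g : σ → A) (e : ℕ) (hg : ∀ i, dg (g i) ≤ e)
    (p : MvPolynomial σ R) : dg (p.eval₂ φ g) ≤ p.totalDegree * e := by
  classical
  rw [MvPolynomial.eval₂_eq]
  refine h.sum_le _ _ _ fun m hm => ?_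
  have hprod : ∀ s : Finset σ, dg (∏ i ∈ s, g i ^ m i) ≤ (∑ i ∈ s, m i) * e := by
    intro s
    induction s using Finset.induction_on with
    | empty => simp [h.one]
    | insert i s hi ih =>
      rw [Finset.prod_insert hi, Finset.sum_insert hi, add_mul]
      refine (h.mul _ _).trans (add_le_add ((h.pow_le _ _).trans ?_) ih)
      gcongr
      exact hg i
  refine (h.mul _ _).trans ?_
  rw [hφ, zero_add]
  refine (hprod _).trans ?_
  gcongr
  exact MvPolynomial.le_totalDegree hm

/-- The largest degree of a coefficient. -/
theorem coeffSup (h : IsDegreeLike dg) :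
    IsDegreeLike (fun w : Polynomial A => w.support.sup fun i => dg (w.coeff i)) := by
  have hle : ∀ (w : Polynomial A) (e : ℕ), (w.support.sup fun i => dg (w.coeff i)) ≤ e ↔
      ∀ i, dg (w.coeff i) ≤ e := by
    intro w e
    rw [Finset.sup_le_iff]
    refine ⟨fun H i => ?_, fun H i _ => H i⟩
    by_cases hi : i ∈ w.support
    · exact H i hi
    · rw [Polynomial.notMem_support_iff.1 hi, h.zero]
      exact Nat.zero_le _
  have hself : ∀ (w : Polynomial A) (i : ℕ),
      dg (w.coeff i) ≤ w.support.sup fun i => dg (w.coeff i) :=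
    fun w => (hle w _).1 le_rfl
  refine ⟨?_, by simp, ?_, ?_, ?_⟩
  · refine Nat.le_zero.1 ((hle _ _).2 fun i => ?_)
    rw [Polynomial.coeff_one]
    split_ifs
    · rw [h.one]
    · rw [h.zero]
  · intro w
    simp [h.neg]
  · intro v w
    refine (hle _ _).2 fun i => ?_
    rw [Polynomial.coeff_add]
    exact (h.add _ _).trans (max_le_max (hself v i) (hself w i))
  · intro v w
    refine (hle _ _).2 fun i => ?_
    rw [Polynomial.coeff_mul]
    exact h.sum_le _ _ _ fun s _ => (h.mul _ _).trans (add_le_add (hself v _) (hself w _))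

theorem le_coeffSup (h : IsDegreeLike dg) (w : Polynomial A) (i : ℕ) :
    dg (w.coeff i) ≤ w.support.sup fun i => dg (w.coeff i) := by
  by_cases hi : i ∈ w.support
  · exact Finset.le_sup (f := fun i => dg (w.coeff i)) hi
  · rw [Polynomial.notMem_support_iff.1 hi, h.zero]
    exact Nat.zero_le _

end IsDegreeLike

namespace Polynomial

section Minors

theorem jetEntry_map {A B : Type*} [CommRing A] [CommRing B] (ψ : A →+* B) {a b : ℕ}
    (f : A[X][X]) (α : A) (l : ℕ) (s : Fin a × Fin b) :
    jetEntry (f.map (mapRingHom ψ)) (ψ α) l s = ψ (jetEntry f α l s) := by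
  rw [jetEntry, jetEntry, ← map_mapRingHom_evalEval, ← hamiltonian_iterate_map, map_zero]
  simp

/-- A maximal minor of the matrix of derivatives of monomials along a curve. -/
noncomputable def jetMinor {A : Type*} [CommRing A] {δ : ℕ} (f : A[X][X]) (α : A)
    (r : Fin (δ + 1) × Fin δ → Fin (derivativesNeeded δ)) : A :=
  (Matrix.of fun l s : Fin (δ + 1) × Fin δ => jetEntry f α (r l) s).det

theorem jetMinor_map {A B : Type*} [CommRing A] [CommRing B] (ψ : A →+* B) {δ : ℕ}
    (f : A[X][X]) (α : A) (r : Fin (δ + 1) × Fin δ → Fin (derivativesNeeded δ)) :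
    jetMinor (f.map (mapRingHom ψ)) (ψ α) r = ψ (jetMinor f α r) := by
  rw [jetMinor, jetMinor, RingHom.map_det]
  congr 1
  ext l s
  simp [jetEntry_map]

/-- The universal minor, in the coefficients of the curve and the coordinate of the point. -/
noncomputable def universalMinor (δ : ℕ) (r : Fin (δ + 1) × Fin δ → Fin (derivativesNeeded δ)) :
    MvPolynomial (Option (Fin (δ + 1) × Fin δ)) ℤ :=
  jetMinor (X ^ δ + ofCoeffs fun s => MvPolynomial.X (some s)) (MvPolynomial.X none) r

/-- A bound for the degrees of the universal minors. -/
noncomputable def minorDegree (δ : ℕ) : ℕ :=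
  Finset.univ.sup fun r => (universalMinor δ r).totalDegree

theorem jetMinor_eq_eval₂ {A : Type*} [CommRing A] {δ : ℕ} {f : A[X][X]} (hf : f.Monic)
    (hfδ : f.natDegree = δ) (hfc : ∀ j, (f.coeff j).natDegree ≤ δ) (α : A)
    (r : Fin (δ + 1) × Fin δ → Fin (derivativesNeeded δ)) :
    jetMinor f α r = (universalMinor δ r).eval₂ (Int.castRingHom A)
      (fun o => o.elim α fun s => (f.coeff s.2).coeff s.1) := by
  set ψ := MvPolynomial.eval₂Hom (Int.castRingHom A)
      (fun o : Option (Fin (δ + 1) × Fin δ) => o.elim α fun s => (f.coeff s.2).coeff s.1) with hψ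
  have hfa : f = (X ^ δ + ofCoeffs fun s => MvPolynomial.X (some s)).map (mapRingHom ψ) := by
    rw [Polynomial.map_add, map_ofCoeffs, Polynomial.map_pow, map_X]
    have := hf.eq_X_pow_add_ofCoeffs hfc
    subst hfδ
    convert this using 3
    ext s
    simp [hψ]
  have hα : α = ψ (MvPolynomial.X none) := by simp [hψ]
  change _ = ψ (universalMinor δ r)
  rw [universalMinor, ← jetMinor_map, ← hfa, ← hα]

theorem dg_jetMinor_le {A : Type*} [CommRing A] {dg : A → ℕ} (h : IsDegreeLike dg)
    (hint : ∀ z : ℤ, dg (z : A) = 0) {δ : ℕ} {f : A[X][X]} (hf : f.Monic)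
    (hfδ : f.natDegree = δ) (hfc : ∀ j, (f.coeff j).natDegree ≤ δ) (α : A)
    (r : Fin (δ + 1) × Fin δ → Fin (derivativesNeeded δ)) (e : ℕ) (hα : dg α ≤ e)
    (hfe : ∀ i j, dg ((f.coeff j).coeff i) ≤ e) : dg (jetMinor f α r) ≤ minorDegree δ * e := by
  rw [jetMinor_eq_eval₂ hf hfδ hfc]
  refine (h.eval₂_le _ (by simpa using hint) _ e ?_ _).trans ?_
  · rintro (_ | s)
    · exact hα
    · exact hfe _ _
  · gcongr
    exact Finset.le_sup (f := fun r => (universalMinor δ r).totalDegree) (Finset.mem_univ r)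

end Minors

section Slice

variable {K σ : Type*} [Field K] {B B' : Type*} [CommRing B] [Algebra K B] [CommRing B']
  [Algebra K B']

/-- The restriction of a hypersurface `f(X, Y) = 0` to the plane `Y = y + a T`. -/
noncomputable def slice (f : (MvPolynomial σ K)[X]) (y a : σ → B) : B[X][X] :=
  f.map (MvPolynomial.aeval fun i => C (y i) + C (a i) * X : MvPolynomial σ K →ₐ[K] B[X]).toRingHom

theorem slice_map (ψ : B →ₐ[K] B') (f : (MvPolynomial σ K)[X]) (y a : σ → B) :
    (slice f y a).map (mapRingHom ψ.toRingHom) = slice f (ψ ∘ y) (ψ ∘ a) := by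
  rw [slice, slice, map_map]
  congr 1
  have : (mapAlgHom ψ).comp (MvPolynomial.aeval fun i => C (y i) + C (a i) * X) =
      MvPolynomial.aeval fun i => C ((ψ ∘ y) i) + C ((ψ ∘ a) i) * X := by
    ext i : 1
    simp
  exact congrArg AlgHom.toRingHom this

theorem slice_translate (f : (MvPolynomial σ K)[X]) (y a : σ → B) (τ : B) :
    slice f (fun i => y i + τ * a i) a = (slice f y a).map (compRingHom (X + C τ)) := by
  rw [slice, slice, map_map]
  congr 1
  have hcomp : (compRingHom (X + C τ) : B[X] →+* B[X]) =
      (aeval (X + C τ) : B[X] →ₐ[B] B[X]).toRingHom := by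
    ext <;> simp
  have : ((aeval (X + C τ) : B[X] →ₐ[B] B[X]).restrictScalars K).comp
      (MvPolynomial.aeval fun i => C (y i) + C (a i) * X) =
      MvPolynomial.aeval fun i => C (y i + τ * a i) + C (a i) * X := by
    ext i : 1
    simp
    ring
  rw [hcomp]
  exact (congrArg AlgHom.toRingHom this).symm

theorem map_evalRingHom_slice (f : (MvPolynomial σ K)[X]) (y a : σ → B) (τ : B) :
    (slice f y a).map (evalRingHom τ) =
      f.map (MvPolynomial.aeval fun i => y i + τ * a i : MvPolynomial σ K →ₐ[K] B).toRingHom := by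
  rw [slice, map_map]
  congr 1
  have hcomp : (evalRingHom τ : B[X] →+* B) = (aeval τ : B[X] →ₐ[B] B).toRingHom := by
    ext <;> simp
  have : ((aeval τ : B[X] →ₐ[B] B).restrictScalars K).comp
      (MvPolynomial.aeval fun i => C (y i) + C (a i) * X) =
      MvPolynomial.aeval fun i => y i + τ * a i := by
    ext i : 1
    simp
    ring
  rw [hcomp]
  exact congrArg AlgHom.toRingHom this

theorem evalEval_slice (f : (MvPolynomial σ K)[X]) (y a : σ → K) (τ x : K) :
    (slice f y a).evalEval τ x = (f.map (MvPolynomial.eval fun i => y i + τ * a i)).eval x := by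
  rw [← map_evalRingHom_eval, map_evalRingHom_slice]
  rfl

theorem derivative_slice (f : (MvPolynomial σ K)[X]) (y a : σ → B) :
    derivative (slice f y a) = slice (derivative f) y a := derivative_map _ _

theorem Monic.slice {f : (MvPolynomial σ K)[X]} (hf : f.Monic) (y a : σ → B) :
    (slice f y a).Monic := hf.map _

theorem Monic.natDegree_slice [Nontrivial B] {f : (MvPolynomial σ K)[X]} (hf : f.Monic)
    (y a : σ → B) : (Polynomial.slice f y a).natDegree = f.natDegree := hf.natDegree_map _

theorem natDegree_coeff_slice_le {f : (MvPolynomial σ K)[X]} {e : ℕ}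
    (hfc : ∀ j, (f.coeff j).totalDegree ≤ e) (y a : σ → B) (j : ℕ) :
    ((slice f y a).coeff j).natDegree ≤ e := by
  rw [slice, coeff_map]
  refine ((IsDegreeLike.natDegree B).eval₂_le (algebraMap K B[X]) (fun c => ?_)
    (fun i => C (y i) + C (a i) * X) 1 (fun i => ?_) (f.coeff j)).trans (by simpa using hfc j)
  · rw [algebraMap_apply]; simp
  · refine (natDegree_add_le _ _).trans (max_le (by simp) (by simpa using natDegree_C_mul_X_pow_le (a i) 1))

theorem dg_coeff_coeff_slice_le {dg : B → ℕ} (h : IsDegreeLike dg)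
    (hK : ∀ c : K, dg (algebraMap K B c) = 0) {f : (MvPolynomial σ K)[X]} {e : ℕ}
    (hfc : ∀ j, (f.coeff j).totalDegree ≤ e) {y a : σ → B} (hy : ∀ i, dg (y i) ≤ 1)
    (ha : ∀ i, dg (a i) ≤ 1) (i j : ℕ) : dg (((slice f y a).coeff j).coeff i) ≤ e := by
  refine (h.le_coeffSup _ i).trans ?_
  rw [slice, coeff_map]
  refine (h.coeffSup.eval₂_le (algebraMap K B[X]) (fun c => ?_)
    (fun i => C (y i) + C (a i) * X) 1 (fun i => ?_) (f.coeff j)).trans (by simpa using hfc j)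
  · refine Nat.le_zero.1 (Finset.sup_le fun i _ => ?_)
    rw [algebraMap_apply, coeff_C]
    split_ifs
    · rw [hK]
    · rw [h.zero]
  · refine Finset.sup_le fun k _ => ?_
    rw [coeff_add]
    refine (h.add _ _).trans (max_le ?_ ?_)
    · rw [coeff_C]
      split_ifs
      · exact hy i
      · simp [h.zero]
    · rw [coeff_C_mul_X]
      split_ifs
      · exact ha i
      · simp [h.zero]

end Slice

end Polynomial

namespace Polynomial

section Bertini

theorem irreducible_map_translation {K σ : Type*} [Field K] {f : (MvPolynomial σ K)[X]}
    (hirr : Irreducible f) (y : σ → K) :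
    Irreducible (f.map (MvPolynomial.aeval fun i => MvPolynomial.C (y i) + MvPolynomial.X i :
      MvPolynomial σ K →ₐ[K] MvPolynomial σ K).toRingHom) := by
  let e : MvPolynomial σ K ≃ₐ[K] MvPolynomial σ K := AlgEquiv.ofAlgHom
    (MvPolynomial.aeval fun i => MvPolynomial.C (y i) + MvPolynomial.X i)
    (MvPolynomial.aeval fun i => MvPolynomial.X i - MvPolynomial.C (y i))
    (by ext i : 1; simp [← MvPolynomial.algebraMap_eq])
    (by ext i : 1; simp [← MvPolynomial.algebraMap_eq])
  have := (MulEquiv.irreducible_iff (mapEquiv e.toRingEquiv) (x := f)).2 hirr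
  exact this

theorem irreducible_generic_slice {K σ : Type*} [Field K] {f : (MvPolynomial σ K)[X]}
    (hf : f.Monic) (hirr : Irreducible f) (y : σ → K) :
    Irreducible (slice f
      (fun i => algebraMap (MvPolynomial σ K) (FractionRing (MvPolynomial σ K))
        (MvPolynomial.C (y i)))
      (fun i => algebraMap (MvPolynomial σ K) (FractionRing (MvPolynomial σ K))
        (MvPolynomial.X i))) := by
  refine Monic.irreducible_of_irreducible_map (evalRingHom 1) _ (hf.slice _ _) ?_
  rw [map_evalRingHom_slice]
  have h1 := irreducible_map_translation hirr y
  have h2 := ((hf.map _).irreducible_iff_irreducible_map_fraction_map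
    (K := FractionRing (MvPolynomial σ K))).1 h1
  rw [map_map] at h2
  have : (MvPolynomial.aeval fun i => algebraMap (MvPolynomial σ K)
        (FractionRing (MvPolynomial σ K)) (MvPolynomial.C (y i)) + 1 *
        algebraMap (MvPolynomial σ K) (FractionRing (MvPolynomial σ K)) (MvPolynomial.X i)) =
      (IsScalarTower.toAlgHom K (MvPolynomial σ K) (FractionRing (MvPolynomial σ K))).comp
      (MvPolynomial.aeval fun i => MvPolynomial.C (y i) + MvPolynomial.X i) := by
    ext i : 1
    simp
  rw [this]
  exact h2

theorem totalDegree_intCast {K σ : Type*} [CommRing K] (z : ℤ) :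
    (z : MvPolynomial σ K).totalDegree = 0 := by
  rw [← map_intCast (MvPolynomial.C : K →+* MvPolynomial σ K), MvPolynomial.totalDegree_C]

theorem exists_direction {K : Type*} [Field K] {r' δ : ℕ}
    {f : (MvPolynomial (Fin (r' + 1)) K)[X]} (hf : f.Monic) (hirr : Irreducible f)
    (hfδ : f.natDegree = δ) (hδ : 0 < δ) (hfc : ∀ j, (f.coeff j).totalDegree ≤ δ)
    (hchar : ∀ i, 0 < i → i < derivativesNeeded δ → (i : K) ≠ 0)
    {x : K} {y : Fin (r' + 1) → K} (h0 : (f.map (MvPolynomial.eval y)).eval x = 0)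
    (h1 : (f.derivative.map (MvPolynomial.eval y)).eval x ≠ 0)
    (S : Finset K) (hS : minorDegree δ * δ + 1 < S.card) :
    ∃ a : Fin (r' + 1) → K, (∀ i, a i ∈ S) ∧ a 0 ≠ 0 ∧
      ∃ r : Fin (δ + 1) × Fin δ → Fin (derivativesNeeded δ), jetMinor (slice f y a) x r ≠ 0 := by
  classical
  let A := MvPolynomial (Fin (r' + 1)) K
  let L := FractionRing A
  let φ : A →ₐ[K] L := IsScalarTower.toAlgHom K A L
  let w : A[X][X] := slice f (fun i => MvPolynomial.C (y i)) MvPolynomial.X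
  have hwL : w.map (mapRingHom φ.toRingHom) =
      slice f (fun i => φ (MvPolynomial.C (y i))) (fun i => φ (MvPolynomial.X i)) :=
    slice_map φ f _ _
  have heval : ∀ g : A[X], (slice g (fun i => φ (MvPolynomial.C (y i)))
      (fun i => φ (MvPolynomial.X i))).evalEval 0 (φ (MvPolynomial.C x)) =
      algebraMap K L ((g.map (MvPolynomial.eval y)).eval x) := by
    intro g
    have hC : ∀ c : K, φ (MvPolynomial.C c) = algebraMap K L c := fun c => φ.commutes c
    rw [← map_evalRingHom_eval, map_evalRingHom_slice, hC, ← eval_map_apply, map_map]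
    congr 2
    have : (MvPolynomial.aeval fun i => φ (MvPolynomial.C (y i)) + 0 * φ (MvPolynomial.X i)) =
        (Algebra.ofId K L).comp (MvPolynomial.aeval y) := by
      ext i : 1
      simp [hC]
    exact congrArg AlgHom.toRingHom this
  have hLirr : Irreducible (w.map (mapRingHom φ.toRingHom)) := by
    rw [hwL]; exact irreducible_generic_slice hf hirr y
  obtain ⟨r, hr⟩ := exists_det_jetEntry_ne_zero (f := w.map (mapRingHom φ.toRingHom))
    (δ := δ) (α := φ (MvPolynomial.C x))
    (by rw [hwL]; exact hf.slice _ _) (by rw [hwL, hf.natDegree_slice, hfδ]) hδ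
    (fun j => by rw [hwL]; exact natDegree_coeff_slice_le hfc _ _ j)
    (by rw [hwL, heval, h0, map_zero])
    (by rw [hwL, derivative_slice, heval]; simpa using h1) hLirr
    (fun i hi hi' => by
      have := (_root_.map_ne_zero (algebraMap K L)).2 (hchar i hi hi')
      rwa [map_natCast] at this)
  have hminor : jetMinor w (MvPolynomial.C x) r ≠ 0 := by
    intro h
    apply hr
    have := jetMinor_map φ.toRingHom w (MvPolynomial.C x) r
    rw [h, map_zero] at this
    exact this
  have hdeg : (jetMinor w (MvPolynomial.C x) r).totalDegree ≤ minorDegree δ * δ := by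
    refine dg_jetMinor_le (IsDegreeLike.totalDegree _ _) totalDegree_intCast (hf.slice _ _)
      (by rw [hf.natDegree_slice, hfδ]) (natDegree_coeff_slice_le hfc _ _) _ _ _ (by simp) ?_
    refine dg_coeff_coeff_slice_le (IsDegreeLike.totalDegree _ _) (by simp) hfc (by simp) ?_
    simp
  set P := MvPolynomial.X 0 * jetMinor w (MvPolynomial.C x) r with hP
  have hP0 : P ≠ 0 := mul_ne_zero (MvPolynomial.X_ne_zero _) hminor
  have hPdeg : P.totalDegree ≤ minorDegree δ * δ + 1 := by
    refine (MvPolynomial.totalDegree_mul _ _).trans ?_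
    rw [MvPolynomial.totalDegree_X]
    omega
  have hcount := MvPolynomial.card_zeros_le hP0 S
  obtain ⟨a, ha, haP⟩ : ∃ a ∈ Fintype.piFinset fun _ : Fin (r' + 1) => S,
      MvPolynomial.eval a P ≠ 0 := by
    by_contra! H
    rw [Finset.filter_true_of_mem H, Fintype.card_piFinset_const, pow_succ'] at hcount
    have := Nat.le_of_mul_le_mul_right hcount (pow_pos (by omega) _)
    omega
  rw [hP, map_mul, MvPolynomial.eval_X] at haP
  refine ⟨a, fun i => Fintype.mem_piFinset.1 ha i, left_ne_zero_of_mul haP, r, ?_⟩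
  convert right_ne_zero_of_mul haP using 1
  have := jetMinor_map (MvPolynomial.aeval a : A →ₐ[K] K).toRingHom w (MvPolynomial.C x) r
  rw [slice_map] at this
  convert this using 2
  · congr 1
    · ext i; simp
    · ext i; simp
  · simp
  · rfl

theorem exists_irreducible_slices {K : Type*} [Field K] {r' δ : ℕ}
    {f : (MvPolynomial (Fin (r' + 1)) K)[X]} (hf : f.Monic) (hirr : Irreducible f)
    (hfδ : f.natDegree = δ) (hδ : 0 < δ) (hfc : ∀ j, (f.coeff j).totalDegree ≤ δ)
    (hchar : ∀ i, 0 < i → i < derivativesNeeded δ → (i : K) ≠ 0)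
    {x : K} {y : Fin (r' + 1) → K} (h0 : (f.map (MvPolynomial.eval y)).eval x = 0)
    (h1 : (f.derivative.map (MvPolynomial.eval y)).eval x ≠ 0)
    (S : Finset K) (hS : minorDegree δ * δ + 1 < S.card) :
    ∃ a : Fin (r' + 1) → K, (∀ i, a i ∈ S) ∧ a 0 ≠ 0 ∧
      ∃ g : (MvPolynomial (Fin (r' + 1)) K)[X], ¬ f ∣ g ∧ g.natDegree ≤ minorDegree δ * δ ∧
        (∀ i, (g.coeff i).totalDegree ≤ minorDegree δ * δ) ∧
        ∀ x y, (f.map (MvPolynomial.eval y)).eval x = 0 →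
          (g.map (MvPolynomial.eval y)).eval x ≠ 0 → Irreducible (slice f y a) := by
  obtain ⟨a, haS, ha0, r, hr⟩ := exists_direction hf hirr hfδ hδ hfc hchar h0 h1 S hS
  let A := MvPolynomial (Fin (r' + 2)) K
  let w : A[X][X] := slice f (fun i => MvPolynomial.X i.succ) (fun i => MvPolynomial.C (a i))
  have heval : ∀ x y, ((MvPolynomial.finSuccEquiv K _ (jetMinor w (MvPolynomial.X 0) r)).map
      (MvPolynomial.eval y)).eval x = jetMinor (slice f y a) x r := by
    intro x y
    rw [← MvPolynomial.eval_eq_eval_mv_eval']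
    have := jetMinor_map (MvPolynomial.aeval (Fin.cons x y) : A →ₐ[K] K).toRingHom w
      (MvPolynomial.X 0) r
    rw [slice_map] at this
    symm
    convert this using 2
    · congr 1
      · ext i; simp
      · ext i; simp
    · simp
    · rfl
  have hdeg : (jetMinor w (MvPolynomial.X 0) r).totalDegree ≤ minorDegree δ * δ := by
    refine dg_jetMinor_le (IsDegreeLike.totalDegree _ _) totalDegree_intCast (hf.slice _ _)
      (by rw [hf.natDegree_slice, hfδ]) (natDegree_coeff_slice_le hfc _ _) _ _ _ (by simp; omega) ?_
    refine dg_coeff_coeff_slice_le (IsDegreeLike.totalDegree _ _) (by simp) hfc (by simp) ?_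
    simp
  refine ⟨a, haS, ha0, MvPolynomial.finSuccEquiv K _ (jetMinor w (MvPolynomial.X 0) r),
    ?_, ?_, ?_, ?_⟩
  · rintro ⟨h, hh⟩
    apply hr
    rw [← heval, hh, Polynomial.map_mul, eval_mul, h0, zero_mul]
  · rw [MvPolynomial.natDegree_finSuccEquiv]
    exact (MvPolynomial.degreeOf_le_totalDegree _ _).trans hdeg
  · intro i
    by_cases hi : (MvPolynomial.finSuccEquiv K _ (jetMinor w (MvPolynomial.X 0) r)).coeff i = 0
    · rw [hi]; simp
    · have := MvPolynomial.totalDegree_coeff_finSuccEquiv_add_le _ i hi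
      omega
  · intro x y hx hxy
    rw [heval] at hxy
    by_contra hred
    refine hxy (det_jetEntry_eq_zero (hf.slice _ _) (by rw [hf.natDegree_slice, hfδ]) hδ
      (natDegree_coeff_slice_le hfc _ _) ?_ hred _)
    rw [evalEval_slice]
    simpa using hx

end Bertini

end Polynomial

namespace Polynomial

section Slicing

variable {F K : Type*} [Field F] [Field K] {ι : F[X] →+* K}

theorem natDegree_lt_iff_degree_lt_of_pos {p : F[X]} {n : ℕ} (hn : 0 < n) :
    p.natDegree < n ↔ p.degree < n := by
  by_cases hp : p = 0
  · simp [hp, hn]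
  · exact natDegree_lt_iff_degree_lt hp

theorem exists_finset_natDegree_lt [Fintype F] {n : ℕ} (hn : 0 < n) :
    ∃ B : Finset F[X], (∀ p, p ∈ B ↔ p.natDegree < n) ∧ B.card = Fintype.card F ^ n := by
  classical
  refine ⟨Finset.univ.image fun c : Fin n → F => ((degreeLTEquiv F n).symm c : F[X]), ?_, ?_⟩
  · intro p
    rw [natDegree_lt_iff_degree_lt_of_pos hn, ← mem_degreeLT]
    simp only [Finset.mem_image, Finset.mem_univ, true_and]
    constructor
    · rintro ⟨c, rfl⟩
      exact Subtype.coe_prop _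
    · intro hp
      exact ⟨degreeLTEquiv F n ⟨p, hp⟩, by simp⟩
  · refine (Finset.card_image_of_injective _
      (Subtype.val_injective.comp (degreeLTEquiv F n).symm.injective)).trans ?_
    simp

/-- The points in a box on a hypersurface that lie on another hypersurface. -/
theorem card_box_common_zeros_hypersurface_le [Fintype F] {r n δ e : ℕ}
    {f g : (MvPolynomial (Fin (r + 1)) K)[X]} (hι : Function.Injective ι) (hn : 0 < n)
    (hf : f.Monic) (hirr : Irreducible f) (hfδ : f.natDegree = δ)
    (hfc : ∀ j, (f.coeff j).totalDegree ≤ δ) (hfg : ¬ f ∣ g) (hge : g.natDegree ≤ e)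
    (hgc : ∀ j, (g.coeff j).totalDegree ≤ e) (hδe : δ ≤ e)
    (S : Finset (F[X] × (Fin (r + 1) → F[X])))
    (hSn : ∀ z ∈ S, ∀ i, (z.2 i).natDegree < n)
    (hSf : ∀ z ∈ S, (f.map (MvPolynomial.eval fun i => ι (z.2 i))).eval (ι z.1) = 0)
    (hSg : ∀ z ∈ S, (g.map (MvPolynomial.eval fun i => ι (z.2 i))).eval (ι z.1) = 0) :
    S.card ≤ δ * ((δ + e) * e) * (Fintype.card F ^ n) ^ r := by
  classical
  obtain ⟨B, hB, hBcard⟩ := exists_finset_natDegree_lt (F := F) hn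
  let ψ : F[X] × (Fin (r + 1) → F[X]) → K × (Fin (r + 1) → K) :=
    fun z => (ι z.1, fun i => ι (z.2 i))
  have hψ : Function.Injective ψ := by
    rintro ⟨x, y⟩ ⟨x', y'⟩ h
    obtain ⟨h1, h2⟩ := Prod.ext_iff.1 h
    exact Prod.ext (hι h1) (_root_.funext fun i => hι (congrFun h2 i))
  have := MvPolynomial.card_common_zeros_le hf hirr hfg e (fun j => (hfc j).trans hδe) hgc
    (B.image ι) (S.image ψ)
    (by
      intro z hz i
      obtain ⟨w, hw, rfl⟩ := Finset.mem_image.1 hz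
      exact Finset.mem_image_of_mem _ ((hB _).2 (hSn w hw i)))
    (by
      intro z hz
      obtain ⟨w, hw, rfl⟩ := Finset.mem_image.1 hz
      exact hSf w hw)
    (by
      intro z hz
      obtain ⟨w, hw, rfl⟩ := Finset.mem_image.1 hz
      exact hSg w hw)
  rw [Finset.card_image_of_injective _ hψ, Finset.card_image_of_injective _ hι, hBcard, hfδ]
    at this
  refine this.trans ?_
  gcongr

/-- The points in a box on the irreducible plane sections of a hypersurface in a given
direction. -/
theorem card_box_irreducible_slices_le [Fintype F] {r n δ d : ℕ}
    {f : (MvPolynomial (Fin (r + 1)) K)[X]} (hι : Function.Injective ι) (hn : 0 < n)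
    (hδ : 0 < δ) (hd : n ≤ d * δ) (hdn : d ≤ n) (hchar : (δ : K) ≠ 0)
    (hq : 2 * primesNeeded δ ≤ Fintype.card F) (hf : f.Monic) (hfδ : f.natDegree = δ)
    (hfc : ∀ j, (f.coeff j).totalDegree ≤ δ) (a : Fin (r + 1) → F) (ha : a 0 ≠ 0)
    (S : Finset (F[X] × (Fin (r + 1) → F[X])))
    (hSn : ∀ z ∈ S, z.1.natDegree < n ∧ ∀ i, (z.2 i).natDegree < n)
    (hSf : ∀ z ∈ S, (f.map (MvPolynomial.eval fun i => ι (z.2 i))).eval (ι z.1) = 0)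
    (hSirr : ∀ z ∈ S, Irreducible (slice f (fun i => ι (z.2 i)) (fun i => ι (C (a i))))) :
    S.card ≤ curveConst δ * n * Fintype.card F ^ d * (Fintype.card F ^ n) ^ r := by
  classical
  obtain ⟨B, hB, hBcard⟩ := exists_finset_natDegree_lt (F := F) hn
  let τ : F[X] × (Fin (r + 1) → F[X]) → F[X] := fun z => C (a 0)⁻¹ * z.2 0
  let π : F[X] × (Fin (r + 1) → F[X]) → Fin r → F[X] :=
    fun z i => z.2 i.succ - C (a i.succ) * τ z
  have hτ : ∀ z ∈ S, (τ z).natDegree < n :=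
    fun z hz => (natDegree_C_mul_le _ _).trans_lt ((hSn z hz).2 0)
  have hz2 : ∀ z, z.2 = fun i => (Fin.cons 0 (π z) : Fin (r + 1) → F[X]) i + τ z * C (a i) := by
    intro z
    ext1 i
    refine Fin.cases ?_ (fun i => ?_) i
    · simp only [Fin.cons_zero, zero_add, τ]
      rw [mul_right_comm, ← C_mul, inv_mul_cancel₀ ha, C_1, one_mul]
    · simp only [Fin.cons_succ, π]
      ring
  have hπ : ∀ z ∈ S, π z ∈ Fintype.piFinset fun _ : Fin r => B := by
    intro z hz
    refine Fintype.mem_piFinset.2 fun i => (hB _).2 ?_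
    refine (natDegree_sub_le _ _).trans_lt (max_lt ((hSn z hz).2 _) ?_)
    exact (natDegree_C_mul_le _ _).trans_lt (hτ z hz)
  have hcard : (Fintype.piFinset fun _ : Fin r => B).card = (Fintype.card F ^ n) ^ r := by
    rw [Fintype.card_piFinset_const, hBcard]
  rw [← hcard]
  refine Finset.card_le_mul_card_image_of_maps_to hπ _ fun w _ => ?_
  set G := {z ∈ S | π z = w} with hG
  rcases G.eq_empty_or_nonempty with hGe | ⟨z₀, hz₀⟩
  · rw [hGe]; simp
  let y : Fin (r + 1) → K := fun i => ι ((Fin.cons 0 w : Fin (r + 1) → F[X]) i)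
  have hy : ∀ z ∈ G, (fun i => ι (z.2 i)) = fun i => y i + ι (τ z) * ι (C (a i)) := by
    intro z hz
    rw [hG, Finset.mem_filter] at hz
    ext1 i
    rw [congrFun (hz2 z) i, hz.2, map_add, map_mul]
  have hinj : Set.InjOn (fun z => (z.1, τ z)) (G : Set (F[X] × (Fin (r + 1) → F[X]))) := by
    intro z hz z' hz' h
    rw [hG, Finset.mem_coe, Finset.mem_filter] at hz hz'
    obtain ⟨h1, h2⟩ := Prod.ext_iff.1 h
    refine Prod.ext h1 ?_
    simp only at h2
    rw [hz2 z, hz2 z', hz.2, hz'.2, h2]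
  rw [← Finset.card_image_of_injOn hinj]
  refine card_box_zeros_le (f := slice f y fun i => ι (C (a i))) hι hn hδ hd hdn hchar hq
    (hf.slice _ _) ?_ (by rw [hf.natDegree_slice, hfδ]) (natDegree_coeff_slice_le hfc _ _) _ ?_ ?_
  · have := hSirr z₀ (Finset.mem_filter.1 hz₀).1
    rw [hy z₀ hz₀, slice_translate] at this
    exact Monic.irreducible_of_irreducible_map _ _ (hf.slice _ _) this
  · intro v hv
    obtain ⟨z, hz, rfl⟩ := Finset.mem_image.1 hv
    have hzS := (Finset.mem_filter.1 hz).1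
    exact ⟨(hSn z hzS).1, hτ z hzS⟩
  · intro v hv
    obtain ⟨z, hz, rfl⟩ := Finset.mem_image.1 hv
    have hzS := (Finset.mem_filter.1 hz).1
    rw [evalEval_slice, ← hy z hz]
    exact hSf z hzS

/-- The constant in the bound for the number of points in a box on a hypersurface. -/
noncomputable def hypersurfaceConst (δ : ℕ) : ℕ :=
  δ * ((δ + (minorDegree δ * δ + δ)) * (minorDegree δ * δ + δ)) + curveConst δ

/-- The number of points in a box on an irreducible hypersurface given by a monic equation. -/
theorem card_box_zeros_hypersurface_le [Fintype F] {r n δ d : ℕ}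
    {f : (MvPolynomial (Fin (r + 1)) K)[X]} (hι : Function.Injective ι) (hn : 0 < n)
    (hδ : 0 < δ) (hd : n ≤ d * δ) (hdn : d ≤ n)
    (hchar : ∀ i, 0 < i → i < derivativesNeeded δ → (i : K) ≠ 0)
    (hq : 2 * primesNeeded δ ≤ Fintype.card F) (hq' : minorDegree δ * δ + 1 < Fintype.card F)
    (hf : f.Monic) (hirr : Irreducible f) (hfδ : f.natDegree = δ)
    (hfc : ∀ j, (f.coeff j).totalDegree ≤ δ)
    (S : Finset (F[X] × (Fin (r + 1) → F[X])))
    (hSn : ∀ z ∈ S, z.1.natDegree < n ∧ ∀ i, (z.2 i).natDegree < n)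
    (hSf : ∀ z ∈ S, (f.map (MvPolynomial.eval fun i => ι (z.2 i))).eval (ι z.1) = 0) :
    S.card ≤ hypersurfaceConst δ * n * Fintype.card F ^ d * (Fintype.card F ^ n) ^ r := by
  classical
  have hδK : (δ : K) ≠ 0 := hchar δ hδ (by unfold derivativesNeeded; nlinarith)
  set e := minorDegree δ * δ + δ with he
  have hbez : ∀ g : (MvPolynomial (Fin (r + 1)) K)[X], ¬ f ∣ g → g.natDegree ≤ e →
      (∀ j, (g.coeff j).totalDegree ≤ e) → ∀ T ⊆ S,
      (∀ z ∈ T, (g.map (MvPolynomial.eval fun i => ι (z.2 i))).eval (ι z.1) = 0) →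
      T.card ≤ δ * ((δ + e) * e) * n * Fintype.card F ^ d * (Fintype.card F ^ n) ^ r := by
    intro g hfg hge hgc T hT hTg
    refine (card_box_common_zeros_hypersurface_le hι hn hf hirr hfδ hfc hfg hge hgc (by omega) T
      (fun z hz => (hSn z (hT hz)).2) (fun z hz => hSf z (hT hz)) hTg).trans ?_
    refine Nat.mul_le_mul_right _ ?_
    rw [mul_assoc _ n]
    exact Nat.le_mul_of_pos_right _ (Nat.mul_pos hn (pow_pos Fintype.card_pos _))
  have hconst : hypersurfaceConst δ * n * Fintype.card F ^ d * (Fintype.card F ^ n) ^ r =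
      δ * ((δ + e) * e) * n * Fintype.card F ^ d * (Fintype.card F ^ n) ^ r +
      curveConst δ * n * Fintype.card F ^ d * (Fintype.card F ^ n) ^ r := by
    rw [hypersurfaceConst, ← he]
    ring
  rw [hconst]
  by_cases hsing : ∀ z ∈ S,
      (f.derivative.map (MvPolynomial.eval fun i => ι (z.2 i))).eval (ι z.1) = 0
  · refine (hbez f.derivative ?_ ?_ ?_ S subset_rfl hsing).trans (Nat.le_add_right _ _)
    · refine hf.not_dvd_of_natDegree_lt ?_ (natDegree_derivative_lt (by omega))
      intro h
      have := congrArg (fun p => p.coeff (δ - 1)) h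
      simp only [coeff_derivative, coeff_zero] at this
      rw [Nat.sub_add_cancel hδ, ← hfδ, hf.coeff_natDegree, one_mul, hfδ] at this
      rw [← Nat.cast_succ, Nat.succ_eq_add_one, Nat.sub_add_cancel hδ,
        ← map_natCast (MvPolynomial.C : K →+* _), MvPolynomial.C_eq_zero] at this
      exact hδK this
    · exact (natDegree_derivative_le _).trans (by omega)
    · intro j
      rw [coeff_derivative]
      refine (MvPolynomial.totalDegree_mul _ _).trans ?_
      have h1 := hfc (j + 1)
      have h2 : ((j : MvPolynomial (Fin (r + 1)) K) + 1).totalDegree = 0 := by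
        rw [← Nat.cast_succ, ← map_natCast (MvPolynomial.C : K →+* _),
          MvPolynomial.totalDegree_C]
      omega
  · push Not at hsing
    obtain ⟨z₀, hz₀, hz₀'⟩ := hsing
    have hιC : Function.Injective fun c : F => ι (C c) := hι.comp C_injective
    obtain ⟨a, haS, ha0, g, hfg, hgd, hgc, hg⟩ := exists_irreducible_slices hf hirr hfδ hδ hfc
      hchar (hSf z₀ hz₀) hz₀' (Finset.univ.image fun c : F => ι (C c))
      (by rwa [Finset.card_image_of_injective _ hιC])
    choose b _ hb using fun i => Finset.mem_image.1 (haS i)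
    have hab : a = fun i => ι (C (b i)) := _root_.funext fun i => (hb i).symm
    rw [← Finset.card_filter_add_card_filter_not (s := S)
      (fun z => (g.map (MvPolynomial.eval fun i => ι (z.2 i))).eval (ι z.1) = 0)]
    refine add_le_add (hbez g hfg (by omega) (fun j => (hgc j).trans (by omega)) _
      (Finset.filter_subset _ _) fun z hz => (Finset.mem_filter.1 hz).2) ?_
    refine card_box_irreducible_slices_le hι hn hδ hd hdn hδK hq hf hfδ hfc b ?_ _
      (fun z hz => hSn z (Finset.mem_filter.1 hz).1) (fun z hz => hSf z (Finset.mem_filter.1 hz).1)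
      fun z hz => ?_
    · intro h
      rw [hab] at ha0
      simp [h] at ha0
    · obtain ⟨hzS, hzg⟩ := Finset.mem_filter.1 hz
      rw [← hab]
      exact hg _ _ (hSf z hzS) hzg

end Slicing

end Polynomial

namespace MvPolynomial

theorem coeff_aeval_C_mul_X {R σ : Type*} [CommRing R] (f : MvPolynomial σ R) (a : σ → R)
    (k : ℕ) : (aeval (fun i => Polynomial.C (a i) * Polynomial.X) f : Polynomial R).coeff k =
      eval a (homogeneousComponent k f) := by
  classical
  rw [homogeneousComponent_apply, map_sum, Finset.sum_filter, aeval_def, eval₂_eq,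
    Polynomial.finsetSum_coeff]
  refine Finset.sum_congr rfl fun d _ => ?_
  simp only [mul_pow, Finset.prod_mul_distrib, ← Polynomial.C_pow]
  rw [Finset.prod_pow_eq_pow_sum, ← map_prod, Polynomial.algebraMap_apply, Algebra.algebraMap_self,
    RingHom.id_apply, Polynomial.coeff_C_mul, Polynomial.coeff_C_mul_X_pow, eval_monomial]
  simp only [eq_comm (a := k), Finsupp.degree_apply, Finsupp.prod]
  split_ifs <;> simp_all

theorem homogeneousComponent_totalDegree_ne_zero {R σ : Type*} [CommRing R]
    {f : MvPolynomial σ R} (hf : f ≠ 0) : homogeneousComponent f.totalDegree f ≠ 0 := by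
  classical
  obtain ⟨d, hd, hdeg⟩ := Finset.exists_mem_eq_sup f.support (support_nonempty.2 hf)
    fun s => s.sum fun _ e => e
  intro h
  have := congrArg (coeff d) h
  rw [coeff_homogeneousComponent, if_pos (by rw [totalDegree, hdeg]; rfl), coeff_zero] at this
  exact mem_support_iff.1 hd this

section Shear

variable {K : Type*} [Field K] {r : ℕ}

/-- The linear change of coordinates `x ↦ x₀ a + (0, x₁, …)`. -/
noncomputable def shear (a : Fin (r + 1) → K) :
    MvPolynomial (Fin (r + 1)) K →ₐ[K] MvPolynomial (Fin (r + 1)) K :=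
  aeval (Fin.cons (C (a 0) * X 0) fun i => X i.succ + C (a i.succ) * X 0)

theorem shear_bijective {a : Fin (r + 1) → K} (ha : a 0 ≠ 0) : Function.Bijective (shear a) := by
  have hC : ∀ c, (C c : MvPolynomial (Fin (r + 1)) K) = algebraMap K _ c := fun _ => rfl
  let e : MvPolynomial (Fin (r + 1)) K ≃ₐ[K] MvPolynomial (Fin (r + 1)) K :=
    AlgEquiv.ofAlgHom (shear a)
    (aeval (Fin.cons (C (a 0)⁻¹ * X 0) fun i => X i.succ - C (a i.succ) * (C (a 0)⁻¹ * X 0)))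
    (by
      refine algHom_ext fun i => ?_
      have hinv : C (a 0)⁻¹ * C (a 0) = (1 : MvPolynomial (Fin (r + 1)) K) := by
        rw [← C_mul, inv_mul_cancel₀ ha, C_1]
      rw [hC, hC] at hinv
      refine Fin.cases ?_ (fun i => ?_) i
      · simp only [shear, AlgHom.comp_apply, aeval_X, Fin.cons_zero, map_mul, hC, AlgHom.commutes,
          ← mul_assoc, hinv, AlgHom.id_apply, one_mul]
      · simp only [shear, AlgHom.comp_apply, aeval_X, Fin.cons_zero, Fin.cons_succ, map_mul,
          map_sub, hC, AlgHom.commutes, AlgHom.id_apply]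
        linear_combination (-algebraMap K _ (a i.succ) * X 0) * hinv)
    (by
      refine algHom_ext fun i => ?_
      have hinv : C (a 0)⁻¹ * C (a 0) = (1 : MvPolynomial (Fin (r + 1)) K) := by
        rw [← C_mul, inv_mul_cancel₀ ha, C_1]
      rw [hC, hC] at hinv
      refine Fin.cases ?_ (fun i => ?_) i
      · simp only [shear, AlgHom.comp_apply, aeval_X, Fin.cons_zero, map_mul, hC, AlgHom.commutes,
          AlgHom.id_apply]
        linear_combination (X 0) * hinv
      · simp only [shear, AlgHom.comp_apply, aeval_X, Fin.cons_zero, Fin.cons_succ, map_mul,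
          map_add, hC, AlgHom.commutes, AlgHom.id_apply]
        ring)
  exact e.bijective

theorem irreducible_shear {a : Fin (r + 1) → K} (ha : a 0 ≠ 0)
    {f : MvPolynomial (Fin (r + 1)) K} (hf : Irreducible f) : Irreducible (shear a f) :=
  (MulEquiv.irreducible_iff (AlgEquiv.ofBijective (shear a) (shear_bijective ha))).2 hf

theorem totalDegree_shear_le (a : Fin (r + 1) → K) (f : MvPolynomial (Fin (r + 1)) K) :
    (shear a f).totalDegree ≤ f.totalDegree := by
  have hX : ∀ (c : K) (i : Fin (r + 1)), (C c * X i : MvPolynomial _ K).totalDegree ≤ 1 := by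
    intro c i
    refine (totalDegree_mul _ _).trans ?_
    simp
  refine ((IsDegreeLike.totalDegree _ K).eval₂_le (algebraMap K _) (by simp)
    _ 1 (fun i => ?_) f).trans (by simp)
  refine Fin.cases ?_ (fun i => ?_) i
  · exact hX _ _
  · exact (totalDegree_add _ _).trans (max_le (by simp) (hX _ _))

theorem eval_shear (a : Fin (r + 1) → K) (f : MvPolynomial (Fin (r + 1)) K)
    (x : Fin (r + 1) → K) : eval x (shear a f) =
      eval (Fin.cons (a 0 * x 0) fun i => x i.succ + a i.succ * x 0) f := by
  have : (aeval x : MvPolynomial (Fin (r + 1)) K →ₐ[K] K).comp (shear a) =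
      aeval (Fin.cons (a 0 * x 0) fun i => x i.succ + a i.succ * x 0) := by
    refine algHom_ext fun i => ?_
    refine Fin.cases ?_ (fun i => ?_) i <;> simp [shear]
  exact congrArg (fun φ : MvPolynomial (Fin (r + 1)) K →ₐ[K] K => φ f) this

theorem totalDegree_coeff_finSuccEquiv_le (f : MvPolynomial (Fin (r + 1)) K) (i : ℕ) :
    ((finSuccEquiv K r f).coeff i).totalDegree ≤ f.totalDegree := by
  by_cases hi : (finSuccEquiv K r f).coeff i = 0
  · simp [hi]
  · exact (Nat.le_add_right _ _).trans (totalDegree_coeff_finSuccEquiv_add_le f i hi)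

theorem coeff_finSuccEquiv_shear (a : Fin (r + 1) → K) (f : MvPolynomial (Fin (r + 1)) K)
    {δ : ℕ} (hδ : f.totalDegree = δ) :
    (finSuccEquiv K r (shear a f)).coeff δ = C (eval a (homogeneousComponent δ f)) := by
  set p := finSuccEquiv K r (shear a f) with hp
  have hconst : p.coeff δ = C ((p.coeff δ).coeff 0) := by
    rw [← totalDegree_eq_zero_iff_eq_C]
    by_cases h : p.coeff δ = 0
    · simp [h]
    · have h1 := totalDegree_coeff_finSuccEquiv_add_le _ δ h
      have h2 := totalDegree_shear_le a f
      rw [← hp] at h1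
      omega
  have hline : p.map (eval 0) = aeval (fun i => Polynomial.C (a i) * Polynomial.X) f := by
    have hC : ∀ c : K, finSuccEquiv K r (C c) = Polynomial.C (C c) := (finSuccEquiv K r).commutes
    have : ((Polynomial.mapAlgHom (aeval 0 : MvPolynomial (Fin r) K →ₐ[K] K)).comp
        (finSuccEquiv K r).toAlgHom).comp (shear a) =
        aeval (fun i => Polynomial.C (a i) * Polynomial.X) := by
      refine algHom_ext fun i => ?_
      refine Fin.cases ?_ (fun i => ?_) i <;>
        simp [shear, hC, finSuccEquiv_X_zero, finSuccEquiv_X_succ]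
    exact congrArg (fun φ : MvPolynomial (Fin (r + 1)) K →ₐ[K] Polynomial K => φ f) this
  rw [← coeff_aeval_C_mul_X, ← hline, Polynomial.coeff_map, hconst, eval_C]

end Shear

end MvPolynomial

namespace MvPolynomial

open Polynomial (derivativesNeeded primesNeeded minorDegree hypersurfaceConst)

/-- The number of points in a box on an irreducible hypersurface. -/
theorem card_box_zeros_le {F K : Type*} [Field F] [Field K] [Fintype F]
    {ι : Polynomial F →+* K} {r n δ d : ℕ} {f : MvPolynomial (Fin (r + 2)) K}
    (hι : Function.Injective ι) (hn : 0 < n) (hδ : 0 < δ) (hd : n ≤ d * δ) (hdn : d ≤ n)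
    (hchar : ∀ i, 0 < i → i < derivativesNeeded δ → (i : K) ≠ 0)
    (hq : 2 * primesNeeded δ ≤ Fintype.card F) (hq' : minorDegree δ * δ + 1 < Fintype.card F)
    (hqδ : δ + 1 < Fintype.card F) (hirr : Irreducible f) (hfδ : f.totalDegree = δ)
    (S : Finset (Fin (r + 2) → Polynomial F)) (hSn : ∀ z ∈ S, ∀ i, (z i).natDegree < n)
    (hSf : ∀ z ∈ S, eval (fun i => ι (z i)) f = 0) :
    S.card ≤ hypersurfaceConst δ * n * Fintype.card F ^ d * (Fintype.card F ^ n) ^ r := by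
  classical
  have hιC : Function.Injective fun c : F => ι (Polynomial.C c) :=
    hι.comp Polynomial.C_injective
  obtain ⟨b, hb0, hbf⟩ : ∃ b : Fin (r + 2) → F, b 0 ≠ 0 ∧
      eval (fun i => ι (Polynomial.C (b i))) (homogeneousComponent δ f) ≠ 0 := by
    set P := X 0 * homogeneousComponent δ f with hP
    have hP0 : P ≠ 0 := mul_ne_zero (X_ne_zero _)
      (hfδ ▸ homogeneousComponent_totalDegree_ne_zero hirr.ne_zero)
    have hPdeg : P.totalDegree ≤ δ + 1 := by
      refine (totalDegree_mul _ _).trans ?_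
      rw [totalDegree_X]
      have := (homogeneousComponent_isHomogeneous δ f).totalDegree_le
      omega
    have hcount := card_zeros_le hP0 (Finset.univ.image fun c : F => ι (Polynomial.C c))
    by_contra! H
    rw [Finset.filter_true_of_mem, Fintype.card_piFinset_const, pow_succ',
      Finset.card_image_of_injective _ hιC, Finset.card_univ] at hcount
    · have := Nat.le_of_mul_le_mul_right hcount (pow_pos (by omega) _)
      omega
    · intro a ha
      choose b _ hb using fun i => Finset.mem_image.1 (Fintype.mem_piFinset.1 ha i)
      obtain rfl : (fun i => ι (Polynomial.C (b i))) = a := _root_.funext hb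
      rw [hP, map_mul, eval_X]
      by_cases h : b 0 = 0
      · simp [h]
      · rw [H b h, mul_zero]
  set a : Fin (r + 2) → K := fun i => ι (Polynomial.C (b i)) with ha
  have ha0 : a 0 ≠ 0 := fun h => hb0 (hιC (by simpa [ha] using h))
  set c := eval a (homogeneousComponent δ f) with hc
  set p := finSuccEquiv K (r + 1) (shear a f) with hp
  have hpδ : p.coeff δ = C c := coeff_finSuccEquiv_shear a f hfδ
  have hpdeg : p.natDegree ≤ δ := by
    rw [hp, natDegree_finSuccEquiv]
    exact (degreeOf_le_totalDegree _ _).trans ((totalDegree_shear_le a f).trans hfδ.le)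
  have hpc : ∀ j, (p.coeff j).totalDegree ≤ δ := fun j =>
    (totalDegree_coeff_finSuccEquiv_le _ _).trans ((totalDegree_shear_le a f).trans hfδ.le)
  have hpirr : Irreducible p :=
    (MulEquiv.irreducible_iff (finSuccEquiv K (r + 1))).2 (irreducible_shear ha0 hirr)
  set g := Polynomial.C (C c⁻¹) * p with hg
  have hgδ : g.coeff δ = 1 := by
    rw [hg, Polynomial.coeff_C_mul, hpδ, ← C_mul, inv_mul_cancel₀ hbf, C_1]
  have hgdeg : g.natDegree ≤ δ := (Polynomial.natDegree_C_mul_le _ _).trans hpdeg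
  have hgmonic : g.Monic := Polynomial.monic_of_natDegree_le_of_coeff_eq_one δ hgdeg hgδ
  have hgirr : Irreducible g := by
    refine (irreducible_isUnit_mul ?_).2 hpirr
    exact ((inv_ne_zero hbf).isUnit.map C).map Polynomial.C
  let ψ : (Fin (r + 2) → Polynomial F) → Polynomial F × (Fin (r + 1) → Polynomial F) :=
    fun z => (Polynomial.C (b 0)⁻¹ * z 0,
      fun i => z i.succ - Polynomial.C (b i.succ) * (Polynomial.C (b 0)⁻¹ * z 0))
  have hz : ∀ z : Fin (r + 2) → Polynomial F, z = Fin.cons (Polynomial.C (b 0) * (ψ z).1)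
      fun i => (ψ z).2 i + Polynomial.C (b i.succ) * (ψ z).1 := by
    intro z
    ext1 i
    refine Fin.cases ?_ (fun i => ?_) i
    · simp only [Fin.cons_zero, ψ]
      rw [← mul_assoc, ← Polynomial.C_mul, mul_inv_cancel₀ hb0, Polynomial.C_1, one_mul]
    · simp only [Fin.cons_succ, ψ]
      ring
  have hψ : Function.Injective ψ := fun z z' h => by rw [hz z, hz z', h]
  rw [← Finset.card_image_of_injective S hψ]
  refine Polynomial.card_box_zeros_hypersurface_le hι hn hδ hd hdn hchar hq hq' hgmonic hgirr
    ?_ ?_ _ ?_ ?_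
  · exact Polynomial.natDegree_eq_of_le_of_coeff_ne_zero hgdeg (by rw [hgδ]; exact one_ne_zero)
  · intro j
    rw [hg, Polynomial.coeff_C_mul]
    refine (totalDegree_mul _ _).trans ?_
    simpa using hpc j
  · intro v hv
    obtain ⟨z, hzS, rfl⟩ := Finset.mem_image.1 hv
    have h0 : (ψ z).1.natDegree < n :=
      (Polynomial.natDegree_C_mul_le _ _).trans_lt (hSn z hzS 0)
    refine ⟨h0, fun i => ?_⟩
    refine (Polynomial.natDegree_sub_le _ _).trans_lt (max_lt (hSn z hzS _) ?_)
    exact (Polynomial.natDegree_C_mul_le _ _).trans_lt h0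
  · intro v hv
    obtain ⟨z, hzS, rfl⟩ := Finset.mem_image.1 hv
    rw [hg, Polynomial.map_mul, Polynomial.eval_mul, hp, ← eval_eq_eval_mv_eval', eval_shear]
    have := hSf z hzS
    rw [hz z] at this
    convert mul_zero _
    rw [← this]
    congr 2
    ext1 i
    refine Fin.cases ?_ (fun i => ?_) i <;> simp [ha]

end MvPolynomial

theorem Nat.Prime.natCast_ne_zero_of_lt {F : Type*} [Field F] [Fintype F] {p α : ℕ}
    (hp : p.Prime) (hF : Fintype.card F = p ^ α) {i : ℕ} (hi : 0 < i) (hip : i < p) :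
    (i : F) ≠ 0 := by
  obtain ⟨l, hl, k, hlp, hk⟩ := FiniteField.card' F
  have : l = p := by
    refine (Nat.prime_dvd_prime_iff_eq hlp hp).1 (hlp.dvd_of_dvd_pow (n := α) ?_)
    rw [← hF, hk]
    exact dvd_pow_self _ k.pos.ne'
  subst this
  rw [Ne, CharP.cast_eq_zero_iff F l]
  exact Nat.not_dvd_of_pos_of_lt hi hip

/-- For all positive integers `m ≥ 2` and `δ` there exist a real number
`C = C(m,δ)` and an integer `N = N(m,δ)` such that for every prime `p > N`, every prime power
`q = p^α`, every integer `n > 0`, and every irreducible polynomial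
`f ∈ F_q((t))[X_1,…,X_m]` of total degree `δ`, the number of `m`-tuples `x ∈ (F_q[t]_n)^m`
with `f(x) = 0` is at most `C · n² · q^{n(m−2) + ⌈n/δ⌉}`. -/
theorem points_of_bounded_degree_on_hypersurfaces (m δ : ℕ) (hm : 2 ≤ m) (hδ : 0 < δ) :
    ∃ (C : ℝ) (N : ℕ), ∀ (p : ℕ), p.Prime → N < p →
      ∀ (α : ℕ), 1 ≤ α →
      ∀ (F : Type) [Field F] [Fintype F], Fintype.card F = p ^ α →
      ∀ (n : ℕ), 0 < n →
      ∀ f : MvPolynomial (Fin m) (LaurentSeries F),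
        Irreducible f → f.totalDegree = δ →
        (Set.ncard {z : Fin m → Polynomial F |
            (∀ i, (z i).degree < (n : WithBot ℕ)) ∧
            MvPolynomial.eval
              (fun i => (HahnSeries.ofPowerSeries ℤ F ((z i : PowerSeries F)))) f = 0} : ℝ)
          ≤ C * (n : ℝ) ^ 2 * ((p : ℝ) ^ α) ^ (n * (m - 2) + ⌈(n : ℚ) / (δ : ℚ)⌉₊) := by
  classical
  obtain ⟨r, rfl⟩ : ∃ r, m = r + 2 := ⟨m - 2, by omega⟩
  refine ⟨Polynomial.hypersurfaceConst δ, 2 * Polynomial.primesNeeded δ +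
    (Polynomial.minorDegree δ * δ + 1) + (δ + 1) + Polynomial.derivativesNeeded δ, ?_⟩
  intro p hp hN α hα F _ _ hF n hn f hirr hfδ
  have hpF : p ≤ Fintype.card F := hF ▸ Nat.le_self_pow (by omega) p
  set d := ⌈(n : ℚ) / (δ : ℚ)⌉₊ with hd
  have hδQ : (0 : ℚ) < δ := by exact_mod_cast hδ
  have hnd : n ≤ d * δ := by
    have := Nat.le_ceil ((n : ℚ) / (δ : ℚ))
    rw [div_le_iff₀ hδQ] at this
    exact_mod_cast this
  have hdn : d ≤ n := by
    rw [hd, Nat.ceil_le]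
    refine div_le_self (by positivity) ?_
    exact_mod_cast hδ
  let ι : Polynomial F →+* LaurentSeries F :=
    (HahnSeries.ofPowerSeries ℤ F).comp Polynomial.coeToPowerSeries.ringHom
  have hι : Function.Injective ι :=
    HahnSeries.ofPowerSeries_injective.comp (Polynomial.coe_injective F)
  have hchar : ∀ i, 0 < i → i < Polynomial.derivativesNeeded δ → (i : LaurentSeries F) ≠ 0 := by
    intro i hi hi'
    have h := hp.natCast_ne_zero_of_lt hF hi (by omega)
    have := (map_ne_zero (ι.comp Polynomial.C)).2 h
    rwa [map_natCast] at this
  obtain ⟨B, hB, -⟩ := Polynomial.exists_finset_natDegree_lt (F := F) hn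
  set Z := {z ∈ Fintype.piFinset fun _ : Fin (r + 2) => B |
    MvPolynomial.eval (fun i => ι (z i)) f = 0} with hZ
  have hset : {z : Fin (r + 2) → Polynomial F |
      (∀ i, (z i).degree < (n : WithBot ℕ)) ∧ MvPolynomial.eval
        (fun i => (HahnSeries.ofPowerSeries ℤ F ((z i : PowerSeries F)))) f = 0} = Z := by
    ext z
    simp only [Set.mem_ofPred_eq, hZ, Finset.coe_filter, Fintype.mem_piFinset, hB,
      Polynomial.natDegree_lt_iff_degree_lt_of_pos hn]
    rfl
  rw [hset, Set.ncard_coe_finset]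
  have hcard := MvPolynomial.card_box_zeros_le hι hn hδ hnd hdn hchar (by omega) (by omega)
    (by omega) hirr hfδ Z
    (fun z hz i => (hB _).1 (Fintype.mem_piFinset.1 (Finset.mem_filter.1 hz).1 i))
    (fun z hz => (Finset.mem_filter.1 hz).2)
  have hcard' : (Z.card : ℝ) ≤ Polynomial.hypersurfaceConst δ * n *
      ((p : ℝ) ^ α) ^ (n * r + d) := by
    rw [hF] at hcard
    calc (Z.card : ℝ) ≤ ((Polynomial.hypersurfaceConst δ * n * (p ^ α) ^ d *
          ((p ^ α) ^ n) ^ r : ℕ) : ℝ) := by exact_mod_cast hcard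
      _ = _ := by push_cast; ring
  refine hcard'.trans ?_
  have hn1 : (1 : ℝ) ≤ n := by exact_mod_cast hn
  rw [Nat.add_sub_cancel]
  gcongr
  nlinarith
end
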